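/- Let X ⊂ P^{n+c} be a nondegenerate irreducible projective variety with c ≥ 4 and degree d = c+3 such that a₂(X) = C(c+1,2) − 3. Then the arithmetic depth of X equals n (its dimension). -/

import Mathlib

/-!
Common framework: a projective variety `X ⊆ ℙ^N` over a field `k` is represented by its
affine cone `C ⊆ (ι → k)` (with `ι` the index type of homogeneous coordinates,
`Fintype.card ι = N + 1`).  All projective notions (vanishing ideal, `a₂`, Hilbert
function, dimension, degree, depth, base locus of quadrics, irreducible components,
scrolls and divisors on them, sectional genus, maximal sectional regularity) are
defined concretely below.
-/

open MvPolynomial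

noncomputable section

namespace PaperQuadrics

variable (k : Type) [Field k] (ι : Type) [Fintype ι] [DecidableEq ι]

/-- The vanishing ideal of a subset `C` of the affine cone `ι → k`. -/
def vanIdeal (C : Set (ι → k)) : Ideal (MvPolynomial ι k) :=
  ⨅ x ∈ C, RingHom.ker (MvPolynomial.eval x)

/-- The degree-`m` graded piece of an ideal of the polynomial ring. -/
def idealPiece (I : Ideal (MvPolynomial ι k)) (m : ℕ) : Submodule k (MvPolynomial ι k) :=
  Submodule.restrictScalars k I ⊓ homogeneousSubmodule ι k m

/-- The space of quadrics vanishing on `C`, i.e. `H⁰(ℙ^N, I_C(2))`. -/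
def quadrics (C : Set (ι → k)) : Submodule k (MvPolynomial ι k) :=
  idealPiece k ι (vanIdeal k ι C) 2

/-- `a₂(C) = h⁰(ℙ^N, I_C(2))`, the number of linearly independent quadrics through `C`. -/
def a2 (C : Set (ι → k)) : ℕ := Module.finrank k (quadrics k ι C)

/-- The Hilbert function of `R/I` in degree `m`. -/
def idealHilb (I : Ideal (MvPolynomial ι k)) (m : ℕ) : ℕ :=
  Module.finrank k (homogeneousSubmodule ι k m) - Module.finrank k (idealPiece k ι I m)

/-- The Hilbert function of the homogeneous coordinate ring of `C`. -/
def hilb (C : Set (ι → k)) (m : ℕ) : ℕ := idealHilb k ι (vanIdeal k ι C) m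

/-- `C ⊆ ι → k` is the affine cone of an irreducible projective variety:
it is a Zariski-closed cone whose vanishing ideal is prime. -/
structure IsProjVariety (C : Set (ι → k)) : Prop where
  zero_mem : (0 : ι → k) ∈ C
  smul_mem : ∀ x ∈ C, ∀ t : k, t • x ∈ C
  closed : C = {x | ∀ f ∈ vanIdeal k ι C, MvPolynomial.eval x f = 0}
  prime : (vanIdeal k ι C).IsPrime

/-- Nondegenerate: no nonzero linear form vanishes identically on `C`. -/
def Nondeg (C : Set (ι → k)) : Prop :=
  ∀ f ∈ homogeneousSubmodule ι k 1, (∀ x ∈ C, MvPolynomial.eval x f = 0) → f = 0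

/-- The projective variety with cone `C` has dimension `n`
(so the affine cone has Krull dimension `n + 1`). -/
def HasDim (C : Set (ι → k)) (n : ℕ) : Prop :=
  ringKrullDim (MvPolynomial ι k ⧸ vanIdeal k ι C) = (n + 1 : ℕ)

/-- `C` (of projective dimension `n`) has degree `d`:
the Hilbert function satisfies `hF(m) · n! / mⁿ → d`. -/
def HasDegree (C : Set (ι → k)) (n d : ℕ) : Prop :=
  Filter.Tendsto (fun m : ℕ => (hilb k ι C m : ℝ) * (Nat.factorial n : ℝ) / (m : ℝ) ^ n)
    Filter.atTop (nhds (d : ℝ))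

/-- `Q(C)`: the common zero set (base locus) of all quadrics through `C`. -/
def quadZero (C : Set (ι → k)) : Set (ι → k) :=
  {x | ∀ f ∈ quadrics k ι C, MvPolynomial.eval x f = 0}

/-- `fs` is a regular sequence on `R/I`. -/
def IsRegSeqOn (I : Ideal (MvPolynomial ι k)) (fs : List (MvPolynomial ι k)) : Prop :=
  (∀ i : Fin fs.length, ∀ g : MvPolynomial ι k,
      fs.get i * g ∈ I ⊔ Ideal.span {h | ∃ j : Fin fs.length, j < i ∧ fs.get j = h} →
      g ∈ I ⊔ Ideal.span {h | ∃ j : Fin fs.length, j < i ∧ fs.get j = h}) ∧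
  I ⊔ Ideal.span {h | ∃ j : Fin fs.length, fs.get j = h} ≠ ⊤

/-- Arithmetic depth of the homogeneous coordinate ring of `C`: the supremum of lengths of
regular sequences of elements of the irrelevant maximal ideal. -/
def arithDepth (C : Set (ι → k)) : ℕ :=
  sSup {l : ℕ | ∃ fs : List (MvPolynomial ι k), fs.length = l ∧
    (∀ f ∈ fs, MvPolynomial.coeff 0 f = 0) ∧ IsRegSeqOn k ι (vanIdeal k ι C) fs}

/-- `Z` is an irreducible Zariski-closed cone. -/
def IsIrredClosed (Z : Set (ι → k)) : Prop :=
  Z = {x | ∀ f ∈ vanIdeal k ι Z, MvPolynomial.eval x f = 0} ∧ (vanIdeal k ι Z).IsPrime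

/-- `Z` is an irreducible component of `Q`: an irreducible closed subset of `Q`, maximal
among the irreducible closed subsets of `Q`. -/
def IsComponentOf (Z Q : Set (ι → k)) : Prop :=
  IsIrredClosed k ι Z ∧ Z ⊆ Q ∧
    ∀ Z' : Set (ι → k), IsIrredClosed k ι Z' → Z ⊆ Z' → Z' ⊆ Q → Z' = Z

/-- `C` is smooth away from the cone vertex, of codimension `c`: at each nonzero point the
Jacobian of the vanishing ideal has rank `c` (valid criterion in characteristic `0`). -/
def IsSmoothOfCodim (C : Set (ι → k)) (c : ℕ) : Prop :=
  ∀ x ∈ C, x ≠ (0 : ι → k) →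
    Module.finrank k (Submodule.span k
      {v : ι → k | ∃ f ∈ vanIdeal k ι C,
        v = fun i => MvPolynomial.eval x (MvPolynomial.pderiv i f)}) = c

/-- The projective variety with affine cone `C` is a cone (in the projective sense):
there is a vertex point `[v]` such that `C` is stable under the join with `[v]`. -/
def IsConeVariety (C : Set (ι → k)) : Prop :=
  ∃ v ∈ C, v ≠ 0 ∧ ∀ x ∈ C, ∀ s t : k, s • x + t • v ∈ C

/-- `C` (an `n`-dimensional variety of degree `d`) has sectional genus `g`: a general linear
curve section (cut by `n - 1` general hyperplanes) has Hilbert polynomial `d·m + 1 - g`. -/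
def SectionalGenus (n : ℕ) (C : Set (ι → k)) (d g : ℕ) : Prop :=
  ∃ P : MvPolynomial (Fin (n - 1) × ι) k, P ≠ 0 ∧
    ∀ w : Fin (n - 1) → ι → k, MvPolynomial.eval (fun q => w q.1 q.2) P ≠ 0 →
      ∀ᶠ m in Filter.atTop,
        (hilb k ι (C ∩ {x | ∀ j, ∑ i, w j i * x i = 0}) m : ℤ) = d * m + 1 - g

/-- `C` (an `n`-dimensional variety of degree `c + 3`) is a variety of maximal sectional
regularity: there is an `n`-dimensional linear subspace `F(X) = ℙ(L)` such that
`X ∩ F(X)` is (scheme-theoretically) a hypersurface of degree `4` in `F(X) ≅ ℙⁿ`,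
detected by the Hilbert function of the ideal sum. -/
def IsVMSR (n : ℕ) (C : Set (ι → k)) : Prop :=
  ∃ L : Submodule k (ι → k), Module.finrank k L = n + 1 ∧
    ∀ᶠ m in Filter.atTop,
      idealHilb k ι (vanIdeal k ι C ⊔ vanIdeal k ι (L : Set (ι → k))) m =
        Nat.choose (m + n) n - Nat.choose (m - 4 + n) n

end PaperQuadrics

namespace PaperQuadrics

variable {k : Type} [Field k]

/-- The parametrization of the rational normal scroll `S(a₀, …, aₙ)` (so the scroll has
dimension `n + 1`): homogeneous coordinates are indexed by `(i, j)`, `0 ≤ j ≤ aᵢ`,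
and the point of parameters `(s : t) ∈ ℙ¹`, `λ` has coordinates `λᵢ sʲ t^{aᵢ - j}`. -/
def scrollParam (n : ℕ) (a : Fin (n + 1) → ℕ) (s t : k) (lam : Fin (n + 1) → k) :
    ((i : Fin (n + 1)) × Fin (a i + 1)) → k :=
  fun x => lam x.1 * s ^ (x.2 : ℕ) * t ^ (a x.1 - (x.2 : ℕ))

/-- The affine cone of the scroll `S(a₀, …, aₙ) ⊆ ℙ^{n+1+c-1}`, `c = Σ aᵢ`. -/
def scrollCone (n : ℕ) (a : Fin (n + 1) → ℕ) :
    Set (((i : Fin (n + 1)) × Fin (a i + 1)) → k) :=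
  {v | ∃ s t lam, v = scrollParam n a s t lam}

/-- Global sections of `O_Y(A·H + b·F)` on the scroll `Y = S(a₀, …, aₙ)`, realized as
bihomogeneous polynomials in `s, t` (the `ℙ¹`-coordinates) and `T₀, …, Tₙ` (the fiber
coordinates): each monomial has total `T`-degree `A` and `(s,t)`-degree `b + Σ mᵢ aᵢ`. -/
def sectionSpace (k : Type) [Field k] (n : ℕ) (a : Fin (n + 1) → ℕ) (A b : ℤ) :
    Submodule k (MvPolynomial (Fin 2 ⊕ Fin (n + 1)) k) where
  carrier := {F | ∀ m ∈ F.support,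
    ((∑ i, m (Sum.inr i) : ℕ) : ℤ) = A ∧
    ((m (Sum.inl 0) + m (Sum.inl 1) : ℕ) : ℤ)
      = b + ∑ i, (m (Sum.inr i) : ℤ) * (a i : ℤ)}
  add_mem' := by
    intro p q hp hq m hm
    rcases Finset.mem_union.mp (MvPolynomial.support_add hm) with h | h
    · exact hp m h
    · exact hq m h
  zero_mem' := by
    intro m hm
    simp at hm
  smul_mem' := by
    intro c p hp m hm
    exact hp m (MvPolynomial.support_smul hm)

/-- The affine cone of the effective divisor `X ≡ A·H + b·F` on the scroll cut out by a
section `F`: the points of the scroll whose parameters are zeros of `F`. -/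
def divisorCone (n : ℕ) (a : Fin (n + 1) → ℕ)
    (F : MvPolynomial (Fin 2 ⊕ Fin (n + 1)) k) :
    Set (((i : Fin (n + 1)) × Fin (a i + 1)) → k) :=
  {v | ∃ s t lam, v = scrollParam n a s t lam ∧
     MvPolynomial.eval (Sum.elim (fun j : Fin 2 => if j = 0 then s else t) lam) F = 0}

end PaperQuadrics

open PaperQuadrics

namespace GenericProjection

theorem finrank_homogeneousSubmodule (K σ : Type*) [Field K] [Fintype σ] [DecidableEq σ] (m : ℕ) :
    Module.finrank K (homogeneousSubmodule σ K m) = (Fintype.card σ + m - 1).choose m := by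
  rw [homogeneousSubmodule_eq_finsupp_supported]
  rw [LinearEquiv.finrank_eq
    (AddMonoidAlgebra.supportedEquivFinsupp (R := K) (S := K) {d : σ →₀ ℕ | d.degree = m})]
  have h : {d : σ →₀ ℕ | d.degree = m} = ((Finset.univ : Finset σ).finsuppAntidiag m : Set _) := by
    ext d
    simp [Finset.mem_finsuppAntidiag, Finsupp.degree_eq_sum]
  rw [h, Module.finrank_finsupp_self, ← Nat.card_eq_fintype_card, Nat.card_coe_set_eq, Set.ncard_coe_finset,
    Finset.card_finsuppAntidiag_nat_eq_choose, Finset.card_univ]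

theorem map_homogeneousSubmodule {K A J : Type*} [CommRing K] [CommRing A] [Algebra K A]
    (x : J → A) (m : ℕ) :
    (homogeneousSubmodule J K m).map (aeval x).toLinearMap =
      Submodule.span K (Set.range x) ^ m := by
  rw [← homogeneousSubmodule_one_pow, Submodule.map_pow, homogeneousSubmodule_one_eq_span_X,
    Submodule.map_span, ← Set.range_comp]
  congr 3
  ext i
  simp

theorem mem_span_pow_iff {K A J : Type*} [CommRing K] [CommRing A] [Algebra K A]
    (x : J → A) (m : ℕ) (a : A) :
    a ∈ Submodule.span K (Set.range x) ^ m ↔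
      ∃ p : MvPolynomial J K, p.IsHomogeneous m ∧ aeval x p = a := by
  rw [← map_homogeneousSubmodule]
  simp [Submodule.mem_map]

theorem aeval_mem_pow {K A J : Type*} [CommRing K] [CommRing A] [Algebra K A]
    {x : J → A} {m : ℕ} {G : Submodule K A} (hx : ∀ j, x j ∈ G) {p : MvPolynomial J K}
    (hp : p.IsHomogeneous m) : aeval x p ∈ G ^ m := by
  have : Submodule.span K (Set.range x) ^ m ≤ G ^ m :=
    pow_le_pow_left' (Submodule.span_le.2 (by rintro _ ⟨j, rfl⟩; exact hx j)) m
  exact this ((mem_span_pow_iff x m _).2 ⟨p, hp, rfl⟩)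

instance finite_pow {K A : Type*} [Field K] [CommRing A] [Algebra K A]
    (G : Submodule K A) [Module.Finite K G] (m : ℕ) : Module.Finite K (G ^ m : Submodule K A) := by
  rw [Module.Finite.iff_fg]
  exact Submodule.FG.pow ((Module.Finite.iff_fg).1 inferInstance) m

/-- The powers of a subspace of an algebra are in direct sum. -/
def IndepPowers {K A : Type*} [CommRing K] [CommRing A] [Algebra K A] (G : Submodule K A) : Prop :=
  ∀ (s : Finset ℕ) (g : ℕ → A), (∀ m ∈ s, g m ∈ G ^ m) → ∑ m ∈ s, g m = 0 → ∀ m ∈ s, g m = 0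

theorem IndepPowers.eq {K A : Type*} [CommRing K] [CommRing A] [Algebra K A] {G : Submodule K A}
    (h : IndepPowers G) {N : ℕ} {f g : ℕ → A} (hf : ∀ m, f m ∈ G ^ m) (hg : ∀ m, g m ∈ G ^ m)
    (e : ∑ m ∈ Finset.range N, f m = ∑ m ∈ Finset.range N, g m) {m : ℕ} (hm : m < N) :
    f m = g m := by
  have := h (Finset.range N) (fun m => f m - g m) (fun m _ => sub_mem (hf m) (hg m))
    (by rw [Finset.sum_sub_distrib, e, sub_self]) m (Finset.mem_range.2 hm)
  exact sub_eq_zero.1 this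

theorem sum_range_homogeneousComponent {K J : Type*} [CommRing K] (p : MvPolynomial J K) {N : ℕ}
    (hN : p.totalDegree < N) : ∑ m ∈ Finset.range N, homogeneousComponent m p = p := by
  conv_rhs => rw [← sum_homogeneousComponent p]
  symm
  apply Finset.sum_subset
  · intro i hi; simp at hi ⊢; omega
  · intro i _ hi
    apply homogeneousComponent_eq_zero
    simpa [Nat.lt_succ_iff] using hi

/-- Comparing components in a linear relation between elements of one power of `G`. -/
theorem IndepPowers.component {K A I S : Type*} [CommRing K] [CommRing A] [Algebra K A]
    [Fintype S] {G : Submodule K A} (h : IndepPowers G) {y : I → A} (hy : ∀ i, y i ∈ G)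
    {a : ℕ} {g : S → A} (hg : ∀ s, g s ∈ G ^ a) (P : S → MvPolynomial I K)
    (e : ∑ s, aeval y (P s) * g s = 0) (r : ℕ) :
    ∑ s, aeval y (homogeneousComponent r (P s)) * g s = 0 := by
  set N := max (r + 1) (Finset.univ.sup (fun s => (P s).totalDegree) + 1) with hN
  have hlt : ∀ s, (P s).totalDegree < N := fun s => by
    have := Finset.le_sup (f := fun s => (P s).totalDegree) (Finset.mem_univ s)
    omega
  have key := h ((Finset.range N).image (· + a))
    (fun m => ∑ s, aeval y (homogeneousComponent (m - a) (P s)) * g s) ?_ ?_ (r + a) ?_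
  · simpa using key
  · intro m hm
    obtain ⟨r', -, rfl⟩ := Finset.mem_image.1 hm
    refine Submodule.sum_mem _ fun s _ => ?_
    simp only [Nat.add_sub_cancel, pow_add]
    exact Submodule.mul_mem_mul (aeval_mem_pow hy (homogeneousComponent_isHomogeneous _ _)) (hg s)
  · rw [Finset.sum_image (by intro a _ b _ h; simpa using h), Finset.sum_comm, ← e]
    refine Finset.sum_congr rfl fun s _ => ?_
    simp only [Nat.add_sub_cancel]
    rw [← Finset.sum_mul, ← map_sum, sum_range_homogeneousComponent _ (hlt s)]
  · exact Finset.mem_image.2 ⟨r, by simp [hN], rfl⟩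

theorem finrank_span_pow_mul {K E : Type*} [Field K] [Field E] [Algebra K E] {n s : ℕ}
    (y : Fin (n + 1) → E) (g : Fin s → E)
    (hind : ∀ P : Fin s → MvPolynomial (Fin (n + 1)) K,
      ∑ t, aeval y (P t) * g t = 0 → P = 0) (m : ℕ) :
    Module.finrank K (Submodule.span K (Set.range y) ^ m * Submodule.span K (Set.range g) :
      Submodule K E) = s * (m + n).choose n := by
  let φ : (Fin s → homogeneousSubmodule (Fin (n + 1)) K m) →ₗ[K] E :=
    LinearMap.lsum K (fun _ => homogeneousSubmodule (Fin (n + 1)) K m) K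
      (fun t => (LinearMap.mulRight K (g t)) ∘ₗ (aeval y).toLinearMap ∘ₗ Submodule.subtype _)
  have hφ : ∀ P, φ P = ∑ t, aeval y (P t : MvPolynomial (Fin (n + 1)) K) * g t := by
    intro P
    simp [φ, LinearMap.lsum_apply]
  have hinj : Function.Injective φ := by
    rw [← LinearMap.ker_eq_bot, LinearMap.ker_eq_bot']
    intro P hP
    rw [hφ] at hP
    have := hind (fun t => P t) hP
    funext t
    exact Subtype.ext (congrFun this t)
  have hrange : LinearMap.range φ =
      (Submodule.span K (Set.range y) ^ m * Submodule.span K (Set.range g)) := by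
    apply le_antisymm
    · rintro _ ⟨P, rfl⟩
      rw [hφ]
      refine Submodule.sum_mem _ fun t _ => Submodule.mul_mem_mul ?_
        (Submodule.subset_span ⟨t, rfl⟩)
      exact (mem_span_pow_iff _ _ _).2 ⟨_, (P t).2, rfl⟩
    · rw [Submodule.mul_le]
      intro u hu v hv
      obtain ⟨p, hp, rfl⟩ := (mem_span_pow_iff _ _ _).1 hu
      obtain ⟨c, rfl⟩ := (Submodule.mem_span_range_iff_exists_fun K).1 hv
      refine ⟨fun t => c t • ⟨p, hp⟩, ?_⟩
      rw [hφ, Finset.mul_sum]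
      refine Finset.sum_congr rfl fun t _ => ?_
      simp [Algebra.smul_def]
      ring
  have hfin : Module.Finite K (homogeneousSubmodule (Fin (n + 1)) K m) := by
    rw [Module.Finite.iff_fg]
    exact homogeneousSubmodule_fg _ _ m
  rw [← hrange, LinearMap.finrank_range_of_inj hinj, Module.finrank_pi_fintype]
  simp only [Finset.sum_const, Finset.card_univ, Fintype.card_fin, smul_eq_mul]
  rw [finrank_homogeneousSubmodule, Fintype.card_fin]
  congr 1
  rw [show n + 1 + m - 1 = m + n by omega]
  exact (Nat.choose_symm_add)

end GenericProjection

namespace GenericProjection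

theorem pow_le_mul_pow_of_step {K A : Type*} [CommRing K] [CommRing A] [Algebra K A]
    {Y G : Submodule K A} {a : ℕ} (h : ∀ m, a ≤ m → G ^ (m + 1) ≤ Y * G ^ m) (m : ℕ) :
    G ^ (m + a) ≤ Y ^ m * G ^ a := by
  induction m with
  | zero => simp
  | succ m ih =>
    calc G ^ (m + 1 + a) = G ^ (m + a + 1) := by ring_nf
      _ ≤ Y * G ^ (m + a) := h _ (by omega)
      _ ≤ Y * (Y ^ m * G ^ a) := mul_le_mul' le_rfl ih
      _ = Y ^ (m + 1) * G ^ a := by rw [← mul_assoc, pow_succ']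

theorem tendsto_shift (n a b : ℕ) :
    Filter.Tendsto (fun m : ℕ => ((m + b : ℕ) : ℝ) ^ n / ((m + a : ℕ) : ℝ) ^ n) Filter.atTop
      (nhds 1) := by
  have h1 : Filter.Tendsto (fun m : ℕ => ((m + b : ℕ) : ℝ) / ((m + a : ℕ) : ℝ)) Filter.atTop
      (nhds 1) := by
    have := tendsto_add_mul_div_add_mul_atTop_nhds (b : ℝ) (a : ℝ) (1 : ℝ) (d := 1) one_ne_zero
    simp only [one_mul, div_one] at this
    refine this.congr fun m => ?_
    push_cast
    rw [add_comm (b : ℝ), add_comm (a : ℝ)]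
  simpa [div_pow] using h1.pow n

theorem eq_of_growth {n d s a r : ℕ} (f : ℕ → ℕ)
    (hf : Filter.Tendsto (fun m : ℕ => (f m : ℝ) * (n.factorial : ℝ) / (m : ℝ) ^ n) Filter.atTop
      (nhds (d : ℝ)))
    (hlow : ∀ m, s * (m + n).choose n ≤ f (m + a))
    (hupp : ∀ m, f (m + a) ≤ s * (m + r + n).choose n) : s = d := by
  have hf' := hf.comp (Filter.tendsto_add_atTop_nat a)
  have key : ∀ m, (m + n).choose n * n.factorial = (m + 1).ascFactorial n := fun m => by
    rw [Nat.ascFactorial_eq_factorial_mul_choose, mul_comm]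
  apply le_antisymm
  · have h1 : Filter.Tendsto (fun m : ℕ => (s : ℝ) * (((m + 0 : ℕ) : ℝ) ^ n / ((m + a : ℕ) : ℝ) ^ n))
      Filter.atTop (nhds (s * 1)) := (tendsto_shift n a 0).const_mul _
    have := le_of_tendsto_of_tendsto' h1 hf' (fun m => ?_)
    · simpa using this
    · simp only [Function.comp]
      rw [← mul_div_assoc]
      refine div_le_div_of_nonneg_right ?_ (by positivity)
      have h2 : s * (m + 0) ^ n ≤ f (m + a) * n.factorial := by
        calc s * (m + 0) ^ n ≤ s * (m + 1) ^ n := by gcongr; omega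
          _ ≤ s * (m + 1).ascFactorial n := by gcongr; exact Nat.pow_succ_le_ascFactorial _ _
          _ = s * (m + n).choose n * n.factorial := by rw [mul_assoc, key]
          _ ≤ _ := by gcongr; exact hlow m
      exact_mod_cast h2
  · have h1 : Filter.Tendsto
      (fun m : ℕ => (s : ℝ) * (((m + (r + n) : ℕ) : ℝ) ^ n / ((m + a : ℕ) : ℝ) ^ n))
      Filter.atTop (nhds (s * 1)) := (tendsto_shift n a _).const_mul _
    have := le_of_tendsto_of_tendsto' hf' h1 (fun m => ?_)
    · simpa using this
    · simp only [Function.comp]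
      rw [← mul_div_assoc]
      refine div_le_div_of_nonneg_right ?_ (by positivity)
      have h2 : f (m + a) * n.factorial ≤ s * (m + (r + n)) ^ n := by
        calc f (m + a) * n.factorial ≤ s * (m + r + n).choose n * n.factorial := by
              gcongr; exact hupp m
          _ = s * (m + r + 1).ascFactorial n := by rw [mul_assoc, key]
          _ ≤ s * (m + r + n) ^ n := by gcongr; exact Nat.ascFactorial_le_pow_add _ _
          _ = _ := by rw [add_assoc]
      exact_mod_cast h2

end GenericProjection

namespace GenericProjection

theorem exists_common_denominator {K E I S : Type*} [Field K] [Field E] [Algebra K E] [Finite S]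
    (y : I → E) (f : S → IntermediateField.adjoin K (Set.range y)) :
    ∃ (Q : MvPolynomial I K) (P : S → MvPolynomial I K), aeval y Q ≠ 0 ∧
      ∀ s, aeval y Q * (f s : E) = aeval y (P s) := by
  classical
  cases nonempty_fintype S
  have h : ∀ s, ∃ r q : MvPolynomial I K, aeval y q ≠ 0 ∧ aeval y q * (f s : E) = aeval y r := by
    intro s
    obtain ⟨r, q, e⟩ := (IntermediateField.mem_adjoin_range_iff K y _).1 (f s).2
    by_cases hq : aeval y q = 0
    · exact ⟨0, 1, by simp, by simp [e, hq]⟩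
    · exact ⟨r, q, hq, by rw [e]; field_simp⟩
  choose r q hq e using h
  refine ⟨∏ s, q s, fun s => (∏ t ∈ Finset.univ.erase s, q t) * r s, ?_, fun s => ?_⟩
  · rw [map_prod]; exact Finset.prod_ne_zero_iff.2 fun s _ => hq s
  · rw [← Finset.mul_prod_erase _ _ (Finset.mem_univ s), map_mul, map_mul, ← e]; ring

theorem aeval_mem_adjoin {K E I : Type*} [Field K] [Field E] [Algebra K E]
    (y : I → E) (P : MvPolynomial I K) :
    aeval y P ∈ IntermediateField.adjoin K (Set.range y) := by
  apply IntermediateField.algebra_adjoin_le_adjoin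
  rw [Algebra.adjoin_range_eq_range_aeval]
  exact ⟨P, rfl⟩

section degree

variable {K E J : Type*} [Field K] [Field E] [Algebra K E] {n d a : ℕ}
  {x : J → E} {y : Fin (n + 1) → E}

theorem span_pow_le_adjoin (m : ℕ) {u : E} (hu : u ∈ Submodule.span K (Set.range y) ^ m) :
    u ∈ IntermediateField.adjoin K (Set.range y) := by
  obtain ⟨p, -, rfl⟩ := (mem_span_pow_iff y m u).1 hu
  exact aeval_mem_adjoin y p

theorem pow_le_span_of_step
    (hy : ∀ i, y i ∈ Submodule.span K (Set.range x)) (hy0 : y 0 ≠ 0)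
    (hstep : ∀ m, a ≤ m → Submodule.span K (Set.range x) ^ (m + 1) ≤
      Submodule.span K (Set.range y) * Submodule.span K (Set.range x) ^ m) (m : ℕ)
    {u : E} (hu : u ∈ Submodule.span K (Set.range x) ^ m) :
    u ∈ Submodule.span (IntermediateField.adjoin K (Set.range y))
      ((Submodule.span K (Set.range x) ^ a : Submodule K E) : Set E) := by
  set G := Submodule.span K (Set.range x) with hG
  set L := IntermediateField.adjoin K (Set.range y) with hL
  have hyL : y 0 ∈ L := IntermediateField.subset_adjoin _ _ ⟨0, rfl⟩
  rcases le_total a m with h | h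
  · obtain ⟨t, rfl⟩ := Nat.exists_eq_add_of_le' h
    have := pow_le_mul_pow_of_step hstep t hu
    refine Submodule.mul_induction_on this ?_ fun _ _ h1 h2 => add_mem h1 h2
    intro v hv w hw
    exact Submodule.smul_mem _ (⟨v, span_pow_le_adjoin t hv⟩ : L) (Submodule.subset_span hw)
  · obtain ⟨t, rfl⟩ := Nat.exists_eq_add_of_le' h
    have h1 : (y 0) ^ t * u ∈ G ^ (t + m) := by
      rw [pow_add]
      exact Submodule.mul_mem_mul (Submodule.pow_mem_pow _ (hy 0) t) hu
    have := Submodule.smul_mem (Submodule.span L ((G ^ (t + m) : Submodule K E) : Set E))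
      ((⟨y 0, hyL⟩ : L) ^ t)⁻¹ (Submodule.subset_span h1)
    convert this using 1
    rw [Algebra.smul_def, map_inv₀, map_pow]
    change _ = (y 0 ^ t)⁻¹ * _
    field_simp

theorem span_pow_eq_top [Finite J]
    (hy : ∀ i, y i ∈ Submodule.span K (Set.range x)) (hy0 : y 0 ≠ 0)
    (hstep : ∀ m, a ≤ m → Submodule.span K (Set.range x) ^ (m + 1) ≤
      Submodule.span K (Set.range y) * Submodule.span K (Set.range x) ^ m)
    (hgen : IntermediateField.adjoin K (Set.range x) = ⊤) :
    Module.Finite (IntermediateField.adjoin K (Set.range y)) E ∧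
    Submodule.span (IntermediateField.adjoin K (Set.range y))
      ((Submodule.span K (Set.range x) ^ a : Submodule K E) : Set E) = ⊤ := by
  set G := Submodule.span K (Set.range x) with hG
  set L := IntermediateField.adjoin K (Set.range y) with hL
  set S := Submodule.span L ((G ^ a : Submodule K E) : Set E) with hS
  have hGS : ∀ m, ∀ u ∈ G ^ m, u ∈ S := fun m u hu => pow_le_span_of_step hy hy0 hstep m hu
  have : Module.Finite K G := Module.Finite.span_of_finite K (Set.finite_range x)
  have hfin : Module.Finite L S := by
    obtain ⟨B, hB⟩ := (Module.Finite.iff_fg).1 (finite_pow G a)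
    rw [hS, ← hB, Submodule.span_span_of_tower]
    exact Module.Finite.span_of_finite L B.finite_toSet
  have hTS : ∀ p : MvPolynomial J L, aeval x p ∈ S := by
    intro p
    induction p using MvPolynomial.induction_on' with
    | monomial s l =>
      have : aeval x (monomial s l) = l • aeval x (monomial s (1 : K)) := by
        simp [aeval_monomial, Algebra.smul_def]
      rw [this]
      refine S.smul_mem _ (hGS s.degree _ (aeval_mem_pow (fun j => Submodule.subset_span (Set.mem_range_self j)) ?_))
      exact isHomogeneous_monomial _ rfl
    | add p q hp hq => rw [map_add]; exact add_mem hp hq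
  have hfT : Module.Finite L (Algebra.adjoin L (Set.range x)) := by
    have : Subalgebra.toSubmodule (Algebra.adjoin L (Set.range x)) ≤ S := by
      rw [Algebra.adjoin_range_eq_range_aeval]
      rintro _ ⟨p, rfl⟩
      exact hTS p
    exact Submodule.finiteDimensional_of_le this
  have halg : ∀ u ∈ Set.range x, IsAlgebraic L u := by
    intro u hu
    have : IsAlgebraic L (⟨u, Algebra.subset_adjoin hu⟩ : Algebra.adjoin L (Set.range x)) :=
      Algebra.IsAlgebraic.isAlgebraic _
    exact this.algHom (Algebra.adjoin L (Set.range x)).val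
  have htop : Algebra.adjoin L (Set.range x) = ⊤ := by
    rw [← IntermediateField.adjoin_toSubalgebra_of_isAlgebraic halg]
    have : IntermediateField.adjoin L (Set.range x) = ⊤ := by
      rw [eq_top_iff]
      intro u _
      have h1 : u ∈ IntermediateField.adjoin K (Set.range x) := by rw [hgen]; trivial
      have h2 : IntermediateField.adjoin K (Set.range x) ≤
          (IntermediateField.adjoin L (Set.range x)).restrictScalars K :=
        IntermediateField.adjoin_le_iff.2 (IntermediateField.subset_adjoin L _)
      exact h2 h1
    rw [this]; rfl
  have hStop : S = ⊤ := by
    rw [eq_top_iff]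
    intro u _
    have : u ∈ Algebra.adjoin L (Set.range x) := by rw [htop]; trivial
    rw [Algebra.adjoin_range_eq_range_aeval] at this
    obtain ⟨p, rfl⟩ := this
    exact hTS p
  refine ⟨?_, hStop⟩
  rw [Module.finite_def, ← hStop]
  exact (Module.Finite.iff_fg).1 hfin

theorem finrank_adjoin_eq [Finite J] (hind : IndepPowers (Submodule.span K (Set.range x)))
    (hy : ∀ i, y i ∈ Submodule.span K (Set.range x)) (hyi : AlgebraicIndependent K y)
    (hstep : ∀ m, a ≤ m → Submodule.span K (Set.range x) ^ (m + 1) ≤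
      Submodule.span K (Set.range y) * Submodule.span K (Set.range x) ^ m)
    (hgen : IntermediateField.adjoin K (Set.range x) = ⊤)
    (hgrow : Filter.Tendsto (fun m : ℕ =>
      (Module.finrank K (Submodule.span K (Set.range x) ^ m : Submodule K E) : ℝ)
        * (n.factorial : ℝ) / (m : ℝ) ^ n) Filter.atTop (nhds (d : ℝ))) :
    Module.finrank (IntermediateField.adjoin K (Set.range y)) E = d := by
  have hy0 : y 0 ≠ 0 := hyi.ne_zero 0
  obtain ⟨hfin, htop⟩ := span_pow_eq_top hy hy0 hstep hgen
  set G := Submodule.span K (Set.range x) with hG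
  set L := IntermediateField.adjoin K (Set.range y) with hL
  have : Module.Finite K G := Module.Finite.span_of_finite K (Set.finite_range x)
  have hEfin : Module.finrank L (Submodule.span L ((G ^ a : Submodule K E) : Set E)) =
    Module.finrank L E := by rw [htop, finrank_top]
  obtain ⟨g, hgG, hgspan, hgi⟩ := Submodule.exists_fun_fin_finrank_span_eq L
    ((G ^ a : Submodule K E) : Set E)
  replace hgspan := hgspan.trans htop
  rw [← hEfin]
  generalize Module.finrank L (Submodule.span L ((G ^ a : Submodule K E) : Set E)) = s at *
  have hind' : ∀ P : Fin s → MvPolynomial (Fin (n + 1)) K,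
      ∑ t, aeval y (P t) * g t = 0 → P = 0 := by
    intro P hP
    have := Fintype.linearIndependent_iff.1 hgi (fun t => ⟨aeval y (P t), aeval_mem_adjoin y _⟩)
      (by simpa [Algebra.smul_def] using hP)
    funext t
    have h1 : aeval y (P t) = 0 := congrArg Subtype.val (this t)
    exact (injective_iff_map_eq_zero _).1 hyi _ h1
  have hYG : Submodule.span K (Set.range y) ≤ G := Submodule.span_le.2 (by rintro _ ⟨i, rfl⟩; exact hy i)
  have hgG' : Submodule.span K (Set.range g) ≤ G ^ a :=
    Submodule.span_le.2 (by rintro _ ⟨i, rfl⟩; exact hgG i)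
  -- a common denominator for a generating set of `G ^ a`
  obtain ⟨r, Q, hQ, hQ0, hQG⟩ : ∃ (r : ℕ) (Q : MvPolynomial (Fin (n + 1)) K), Q.IsHomogeneous r ∧
      Q ≠ 0 ∧ ∀ u ∈ G ^ a, aeval y Q * u ∈
        Submodule.span K (Set.range y) ^ r * Submodule.span K (Set.range g) := by
    obtain ⟨B, hB⟩ := (Module.Finite.iff_fg).1 (finite_pow G a)
    have hc : ∀ b : B, ∃ c : Fin s → L, ∑ t, c t • g t = (b : E) := by
      intro b
      have : (b : E) ∈ Submodule.span L (Set.range g) := by rw [hgspan]; trivial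
      exact (Submodule.mem_span_range_iff_exists_fun L).1 this
    choose c hc using hc
    obtain ⟨Q, P, hQ, hP⟩ := exists_common_denominator y (fun p : B × Fin s => c p.1 p.2)
    have hQ0 : Q ≠ 0 := by rintro rfl; simp at hQ
    obtain ⟨r, hr⟩ : ∃ r, homogeneousComponent r Q ≠ 0 := by
      by_contra! h
      apply hQ0
      rw [← sum_homogeneousComponent Q]
      exact Finset.sum_eq_zero fun i _ => h i
    refine ⟨r, homogeneousComponent r Q, homogeneousComponent_isHomogeneous r Q, hr, ?_⟩
    have hb : ∀ b : B, aeval y (homogeneousComponent r Q) * (b : E) =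
        ∑ t, aeval y (homogeneousComponent r (P (b, t))) * g t := by
      intro b
      have hbG : (b : E) ∈ G ^ a := by rw [← hB]; exact Submodule.subset_span b.2
      have := hind.component hy (a := a) (g := fun o : Option (Fin s) => o.elim (b : E) g)
        (by rintro (_ | t); exacts [hbG, hgG t]) (fun o => o.elim Q (fun t => - P (b, t)))
        (by
          simp only [Fintype.sum_option, Option.elim, map_neg, neg_mul, Finset.sum_neg_distrib]
          rw [← hc b, Finset.mul_sum, ← sub_eq_add_neg, sub_eq_zero]
          refine Finset.sum_congr rfl fun t _ => ?_
          rw [← hP (b, t), Algebra.smul_def]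
          exact (mul_assoc _ _ _).symm) r
      simp only [Fintype.sum_option, Option.elim, map_neg, neg_mul, Finset.sum_neg_distrib] at this
      rwa [← sub_eq_add_neg, sub_eq_zero] at this
    intro u hu
    rw [← hB] at hu
    induction hu using Submodule.span_induction with
    | mem b hb' =>
      rw [hb ⟨b, hb'⟩]
      refine Submodule.sum_mem _ fun t _ => Submodule.mul_mem_mul ?_ (Submodule.subset_span ⟨t, rfl⟩)
      exact aeval_mem_pow (fun i => Submodule.subset_span (Set.mem_range_self i))
        (homogeneousComponent_isHomogeneous r _)
    | zero => simp
    | add u v _ _ hu hv => rw [mul_add]; exact add_mem hu hv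
    | smul t u _ hu => rw [mul_smul_comm]; exact Submodule.smul_mem _ _ hu
  refine eq_of_growth (a := a) (r := r) _ hgrow (fun m => ?_) (fun m => ?_)
  · rw [← finrank_span_pow_mul y g hind' m]
    refine Submodule.finrank_mono ?_
    rw [pow_add]
    exact mul_le_mul' (pow_le_pow_left' hYG m) hgG'
  · rw [← finrank_span_pow_mul y g hind' (m + r)]
    have hQy : aeval y Q ≠ 0 := fun h => hQ0 ((injective_iff_map_eq_zero _).1 hyi _ h)
    have hinj : Function.Injective (LinearMap.mulLeft K (aeval y Q : E)) :=
      fun u v h => mul_left_cancel₀ hQy h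
    rw [(Submodule.equivMapOfInjective _ hinj (G ^ (m + a))).finrank_eq]
    have : Module.Finite K (Submodule.span K (Set.range y)) :=
      Module.Finite.span_of_finite K (Set.finite_range y)
    have : Module.Finite K (Submodule.span K (Set.range g)) :=
      Module.Finite.span_of_finite K (Set.finite_range g)
    have : Module.Finite K (Submodule.span K (Set.range y) ^ (m + r) *
        Submodule.span K (Set.range g) : Submodule K E) := by
      rw [Module.Finite.iff_fg]
      exact Submodule.FG.mul ((Module.Finite.iff_fg).1 inferInstance)
        ((Module.Finite.iff_fg).1 inferInstance)
    refine Submodule.finrank_mono ?_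
    rintro _ ⟨u, hu, rfl⟩
    have hu' := pow_le_mul_pow_of_step hstep m hu
    rw [pow_add, mul_assoc]
    refine Submodule.mul_induction_on hu' ?_ fun u v h1 h2 => ?_
    · intro v hv w hw
      have := Submodule.mul_mem_mul hv (hQG w hw)
      simpa [mul_left_comm] using this
    · rw [map_add]; exact add_mem h1 h2

end degree
end GenericProjection

namespace GenericProjection

section baseChange

variable {k R E W : Type*} [Field k] [CommRing R] [Algebra k R] [Field E] [Algebra k E]
  [Algebra R E] [IsScalarTower k R E]

/-- The span over an intermediate field of the image of a `k`-subspace of `R`. -/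
def bc (U : IntermediateField k E) (V : Submodule k R) : Submodule U E :=
  Submodule.span U (algebraMap R E '' (V : Set R))

theorem algebraMap_mem_bc (U : IntermediateField k E) {V : Submodule k R} {v : R} (hv : v ∈ V) :
    algebraMap R E v ∈ bc U V := Submodule.subset_span ⟨v, hv, rfl⟩

theorem bc_span (U : IntermediateField k E) (S : Set R) :
    bc U (Submodule.span k S) = Submodule.span U (algebraMap R E '' S) := by
  apply le_antisymm
  · rw [bc, Submodule.span_le]
    rintro _ ⟨v, hv, rfl⟩
    induction hv using Submodule.span_induction with
    | mem v hv => exact Submodule.subset_span ⟨v, hv, rfl⟩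
    | zero => simp
    | add u v _ _ h1 h2 => rw [map_add]; exact add_mem h1 h2
    | smul a v _ h =>
      rw [Algebra.smul_def, map_mul, ← IsScalarTower.algebraMap_apply k R E]
      exact Submodule.smul_mem _ (algebraMap k U a) h
  · exact Submodule.span_mono (Set.image_mono Submodule.subset_span)

theorem bc_span_range (U : IntermediateField k E) {J : Type*} (X : J → R) :
    bc U (Submodule.span k (Set.range X)) =
      Submodule.span U (Set.range fun j => algebraMap R E (X j)) := by
  rw [bc_span, ← Set.range_comp]; rfl

theorem bc_mul (U : IntermediateField k E) (V V' : Submodule k R) :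
    bc U (V * V') = bc U V * bc U V' := by
  conv_lhs => rw [← Submodule.span_eq V, ← Submodule.span_eq V', Submodule.span_mul_span]
  rw [bc_span, bc, bc, Submodule.span_mul_span]
  congr 1
  exact Set.image_mul (algebraMap R E)

theorem bc_one (U : IntermediateField k E) : bc U (1 : Submodule k R) = 1 := by
  rw [Submodule.one_eq_span, bc_span, Submodule.one_eq_span]; simp

theorem bc_pow (U : IntermediateField k E) (V : Submodule k R) (m : ℕ) :
    bc U (V ^ m) = bc U V ^ m := by
  induction m with
  | zero => simp [bc_one]
  | succ m ih => rw [pow_succ, bc_mul, ih, pow_succ]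

/-- Polynomials with all coefficients in a given subspace. -/
def coeffsIn (V : Submodule k R) (p : MvPolynomial W R) : Prop := ∀ m, coeff m p ∈ V

theorem coeffsIn_map_mul {V : Submodule k R} {p : MvPolynomial W R} (hp : coeffsIn V p)
    (Q : MvPolynomial W k) : coeffsIn V (map (algebraMap k R) Q * p) := by
  classical
  intro m
  rw [coeff_mul]
  refine Submodule.sum_mem _ fun i _ => ?_
  rw [coeff_map, ← Algebra.smul_def]
  exact V.smul_mem _ (hp _)

theorem coeffsIn.add {V : Submodule k R} {p q : MvPolynomial W R} (hp : coeffsIn V p)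
    (hq : coeffsIn V q) : coeffsIn V (p + q) := fun m => by
  rw [coeff_add]; exact add_mem (hp m) (hq m)

theorem coeffsIn_C {V : Submodule k R} {v : R} (hv : v ∈ V) :
    coeffsIn V (C v : MvPolynomial W R) := by
  classical
  intro m
  rw [coeff_C]
  split_ifs
  · exact hv
  · exact zero_mem _

theorem aeval_map_algebraMap (w : W → E) (Q : MvPolynomial W k) :
    aeval w (map (algebraMap k R) Q) = aeval w Q := by
  rw [MvPolynomial.aeval_map_algebraMap]

theorem exists_of_mem_bc (w : W → E) {V : Submodule k R} {u : E}
    (hu : u ∈ bc (IntermediateField.adjoin k (Set.range w)) V) :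
    ∃ (Q : MvPolynomial W k) (p : MvPolynomial W R), aeval w Q ≠ 0 ∧ coeffsIn V p ∧
      aeval w Q * u = aeval w p := by
  induction hu using Submodule.span_induction with
  | mem u hu =>
    obtain ⟨v, hv, rfl⟩ := hu
    exact ⟨1, C v, by simp, coeffsIn_C hv, by simp⟩
  | zero => exact ⟨1, 0, by simp, fun m => by simp, by simp⟩
  | add u v _ _ h1 h2 =>
    obtain ⟨Q, p, hQ, hp, e⟩ := h1
    obtain ⟨Q', p', hQ', hp', e'⟩ := h2
    refine ⟨Q * Q', map (algebraMap k R) Q' * p + map (algebraMap k R) Q * p', ?_,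
      (coeffsIn_map_mul hp Q').add (coeffsIn_map_mul hp' Q), ?_⟩
    · rw [map_mul]; exact mul_ne_zero hQ hQ'
    · simp only [map_mul, map_add, aeval_map_algebraMap, ← e, ← e']; ring
  | smul a u _ h =>
    obtain ⟨Q, p, hQ, hp, e⟩ := h
    obtain ⟨q, r, hq, hr⟩ := exists_common_denominator w (fun _ : Unit => a)
    refine ⟨q * Q, map (algebraMap k R) (r ()) * p, ?_, coeffsIn_map_mul hp _, ?_⟩
    · rw [map_mul]; exact mul_ne_zero hq hQ
    · simp only [map_mul, aeval_map_algebraMap, ← e, ← hr (), Algebra.smul_def]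
      change _ * (a * u) = _; ring

/-- Finitely many elements of base changes admit a common denominator. -/
theorem exists_of_forall_mem_bc {S : Type*} [Finite S] (w : W → E) {V : S → Submodule k R}
    {u : S → E} (hu : ∀ s, u s ∈ bc (IntermediateField.adjoin k (Set.range w)) (V s)) :
    ∃ (Q : MvPolynomial W k) (p : S → MvPolynomial W R), aeval w Q ≠ 0 ∧
      (∀ s, coeffsIn (V s) (p s)) ∧ ∀ s, aeval w Q * u s = aeval w (p s) := by
  classical
  cases nonempty_fintype S
  choose Q p hQ hp e using fun s => exists_of_mem_bc w (hu s)
  refine ⟨∏ s, Q s, fun s => map (algebraMap k R) (∏ t ∈ Finset.univ.erase s, Q t) * p s, ?_,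
    fun s => coeffsIn_map_mul (hp s) _, fun s => ?_⟩
  · rw [map_prod]; exact Finset.prod_ne_zero_iff.2 fun s _ => hQ s
  · rw [← Finset.mul_prod_erase _ _ (Finset.mem_univ s), map_mul, map_mul, aeval_map_algebraMap,
      ← e]; ring

variable {w : W → E}

theorem indepPowers_bc (hw : AlgebraicIndependent R w) {G : Submodule k R} (hG : IndepPowers G) :
    IndepPowers (bc (IntermediateField.adjoin k (Set.range w)) G) := by
  intro s g hg hsum m hm
  obtain ⟨Q, p, hQ, hp, e⟩ := exists_of_forall_mem_bc (S := s) w (V := fun m => G ^ (m : ℕ))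
    (u := fun m => g m) (fun m => by rw [bc_pow]; exact hg m m.2)
  have h0 : ∑ m : s, p m = 0 := by
    apply (injective_iff_map_eq_zero _).1 hw
    rw [map_sum, Finset.sum_congr rfl fun m _ => (e m).symm, ← Finset.mul_sum,
      Finset.sum_coe_sort s g, hsum, mul_zero]
  have hpm : p ⟨m, hm⟩ = 0 := by
    classical
    ext d
    have h1 := congrArg (coeff d) h0
    rw [coeff_sum, coeff_zero] at h1
    have := hG s (fun m => if h : m ∈ s then coeff d (p ⟨m, h⟩) else 0)
      (fun m hm => by rw [dif_pos hm]; exact hp ⟨m, hm⟩ d)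
      (by rw [← Finset.sum_coe_sort, ← h1]; exact Finset.sum_congr rfl fun m _ => dif_pos m.2) m hm
    rwa [dif_pos hm] at this
  have := e ⟨m, hm⟩
  rw [hpm, map_zero] at this
  exact (mul_eq_zero.1 this).resolve_left hQ

theorem linearIndependent_bc (hw : AlgebraicIndependent R w) {S : Type*} {r : S → R} (hr : LinearIndependent k r) :
    LinearIndependent (IntermediateField.adjoin k (Set.range w))
      (fun s => algebraMap R E (r s)) := by
  classical
  rw [linearIndependent_iff']
  intro s u hu i hi
  obtain ⟨Q, P, hQ, hP⟩ := exists_common_denominator w (fun t : s => u t)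
  have h0 : ∑ t : s, map (algebraMap k R) (P t) * C (r t) = 0 := by
    apply (injective_iff_map_eq_zero _).1 hw
    simp only [map_sum, map_mul, aeval_map_algebraMap, ← hP, aeval_C]
    rw [← mul_zero (aeval w Q), ← hu, Finset.mul_sum, ← Finset.sum_coe_sort s]
    refine Finset.sum_congr rfl fun t _ => ?_
    rw [Algebra.smul_def, mul_assoc]; rfl
  have hPi : P ⟨i, hi⟩ = 0 := by
    ext d
    have h1 := congrArg (coeff d) h0
    simp only [coeff_sum, mul_comm _ (C _), coeff_C_mul, coeff_map, mul_comm _ (algebraMap k R _), ← Algebra.smul_def, coeff_zero] at h1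
    have := linearIndependent_iff'.1 hr s (fun t => if h : t ∈ s then coeff d (P ⟨t, h⟩) else 0)
      (by rw [← Finset.sum_coe_sort, ← h1]
          exact Finset.sum_congr rfl fun t _ => by rw [dif_pos t.2]) i hi
    rwa [dif_pos hi] at this
  have := hP ⟨i, hi⟩
  rw [hPi, map_zero] at this
  exact Subtype.ext ((mul_eq_zero.1 this).resolve_left hQ)

theorem finrank_bc (hw : AlgebraicIndependent R w) (V : Submodule k R) [Module.Finite k V] :
    Module.finrank (IntermediateField.adjoin k (Set.range w))
      (bc (IntermediateField.adjoin k (Set.range w)) V) = Module.finrank k V := by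
  let b := Module.finBasis k V
  have h1 : LinearIndependent k (fun i => (b i : R)) :=
    b.linearIndependent.map' V.subtype (Submodule.ker_subtype V)
  have h2 := linearIndependent_bc hw h1
  have h3 : V = Submodule.span k (Set.range fun i => (b i : R)) := by
    have := congrArg (Submodule.map V.subtype) b.span_eq
    rw [Submodule.map_span, ← Set.range_comp, Submodule.map_subtype_top] at this
    exact this.symm
  conv_lhs => rw [h3, bc_span_range]
  rw [finrank_span_eq_card h2, Fintype.card_fin]

theorem exists_extend_bc (hw : AlgebraicIndependent R w) (V : Submodule k R) [Module.Finite k V] {M : Type*} [AddCommGroup M]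
    [Module k M] [Module (IntermediateField.adjoin k (Set.range w)) M]
    [IsScalarTower k (IntermediateField.adjoin k (Set.range w)) M] (f : V →ₗ[k] M) :
    ∃ F : E →ₗ[IntermediateField.adjoin k (Set.range w)] M,
      ∀ v : V, F (algebraMap R E v) = f v := by
  let b := Module.finBasis k V
  have h1 : LinearIndependent k (fun i => (b i : R)) :=
    b.linearIndependent.map' V.subtype (Submodule.ker_subtype V)
  have h2 := linearIndependent_bc hw h1
  obtain ⟨F, hF⟩ := ((Module.Basis.span h2).constr (IntermediateField.adjoin k (Set.range w)) fun i => f (b i)).exists_extend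
  have hFb : ∀ i, F (algebraMap R E (b i)) = f (b i) := by
    intro i
    have := LinearMap.congr_fun hF (Module.Basis.span h2 i)
    rw [Module.Basis.constr_basis] at this
    rw [← this, LinearMap.comp_apply, Submodule.subtype_apply, Module.Basis.span_apply]
  refine ⟨F, fun v => ?_⟩
  have hl : (F.restrictScalars k ∘ₗ (Algebra.linearMap R E).restrictScalars k) ∘ₗ V.subtype = f :=
    b.ext fun i => hFb i
  exact LinearMap.congr_fun hl v

end baseChange
end GenericProjection

namespace GenericProjection

theorem card_le_of_isAlgebraic {K E T I : Type*} [Field K] [Field E] [Algebra K E] [Fintype T]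
    [Fintype I] {t : T → E} {u : I → E} (hu : AlgebraicIndependent K u)
    (h : ∀ i, IsAlgebraic (Algebra.adjoin K (Set.range t)) (u i)) :
    Fintype.card I ≤ Fintype.card T := by
  have hI : (AlgebraicIndependent.matroid K E).Indep (Set.range u) :=
    AlgebraicIndependent.matroid_indep_iff.2 hu.to_subtype_range
  have hsub : Set.range u ⊆ (AlgebraicIndependent.matroid K E).closure (Set.range t) := by
    rw [AlgebraicIndependent.matroid_closure_eq]
    rintro _ ⟨i, rfl⟩
    exact h i
  have h1 := hI.encard_le_eRk_of_subset hsub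
  rw [Matroid.eRk_closure_eq] at h1
  have h2 := h1.trans (Matroid.eRk_le_encard _ _)
  have h3 : (Set.range u).encard = Fintype.card I := by
    rw [← Set.image_univ, hu.injective.encard_image, Set.encard_univ, ENat.card_eq_coe_fintype_card]
  have h4 : (Set.range t).encard ≤ Fintype.card T := by
    rw [← Set.image_univ]
    refine (Set.encard_image_le _ _).trans ?_
    rw [Set.encard_univ, ENat.card_eq_coe_fintype_card]
  rw [h3] at h2
  exact_mod_cast h2.trans h4

theorem isAlgebraic_adjoin_of_tower {k R K E T : Type*} [Field k] [CommRing R] [Algebra k R]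
    [Field K] [Algebra k K]
    [Field E] [Algebra K E] [Algebra R E] [Algebra k E] [IsScalarTower k R E] [IsScalarTower k K E]
    (hRE : Function.Injective (algebraMap R E)) {t : T → R} {r : R}
    (h : IsAlgebraic (Algebra.adjoin k (Set.range t)) r) :
    IsAlgebraic (Algebra.adjoin K (Set.range fun i => algebraMap R E (t i)))
      (algebraMap R E r) := by
  have hmem : ∀ a ∈ Algebra.adjoin k (Set.range t), algebraMap R E a ∈
      Algebra.adjoin K (Set.range fun i => algebraMap R E (t i)) := by
    intro a ha
    induction ha using Algebra.adjoin_induction with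
    | mem a ha => obtain ⟨i, rfl⟩ := ha; exact Algebra.subset_adjoin ⟨i, rfl⟩
    | algebraMap a =>
      rw [← IsScalarTower.algebraMap_apply k R E, IsScalarTower.algebraMap_apply k K E]
      exact Subalgebra.algebraMap_mem _ _
    | add a b _ _ ha hb => rw [map_add]; exact add_mem ha hb
    | mul a b _ _ ha hb => rw [map_mul]; exact mul_mem ha hb
  let f : Algebra.adjoin k (Set.range t) →+*
      Algebra.adjoin K (Set.range fun i => algebraMap R E (t i)) :=
    ((algebraMap R E).comp (algebraMap (Algebra.adjoin k (Set.range t)) R)).codRestrict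
      _ fun a => hmem a a.2
  refine h.ringHom_of_comp_eq f (algebraMap R E) ?_ ?_
  · intro a b hab
    exact Subtype.ext (hRE (congrArg Subtype.val hab))
  · ext a; rfl

theorem degree_eq_of_isHomogeneous {K I : Type*} [CommSemiring K] {P : MvPolynomial I K} {e : ℕ}
    (hP : P.IsHomogeneous e) {d : I →₀ ℕ} (hd : d ∈ P.support) : d.degree = e := by
  have := hP (mem_support_iff.1 hd)
  rw [← this, Finsupp.degree_eq_weight_one]; rfl

theorem aeval_mul_const {K E I : Type*} [CommRing K] [CommRing E] [Algebra K E] {P : MvPolynomial I K}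
    {e : ℕ} (hP : P.IsHomogeneous e) (t : E) (g : I → E) :
    aeval (fun i => t * g i) P = t ^ e * aeval g P := by
  rw [aeval_def, aeval_def, eval₂_eq, eval₂_eq, Finset.mul_sum]
  refine Finset.sum_congr rfl fun d hd => ?_
  have : d.degree = e := degree_eq_of_isHomogeneous hP hd
  simp only [mul_pow, Finset.prod_mul_distrib, Finset.prod_pow_eq_pow_sum]
  rw [← this, Finsupp.degree_apply]
  ring

theorem dehomogenize_ne_zero {K I : Type*} [Field K] {P : MvPolynomial (Option I) K} {e : ℕ}
    (hP : P.IsHomogeneous e) (h0 : P ≠ 0) :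
    aeval (fun o : Option I => o.elim (-1) X) P ≠ (0 : MvPolynomial I K) := by
  intro h
  apply h0
  let F := FractionRing (MvPolynomial (Option I) K)
  have hinj : Function.Injective (algebraMap (MvPolynomial (Option I) K) F) :=
    IsFractionRing.injective _ _
  let a : Option I → F := fun o =>
    algebraMap (MvPolynomial (Option I) K) F (X o)
  have ha : a none ≠ 0 := fun h => X_ne_zero (R := K) (none : Option I) (hinj (by rw [map_zero]; exact h))
  have h1 := congrArg (aeval fun i => - a (some i) / a none) h
  rw [map_zero, ← AlgHom.comp_apply] at h1
  have h2 := aeval_mul_const hP (- a none)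
    (fun o : Option I => (o.elim (-1) fun i => - a (some i) / a none : F))
  have h3 : (fun o : Option I => - a none * o.elim (-1 : F) fun i => - a (some i) / a none) = a := by
    funext o
    cases o
    · change - a none * -1 = a none
      rw [mul_neg, mul_one, neg_neg]
    · change - a none * (- a (some _) / a none) = a (some _)
      rw [← mul_div_assoc, neg_mul_neg, mul_div_cancel_left₀ _ ha]
  have h4 : (aeval fun i => - a (some i) / a none).comp
      (aeval fun o : Option I => o.elim (-1) (X : I → MvPolynomial I K)) =
      aeval (fun o : Option I => (o.elim (-1) fun i => - a (some i) / a none : F)) := by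
    ext o
    cases o <;> simp
  rw [h4] at h1
  rw [h3, h1, mul_zero] at h2
  have h5 : aeval a P = algebraMap _ F P := by
    have : aeval a = (IsScalarTower.toAlgHom K (MvPolynomial (Option I) K) F) := by
      ext o; simp [a]
    rw [this]; rfl
  exact hinj (by rw [← h5, h2, map_zero])

theorem aeval_sub_aeval_mem {K A I : Type*} [CommRing K] [CommRing A] [Algebra K A]
    {Y G : Submodule K A} (hYG : Y ≤ G) {g g' : I → A} (hg : ∀ i, g i ∈ G)
    (hgg : ∀ i, g i - g' i ∈ Y) {e : ℕ} {P : MvPolynomial I K} (hP : P.IsHomogeneous (e + 1)) :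
    aeval g P - aeval g' P ∈ Y * G ^ e := by
  have hg' : ∀ i, g' i ∈ G := fun i => by
    have := sub_mem (hg i) (hYG (hgg i)); rwa [sub_sub_cancel] at this
  have h1 : ∀ p ∈ Submodule.span K (Set.range (X : I → MvPolynomial I K)),
      aeval g p - aeval g' p ∈ Y := by
    intro p hp
    induction hp using Submodule.span_induction with
    | mem p hp => obtain ⟨i, rfl⟩ := hp; simpa using hgg i
    | zero => simp
    | add p q _ _ hp hq => rw [map_add, map_add, add_sub_add_comm]; exact add_mem hp hq
    | smul a p _ hp => rw [map_smul, map_smul, ← smul_sub]; exact Y.smul_mem _ hp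
  have hP' : P ∈ Submodule.span K (Set.range (X : I → MvPolynomial I K)) ^ (e + 1) := by
    rw [← homogeneousSubmodule_one_eq_span_X, homogeneousSubmodule_one_pow]
    exact hP
  clear hP
  induction e generalizing P with
  | zero => simpa using h1 P (by simpa using hP')
  | succ e ih =>
    rw [pow_succ] at hP'
    refine Submodule.mul_induction_on hP' (fun p hp q hq => ?_) fun p q hp hq => ?_
    · have e1 : aeval g (p * q) - aeval g' (p * q) =
        (aeval g p - aeval g' p) * aeval g q + (aeval g q - aeval g' q) * aeval g' p := by
          simp only [map_mul]; ring
      rw [e1]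
      refine add_mem ?_ ?_
      · rw [pow_succ, ← mul_assoc]
        refine Submodule.mul_mem_mul (ih hp) ?_
        have := aeval_mem_pow hg (m := 1) (p := q) (by
          rw [← mem_homogeneousSubmodule, homogeneousSubmodule_one_eq_span_X]; exact hq)
        simpa using this
      · refine Submodule.mul_mem_mul (h1 q hq) (aeval_mem_pow hg' ?_)
        rw [← mem_homogeneousSubmodule, ← homogeneousSubmodule_one_pow,
          homogeneousSubmodule_one_eq_span_X]; exact hp
    · rw [map_add, map_add, add_sub_add_comm]; exact add_mem hp hq

theorem exists_homogeneous_relation {K E I : Type*} [Field K] [Field E] [Algebra K E]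
    {G : Submodule K E} (hG : IndepPowers G) {u : I → E} (hu : ∀ i, u i ∈ G)
    (hd : ¬ AlgebraicIndependent K u) :
    ∃ (e : ℕ) (P : MvPolynomial I K), P.IsHomogeneous (e + 1) ∧ P ≠ 0 ∧ aeval u P = 0 := by
  rw [AlgebraicIndependent, injective_iff_map_eq_zero] at hd
  push Not at hd
  obtain ⟨P, hP, hP0⟩ := hd
  obtain ⟨r, hr⟩ : ∃ r, homogeneousComponent r P ≠ 0 := by
    by_contra! h
    apply hP0
    rw [← sum_homogeneousComponent P]
    exact Finset.sum_eq_zero fun i _ => h i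
  have h1 := hG.component hu (a := 0) (g := fun _ : Unit => (1 : E)) (fun _ => by simp)
    (fun _ => P) (by simpa using hP) r
  simp only [Finset.univ_unique, mul_one, Finset.sum_const, Finset.card_singleton, one_smul] at h1
  obtain _ | e := r
  · rw [homogeneousComponent_zero] at h1 hr
    simp only [aeval_C, map_eq_zero] at h1
    simp [h1] at hr
  · exact ⟨e, _, homogeneousComponent_isHomogeneous _ P, hr, h1⟩

theorem step_of_pow_mem {K A S : Type*} [CommRing K] [CommRing A] [Algebra K A] [Fintype S]
    {Y G : Submodule K A} {z : S → A} (hYG : Y ≤ G) (hz : ∀ j, z j ∈ G)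
    (hG : G ≤ Y ⊔ Submodule.span K (Set.range z)) (e : S → ℕ)
    (he : ∀ j, z j ^ (e j + 1) ∈ Y * G ^ (e j)) :
    ∃ a, ∀ m, a ≤ m → G ^ (m + 1) ≤ Y * G ^ m := by
  set Z := Submodule.span K (Set.range z)
  have hZG : Z ≤ G := Submodule.span_le.2 (by rintro _ ⟨j, rfl⟩; exact hz j)
  have hGe : G = Y ⊔ Z := le_antisymm hG (sup_le hYG hZG)
  have h1 : ∀ m, G ^ (m + 1) ≤ Y * G ^ m ⊔ Z ^ (m + 1) := by
    intro m
    induction m with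
    | zero => simpa using hG
    | succ m ih =>
      calc G ^ (m + 1 + 1) = G ^ (m + 1) * G := pow_succ _ _
        _ ≤ (Y * G ^ m ⊔ Z ^ (m + 1)) * G := mul_le_mul' ih le_rfl
        _ = Y * G ^ (m + 1) ⊔ Z ^ (m + 1) * G := by rw [Submodule.sup_mul, mul_assoc, ← pow_succ]
        _ ≤ _ := by
          refine sup_le le_sup_left ?_
          conv_lhs => rw [hGe, Submodule.mul_sup]
          refine sup_le_sup ?_ (by rw [← pow_succ])
          rw [mul_comm]
          exact mul_le_mul' le_rfl (pow_le_pow_left' hZG _)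
  refine ⟨∑ j, e j, fun m hm => (h1 m).trans (sup_le le_rfl ?_)⟩
  intro u hu
  obtain ⟨p, hp, rfl⟩ := (mem_span_pow_iff z _ u).1 hu
  rw [aeval_def, eval₂_eq']
  refine Submodule.sum_mem _ fun d hd => ?_
  have hdeg : ∑ j, d j = m + 1 := by
    rw [← degree_eq_of_isHomogeneous hp hd, Finsupp.degree_eq_sum]
  obtain ⟨j, hj⟩ : ∃ j, e j + 1 ≤ d j := by
    by_contra! h
    have := Finset.sum_le_sum (s := Finset.univ) (fun j _ => Nat.lt_succ_iff.1 (h j))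
    omega
  classical
  have hdj : d j + ∑ i ∈ Finset.univ.erase j, d i = m + 1 := by
    rw [Finset.add_sum_erase _ _ (Finset.mem_univ j), hdeg]
  rw [← Algebra.smul_def]
  refine Submodule.smul_mem _ _ ?_
  rw [← Finset.mul_prod_erase _ _ (Finset.mem_univ j)]
  have hsplit : z j ^ d j = z j ^ (e j + 1) * z j ^ (d j - (e j + 1)) := by
    rw [← pow_add]; congr 1; omega
  have hm' : m = e j + ((d j - (e j + 1)) + ∑ i ∈ Finset.univ.erase j, d i) := by omega
  rw [hsplit, mul_assoc, hm', pow_add, ← mul_assoc]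
  refine Submodule.mul_mem_mul (he j) ?_
  rw [pow_add]
  refine Submodule.mul_mem_mul (Submodule.pow_mem_pow _ (hz j) _) ?_
  rw [← Finset.prod_pow_eq_pow_sum]
  generalize Finset.univ.erase j = T
  induction T using Finset.induction_on with
  | empty => simpa using ⟨1, map_one _⟩
  | insert i T hi ih =>
    rw [Finset.prod_insert hi, Finset.prod_insert hi]
    exact Submodule.mul_mem_mul (Submodule.pow_mem_pow _ (hz i) _) ih

end GenericProjection

namespace GenericProjection

/-- The homogeneous coordinate ring of a cone, with coordinates split into two blocks, satisfying
the numerical conditions of a variety of almost minimal degree plus one. -/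
structure IsConeRing (k : Type*) {R : Type*} [Field k] [CommRing R] [Algebra k R] {n c : ℕ}
    (X : Fin (n + 1) ⊕ Fin c → R) : Prop where
  adjoin_eq_top : Algebra.adjoin k (Set.range X) = ⊤
  separated : ∀ r : R, r ≠ 0 → ∃ ev : R →ₐ[k] k, ev r ≠ 0
  graded : IndepPowers (Submodule.span k (Set.range X))
  growth : Filter.Tendsto (fun m : ℕ =>
    (Module.finrank k (Submodule.span k (Set.range X) ^ m : Submodule k R) : ℝ)
      * (n.factorial : ℝ) / (m : ℝ) ^ n) Filter.atTop (nhds ((c + 3 : ℕ) : ℝ))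
  linearIndependent : LinearIndependent k X
  exists_basis : ∃ t : Fin (n + 1) → R, IsTranscendenceBasis k t
  finrank_sq : Module.finrank k (Submodule.span k (Set.range X) ^ 2 : Submodule k R) =
    (n + 2).choose 2 + (n + 1) * c + 3

/-- `E` is the fraction field of the polynomial ring over `R` in the family `w`. -/
structure IsGeneric (R : Type*) {E W : Type*} [CommRing R] [Field E] [Algebra R E] (w : W → E) :
    Prop where
  indep : AlgebraicIndependent R w
  frac : ∀ e : E, ∃ p q : MvPolynomial W R, aeval w q ≠ 0 ∧ aeval w q * e = aeval w p

variable {k R E : Type*} [Field k] [CommRing R] [IsDomain R] [Algebra k R] [Field E] [Algebra k E]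
  [Algebra R E] [IsScalarTower k R E] {n c : ℕ} {X : Fin (n + 1) ⊕ Fin c → R}
  {w : Fin (n + 1) × Fin c → E}

/-- The coordinates of the projection with coefficients `w`. -/
def proj (X : Fin (n + 1) ⊕ Fin c → R) (w : Fin (n + 1) × Fin c → E) (i : Fin (n + 1)) : E :=
  algebraMap R E (X (.inl i)) + ∑ j, w (i, j) * algebraMap R E (X (.inr j))

variable (k w) in
/-- The field of coefficients of the generic projection. -/
abbrev coefField : IntermediateField k E := IntermediateField.adjoin k (Set.range w)

variable (k) in
theorem w_mem_coefField (w : Fin (n + 1) × Fin c → E) (q) : w q ∈ coefField k w :=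
  IntermediateField.subset_adjoin _ _ ⟨q, rfl⟩

variable (k X w) in
/-- The space of linear forms over the field of coefficients. -/
abbrev forms : Submodule (coefField k w) E := bc (coefField k w) (Submodule.span k (Set.range X))

variable (k X w) in
/-- The span of the coordinates of the projection. -/
abbrev projSpan : Submodule (coefField k w) E :=
  Submodule.span (coefField k w) (Set.range (proj X w))

theorem forms_eq : forms k X w =
    Submodule.span (coefField k w) (Set.range fun s => algebraMap R E (X s)) :=
  bc_span_range _ _

theorem algebraMap_mem_forms (s) : algebraMap R E (X s) ∈ forms k X w :=
  algebraMap_mem_bc _ (Submodule.subset_span ⟨s, rfl⟩)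

theorem proj_mem_forms (i) : proj X w i ∈ forms k X w :=
  add_mem (algebraMap_mem_forms _) (Submodule.sum_mem _ fun j _ =>
    (forms k X w).smul_mem (⟨w (i, j), w_mem_coefField k w _⟩ : coefField k w)
      (algebraMap_mem_forms (k := k) (w := w) (X := X) (.inr j)))

theorem projSpan_le_forms : projSpan k X w ≤ forms k X w :=
  Submodule.span_le.2 (by rintro _ ⟨i, rfl⟩; exact proj_mem_forms i)

theorem forms_le : forms k X w ≤ projSpan k X w ⊔
    Submodule.span (coefField k w) (Set.range fun j => algebraMap R E (X (.inr j))) := by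
  rw [forms_eq, Submodule.span_le]
  have hz : ∀ j, algebraMap R E (X (.inr j)) ∈
      Submodule.span (coefField k w) (Set.range fun j => algebraMap R E (X (.inr j))) :=
    fun j => Submodule.subset_span ⟨j, rfl⟩
  rintro _ ⟨i | j, rfl⟩
  · have : algebraMap R E (X (.inl i)) = proj X w i -
        ∑ j, w (i, j) * algebraMap R E (X (.inr j)) := by simp [proj]
    have h1 : proj X w i ∈ projSpan k X w := Submodule.subset_span ⟨i, rfl⟩
    have h2 : ∑ j, w (i, j) * algebraMap R E (X (.inr j)) ∈
        Submodule.span (coefField k w) (Set.range fun j => algebraMap R E (X (.inr j))) :=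
      Submodule.sum_mem _ fun j _ =>
        Submodule.smul_mem _ (⟨w (i, j), w_mem_coefField k w _⟩ : coefField k w) (hz j)
    beta_reduce
    rw [SetLike.mem_coe, this, sub_eq_add_neg]
    exact Submodule.add_mem_sup h1 (neg_mem h2)
  · exact Submodule.mem_sup_right (hz j)

theorem linearIndependent_algebraMap (hX : IsConeRing k X) (hw : IsGeneric R w) :
    LinearIndependent (coefField k w) fun s => algebraMap R E (X s) :=
  linearIndependent_bc hw.indep hX.linearIndependent

theorem proj_ne_zero (hX : IsConeRing k X) (hw : IsGeneric R w) (i) : proj X w i ≠ 0 := by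
  classical
  intro h
  have hli := linearIndependent_algebraMap hX hw
  rw [Fintype.linearIndependent_iff] at hli
  have h1 := hli
    (Sum.elim (fun i' => if i' = i then (1 : coefField k w) else 0)
      fun j => (⟨w (i, j), w_mem_coefField k w _⟩ : coefField k w)) ?_ (.inl i)
  · simp at h1
  · rw [← h, Fintype.sum_sum_type, proj]
    congr 1
    simp only [Sum.elim_inl, ite_smul, one_smul, zero_smul, Finset.sum_ite_eq', Finset.mem_univ,
      if_true]

theorem exists_pow_mem (hX : IsConeRing k X) (hw : IsGeneric R w) (j : Fin c) :
    ∃ e, algebraMap R E (X (.inr j)) ^ (e + 1) ∈ projSpan k X w * forms k X w ^ e := by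
  classical
  let w' : {q : Fin (n + 1) × Fin c // q.2 ≠ j} → E := fun q => w q
  let y' : Fin (n + 1) → E := fun i =>
    proj X w i - w (i, j) * algebraMap R E (X (.inr j))
  set z := algebraMap R E (X (.inr j)) with hz
  let u : Option (Fin (n + 1)) → E := fun o => o.elim z y'
  let K := IntermediateField.adjoin k (Set.range w')
  let G' := bc K (Submodule.span k (Set.range X))
  have hw' : AlgebraicIndependent R w' := hw.indep.comp _ Subtype.val_injective
  have hinj : Function.Injective (algebraMap R E) := hw.indep.algebraMap_injective
  have hkR : Function.Injective (algebraMap k R) := (algebraMap k R).injective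
  have hG' : IndepPowers G' := indepPowers_bc hw' hX.graded
  have hXG' : ∀ s, algebraMap R E (X s) ∈ G' := fun s =>
    algebraMap_mem_bc _ (Submodule.subset_span ⟨s, rfl⟩)
  have hy' : ∀ i, y' i = algebraMap R E (X (.inl i)) +
      ∑ j' ∈ Finset.univ.erase j, w (i, j') * algebraMap R E (X (.inr j')) := by
    intro i
    simp only [y', proj, hz]
    rw [← Finset.add_sum_erase _ _ (Finset.mem_univ j)]; ring
  have hy'G : ∀ i, y' i ∈ G' := by
    intro i
    rw [hy']
    refine add_mem (hXG' _) (Submodule.sum_mem _ fun j' hj' => ?_)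
    exact G'.smul_mem (⟨w (i, j'), IntermediateField.subset_adjoin _ _
      ⟨⟨(i, j'), Finset.ne_of_mem_erase hj'⟩, rfl⟩⟩ : K) (hXG' _)
  have huG : ∀ o, u o ∈ G' := by
    rintro (_ | i)
    · exact hXG' _
    · exact hy'G i
  have hdep : ¬ AlgebraicIndependent K u := by
    intro hu
    obtain ⟨t, ht⟩ := hX.exists_basis
    have halgR : ∀ r : R, IsAlgebraic (Algebra.adjoin K (Set.range fun i => algebraMap R E (t i)))
        (algebraMap R E r) := fun r =>
      isAlgebraic_adjoin_of_tower hinj (ht.isAlgebraic.isAlgebraic r)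
    have := card_le_of_isAlgebraic (t := fun i => algebraMap R E (t i)) hu (by
      intro o
      have := huG o
      rw [show G' = _ from bc_span_range _ _] at this
      refine Submodule.span_induction ?_ ?_ ?_ ?_ this
      · rintro _ ⟨s, rfl⟩; exact halgR _
      · exact isAlgebraic_zero
      · intro a b _ _ ha hb; exact ha.add hb
      · intro a b _ hb
        rw [Algebra.smul_def]
        refine IsAlgebraic.mul ?_ hb
        rw [IsScalarTower.algebraMap_apply K
          (Algebra.adjoin K (Set.range fun i => algebraMap R E (t i))) E]
        exact isAlgebraic_algebraMap _)
    simp at this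
  obtain ⟨e, P, hP, hP0, hPu⟩ := exists_homogeneous_relation hG' huG hdep
  -- the remaining coefficients are independent over `K`
  have hind : AlgebraicIndependent K fun i => w (i, j) := by
    refine IntermediateField.algebraicIndependent_adjoin_iff.2 ?_
    refine (AlgebraicIndependent.sumElim_iff.1 ?_).2
    have h1 : AlgebraicIndependent k w := hw.indep.restrictScalars hkR
    have h2 : Function.Injective
        (Sum.elim (fun i => (i, j)) Subtype.val :
          Fin (n + 1) ⊕ {q : Fin (n + 1) × Fin c // q.2 ≠ j} → Fin (n + 1) × Fin c) := by
      rintro (i | q) (i' | q') h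
      · simpa using h
      · exact (q'.2 (by simpa using (congrArg Prod.snd h).symm)).elim
      · exact (q.2 (by simpa using (congrArg Prod.snd h))).elim
      · simpa [Subtype.ext_iff] using h
    convert h1.comp _ h2 using 1
    funext s
    rcases s with i | q <;> rfl
  have hD : aeval (fun o : Option (Fin (n + 1)) => (o.elim (-1) fun i => w (i, j) : E)) P ≠ 0 := by
    intro h
    refine dehomogenize_ne_zero hP hP0 (hind ?_)
    rw [map_zero, ← h, ← AlgHom.comp_apply]
    congr 1
    ext o
    cases o <;> simp
  have hKU : K ≤ coefField k w := IntermediateField.adjoin.mono _ _ _ (by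
    rintro _ ⟨q, rfl⟩; exact ⟨q, rfl⟩)
  let P' : MvPolynomial (Option (Fin (n + 1))) (coefField k w) :=
    map (IntermediateField.inclusion hKU).toRingHom P
  have hmap : ∀ g : Option (Fin (n + 1)) → E, aeval g P' = aeval g P := by
    intro g
    simp only [P', aeval_def, eval₂_map]
    rfl
  have hP' : P'.IsHomogeneous (e + 1) := hP.map _
  refine ⟨e, ?_⟩
  have h1 := aeval_sub_aeval_mem (Y := projSpan k X w) (G := forms k X w) projSpan_le_forms
    (g := fun o => (-z) * (o.elim (-1) fun i => w (i, j) : E)) (g' := u)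
    (by
      rintro (_ | i)
      · have := algebraMap_mem_forms (k := k) (X := X) (w := w) (.inr j)
        simpa using this
      · have := (forms k X w).smul_mem (-⟨w (i, j), w_mem_coefField k w _⟩ : coefField k w)
          (algebraMap_mem_forms (k := k) (w := w) (X := X) (.inr j))
        simp only [Option.elim_some]
        convert this using 1
        change _ = -w (i, j) * _
        ring)
    (by
      rintro (_ | i)
      · simp [u]
      · have := neg_mem (s := projSpan k X w) (Submodule.subset_span ⟨i, rfl⟩)
        convert this using 1
        simp only [u, y', Option.elim_some]; ring)
    hP'
  rw [hmap, hmap, hPu, sub_zero, aeval_mul_const hP] at h1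
  set D := aeval (fun o : Option (Fin (n + 1)) => (o.elim (-1) fun i => w (i, j) : E)) P with hDdef
  have hDU : D ∈ coefField k w := by
    rw [hDdef, aeval_def, eval₂_eq]
    refine sum_mem fun d _ => mul_mem (hKU (coeff d P).2) (prod_mem fun o _ => pow_mem ?_ _)
    cases o
    · exact neg_mem (one_mem _)
    · exact w_mem_coefField k w _
  have h2 := Submodule.smul_mem _ (((-1) ^ (e + 1) * ⟨D, hDU⟩⁻¹ : coefField k w)) h1
  convert h2 using 1
  change _ = ((-1) ^ (e + 1) * D⁻¹) * ((-z) ^ (e + 1) * D)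
  rw [neg_pow z]
  have h3 : ((-1 : E) ^ (e + 1)) * (-1) ^ (e + 1) = 1 := by
    rw [← mul_pow]; simp
  calc z ^ (e + 1) = ((-1 : E) ^ (e + 1) * (-1) ^ (e + 1)) * z ^ (e + 1) * (D⁻¹ * D) := by
        rw [h3, inv_mul_cancel₀ hD]; ring
    _ = _ := by ring

theorem exists_step (hX : IsConeRing k X) (hw : IsGeneric R w) :
    ∃ a, ∀ m, a ≤ m → forms k X w ^ (m + 1) ≤ projSpan k X w * forms k X w ^ m := by
  choose e he using exists_pow_mem hX hw
  exact step_of_pow_mem projSpan_le_forms (fun j => algebraMap_mem_forms _) forms_le e he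

end GenericProjection

namespace GenericProjection

section Trace

variable {L E ι : Type*} [Field L] [Field E] [Algebra L E]

/-- The map sending `e` to the traces of its products with the members of the family `q`. -/
def traces (L : Type*) {E ι : Type*} [Field L] [Field E] [Algebra L E] (q : ι → E) :
    E →ₗ[L] (ι → L) :=
  LinearMap.pi fun o => Algebra.trace L E ∘ₗ LinearMap.mulRight L (q o)

@[simp] theorem traces_apply (q : ι → E) (e : E) (o : ι) :
    traces L q e o = Algebra.trace L E (e * q o) := rfl

variable [FiniteDimensional L E] [CharZero L] [Fintype ι]

theorem range_traces {q : ι → E} (hq : LinearIndependent L q) :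
    LinearMap.range (traces L q) = ⊤ := by
  classical
  by_contra h
  obtain ⟨f, hf0, hf⟩ := Submodule.exists_le_ker_of_lt_top _ (lt_top_iff_ne_top.2 h)
  have hval : ∀ v : ι → L, f v = ∑ o, v o * f (Pi.single o 1) := by
    intro v
    conv_lhs => rw [← LinearMap.sum_single_apply (fun _ => L) v, map_sum]
    refine Finset.sum_congr rfl fun o _ => ?_
    rw [← smul_eq_mul, ← map_smul, ← Pi.single_smul, smul_eq_mul, mul_one]
  have h1 : ∑ o, f (Pi.single o 1) • q o = 0 := by
    refine (traceForm_nondegenerate L E).1 _ fun e => ?_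
    have h2 : f (traces L q e) = 0 := hf ⟨e, rfl⟩
    rw [hval] at h2
    rw [Algebra.traceForm_apply, Finset.sum_mul, map_sum, ← h2]
    refine Finset.sum_congr rfl fun o _ => ?_
    rw [traces_apply, smul_mul_assoc, map_smul, smul_eq_mul, mul_comm, mul_comm (q o)]
  have h3 := Fintype.linearIndependent_iff.1 hq _ h1
  refine hf0 (LinearMap.ext fun v => ?_)
  rw [hval]
  simp [h3]

theorem finrank_ker_traces {q : ι → E} (hq : LinearIndependent L q) :
    Module.finrank L (LinearMap.ker (traces L q)) + Fintype.card ι = Module.finrank L E := by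
  rw [← LinearMap.finrank_range_add_finrank_ker (traces L q), range_traces hq, finrank_top,
    Module.finrank_fintype_fun_eq_card, add_comm]

theorem finrank_le_of_mul_mem {q : ι → E} (hq : LinearIndependent L q) {e : E} (he : e ≠ 0)
    {V : Submodule L (ι → L)} {T : Submodule L E} (hV : ∀ v ∈ V, e * ∑ o, v o • q o ∈ T) :
    Module.finrank L V ≤ Module.finrank L T := by
  let f : (ι → L) →ₗ[L] E := LinearMap.mulLeft L e ∘ₗ Fintype.linearCombination L q
  have hf : Function.Injective f := by
    intro v v' h
    have h1 : (Fintype.linearCombination L q) v = (Fintype.linearCombination L q) v' :=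
      mul_left_cancel₀ he h
    exact hq.fintypeLinearCombination_injective h1
  have hVT : ∀ v : V, f v ∈ T := fun v => hV v v.2
  refine LinearMap.finrank_le_finrank_of_injective
    (f := (f ∘ₗ V.subtype).codRestrict T hVT) fun v v' h => ?_
  exact Subtype.ext (hf (congrArg Subtype.val h))

theorem mem_bot_of_mul_mem {T : Submodule L E} (hT : Module.finrank L T = 2)
    (hodd : ¬ 2 ∣ Module.finrank L E) {u : E} (hu : ∀ e ∈ T, e * u ∈ T) :
    ∃ a : L, algebraMap L E a = u := by
  obtain ⟨⟨e, heT⟩, he⟩ : ∃ e : T, e ≠ 0 := by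
    have : Nontrivial T := Module.nontrivial_of_finrank_pos (R := L) (by omega)
    exact exists_ne 0
  have he0 : e ≠ 0 := fun h => he (Subtype.ext h)
  have hintegral : IsIntegral L u := Algebra.IsIntegral.isIntegral u
  have hm : ∀ i : ℕ, e * u ^ i ∈ T := by
    intro i
    induction i with
    | zero => simpa using heT
    | succ i ih => rw [pow_succ, ← mul_assoc]; exact hu _ ih
  have hdep : ¬ LinearIndependent L fun i : Fin 3 => (⟨e * u ^ (i : ℕ), hm i⟩ : T) := by
    intro h
    have := h.fintype_card_le_finrank
    simp [hT] at this
  rw [Fintype.not_linearIndependent_iff] at hdep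
  obtain ⟨g, hg, i, hi⟩ := hdep
  let p : Polynomial L := ∑ i : Fin 3, Polynomial.C (g i) * Polynomial.X ^ (i : ℕ)
  have hcoeff : p.coeff i = g i := by
    simp [p, Polynomial.finset_sum_coeff, Polynomial.coeff_X_pow, Fin.val_inj]
  have hp0 : p ≠ 0 := fun h => hi (by rw [← hcoeff, h]; simp)
  have hpu : Polynomial.aeval u p = 0 := by
    have h1 := congrArg Subtype.val hg
    simp only [AddSubmonoidClass.coe_finset_sum, Submodule.coe_smul, Submodule.coe_zero] at h1
    refine mul_left_cancel₀ he0 ?_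
    rw [mul_zero, ← h1]
    simp only [p, map_sum, map_mul, Polynomial.aeval_C, map_pow, Polynomial.aeval_X,
      Finset.mul_sum, Algebra.smul_def]
    exact Finset.sum_congr rfl fun i _ => by ring
  have hdeg : p.natDegree ≤ 2 := by
    refine Polynomial.natDegree_sum_le_of_forall_le _ _ fun i _ => ?_
    refine (Polynomial.natDegree_C_mul_X_pow_le _ _).trans ?_
    omega
  have h1 := Polynomial.natDegree_le_natDegree (minpoly.degree_le_of_ne_zero L u hp0 hpu)
  have h2 := minpoly.degree_dvd hintegral
  have h3 := minpoly.natDegree_pos hintegral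
  have h4 : (minpoly L u).natDegree ≠ 2 := fun h => hodd (h ▸ h2)
  exact minpoly.natDegree_eq_one_iff.1 (by omega)

end Trace
end GenericProjection

namespace GenericProjection

section Cubics

variable {U L E : Type*} [Field U] [Field L] [Field E] [Algebra U L] [Algebra L E] [Algebra U E]
  [IsScalarTower U L E] {m c : ℕ} {y : Fin m → L} {z : Fin c → E} {r : Fin 3 → E}

variable (U y) in
/-- The span of a family of elements of a subfield. -/
def yspan (E : Type*) [Field E] [Algebra L E] [Algebra U E] : Submodule U E :=
  Submodule.span U (Set.range fun i => algebraMap L E (y i))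

variable (U y z) in
/-- The span of a family of elements of a subfield and of a further family. -/
def yzspan : Submodule U E := yspan U y E ⊔ Submodule.span U (Set.range z)

/-- The family `1, z`. -/
def optOne {E : Type*} [One E] {c : ℕ} (z : Fin c → E) (o : Option (Fin c)) : E := o.elim 1 z

theorem z_mem_yzspan (a) : z a ∈ yzspan U y z :=
  Submodule.mem_sup_right (Submodule.subset_span ⟨a, rfl⟩)

theorem y_mem_yspan (i) : algebraMap L E (y i) ∈ yspan U y E := Submodule.subset_span ⟨i, rfl⟩

theorem y_mem_yzspan (i) : algebraMap L E (y i) ∈ yzspan U y z :=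
  Submodule.mem_sup_left (y_mem_yspan i)

theorem yspan_mul_yzspan_le {g : E →ₗ[U] L}
    (hg : ∀ i, ∀ v ∈ yzspan U y z, g (algebraMap L E (y i) * v) = 0) :
    yspan U y E * yzspan U y z ≤ LinearMap.ker g := by
  rw [Submodule.mul_le]
  intro u hu v hv
  refine Submodule.span_induction ?_ ?_ ?_ ?_ hu
  · rintro _ ⟨i, rfl⟩; exact hg i v hv
  · simp
  · intro a b _ _ ha hb; rw [add_mul]; exact add_mem ha hb
  · intro a b _ hb; rw [smul_mul_assoc]; exact Submodule.smul_mem _ _ hb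

/-- Functionals on the quadratic forms are determined by their values on a spanning set modulo
the ideal generated by `y`. -/
theorem eq_on_mul (hr : yzspan U y z * yzspan U y z ≤
      yspan U y E * yzspan U y z ⊔ Submodule.span U (Set.range r))
    {g g' : E →ₗ[U] L}
    (hg : ∀ i, ∀ v ∈ yzspan U y z,
      g (algebraMap L E (y i) * v) = g' (algebraMap L E (y i) * v))
    (hgr : ∀ b, g (r b) = g' (r b)) {u v : E} (hu : u ∈ yzspan U y z) (hv : v ∈ yzspan U y z) :
    g (u * v) = g' (u * v) := by
  have h1 : yspan U y E * yzspan U y z ⊔ Submodule.span U (Set.range r) ≤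
      LinearMap.ker (g - g') := by
    refine sup_le (yspan_mul_yzspan_le fun i v hv => ?_) (Submodule.span_le.2 ?_)
    · rw [LinearMap.sub_apply, hg i v hv, sub_self]
    · rintro _ ⟨b, rfl⟩
      simp [hgr]
  have h2 := h1 (hr (Submodule.mul_mem_mul hu hv))
  rwa [LinearMap.mem_ker, LinearMap.sub_apply, sub_eq_zero] at h2

/-- The trace of the product with `e`, as a functional over the base field. -/
def traceMul (U L : Type*) {E : Type*} [Field U] [Field L] [Field E] [Algebra U L] [Algebra L E]
    [Algebra U E] [IsScalarTower U L E] (e : E) : E →ₗ[U] L :=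
  (Algebra.trace L E ∘ₗ LinearMap.mulLeft L e).restrictScalars U

@[simp] theorem traceMul_apply (e v : E) : traceMul U L e v = Algebra.trace L E (e * v) := rfl

theorem trace_mul_eq_zero {e : E} (he : e ∈ LinearMap.ker (traces L (optOne z)))
    {v : E} (hv : v ∈ yzspan U y z) : Algebra.trace L E (e * v) = 0 := by
  have h0 : ∀ o, Algebra.trace L E (e * optOne z o) = 0 := fun o => congrFun he o
  have h1 : yzspan U y z ≤ LinearMap.ker (traceMul U L e) := by
    refine sup_le (Submodule.span_le.2 ?_) (Submodule.span_le.2 ?_)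
    · rintro _ ⟨i, rfl⟩
      have := h0 none
      simp only [optOne, Option.elim_none, mul_one] at this
      simp only [SetLike.mem_coe, LinearMap.mem_ker, traceMul_apply]
      rw [mul_comm, ← Algebra.smul_def, map_smul, this, smul_zero]
    · rintro _ ⟨a, rfl⟩
      exact h0 (some a)
  exact h1 hv

theorem trace_y_mul (e v : E) (i) : Algebra.trace L E (e * (algebraMap L E (y i) * v)) =
    y i * Algebra.trace L E (e * v) := by
  rw [mul_left_comm, ← Algebra.smul_def, map_smul, smul_eq_mul]

theorem mem_ker_traces {e : E} (h1 : Algebra.trace L E e = 0)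
    (h2 : ∀ a, Algebra.trace L E (e * z a) = 0) : e ∈ LinearMap.ker (traces L (optOne z)) := by
  rw [LinearMap.mem_ker]
  funext o
  cases o with
  | none => simpa [optOne] using h1
  | some a => exact h2 a

variable (L z r) in
/-- The matrix of values of the products `z a * r b` under `φ`. -/
def values (φ : E →ₗ[U] U) : (Fin c → L) →ₗ[L] (Fin 3 → L) :=
  Fintype.linearCombination L fun a b => algebraMap U L (φ (z a * r b))

variable (L z) in
/-- The functional `x ↦ ∑ v a φ(z a x)`. -/
def combo (φ : E →ₗ[U] U) (v : Fin c → L) : E →ₗ[U] L :=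
  ∑ a, (v a) • ((Algebra.linearMap U L) ∘ₗ φ ∘ₗ LinearMap.mulLeft U (z a))

theorem combo_apply (φ : E →ₗ[U] U) (v : Fin c → L) (x : E) :
    combo L z φ v x = ∑ a, v a * algebraMap U L (φ (z a * x)) := by
  simp [combo, LinearMap.sum_apply]

theorem values_apply (φ : E →ₗ[U] U) (v : Fin c → L) (b : Fin 3) :
    values L z r φ v b = combo L z φ v (r b) := by
  simp [values, Fintype.linearCombination_apply, combo_apply]

theorem combo_y {φ : E →ₗ[U] U}
    (hφ : ∀ i, ∀ u ∈ yzspan U y z, ∀ v ∈ yzspan U y z, φ (algebraMap L E (y i) * (u * v)) = 0)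
    (v : Fin c → L) (i) {x : E} (hx : x ∈ yzspan U y z) :
    combo L z φ v (algebraMap L E (y i) * x) = 0 := by
  rw [combo_apply]
  refine Finset.sum_eq_zero fun a _ => ?_
  rw [mul_left_comm, hφ i _ (z_mem_yzspan a) _ hx, map_zero, mul_zero]

variable [CharZero L] [FiniteDimensional L E]

theorem finrank_T (hq : LinearIndependent L (optOne z))
    (hdeg : Module.finrank L E = c + 3) :
    Module.finrank L (LinearMap.ker (traces L (optOne z))) = 2 := by
  have := finrank_ker_traces hq
  rw [Fintype.card_option, Fintype.card_fin] at this
  omega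

theorem eq_zero_of_traces_r (hr : yzspan U y z * yzspan U y z ≤
      yspan U y E * yzspan U y z ⊔ Submodule.span U (Set.range r))
    (hq : LinearIndependent L (optOne z)) (hc : 2 ≤ c)
    (hdeg : Module.finrank L E = c + 3) {e : E}
    (he : e ∈ LinearMap.ker (traces L (optOne z))) (her : traces L r e = 0) : e = 0 := by
  by_contra he0
  have h1 : ∀ u ∈ yzspan U y z, ∀ v ∈ yzspan U y z, Algebra.trace L E (e * (u * v)) = 0 := by
    intro u hu v hv
    have := eq_on_mul hr (g := traceMul U L e) (g' := 0) (fun i v hv => ?_) (fun b => ?_) hu hv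
    · simpa using this
    · simp [trace_y_mul, trace_mul_eq_zero he hv]
    · simpa using congrFun her b
  have h2 : ∀ v : Option (Fin c) → L, v ∈ (⊤ : Submodule L (Option (Fin c) → L)) →
      e * ∑ o, v o • optOne z o ∈ LinearMap.ker (traces L (optOne z)) := by
    intro v _
    rw [Finset.mul_sum]
    refine Submodule.sum_mem _ fun o _ => ?_
    rw [mul_smul_comm]
    refine Submodule.smul_mem _ _ ?_
    cases o with
    | none => simpa [optOne] using he
    | some a =>
      refine mem_ker_traces (trace_mul_eq_zero (U := U) (y := y) he (z_mem_yzspan a)) fun b => ?_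
      simp only [optOne, Option.elim_some]
      rw [mul_assoc]
      exact h1 _ (z_mem_yzspan a) _ (z_mem_yzspan b)
  have h3 := finrank_le_of_mul_mem hq he0 h2
  rw [finrank_T hq hdeg, finrank_top, Module.finrank_fintype_fun_eq_card, Fintype.card_option,
    Fintype.card_fin] at h3
  omega

/-- If a trace functional agrees with a combination of the `φ(z a ·)`, then it vanishes. -/
theorem eq_zero_of_traces_eq_values (hr : yzspan U y z * yzspan U y z ≤
      yspan U y E * yzspan U y z ⊔ Submodule.span U (Set.range r))
    (hq : LinearIndependent L (optOne z)) (hc : 4 ≤ c)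
    (hdeg : Module.finrank L E = c + 3) {φ : E →ₗ[U] U}
    (hφ : ∀ i, ∀ u ∈ yzspan U y z, ∀ v ∈ yzspan U y z, φ (algebraMap L E (y i) * (u * v)) = 0)
    {e : E} (he : e ∈ LinearMap.ker (traces L (optOne z)))
    (hev : traces L r e ∈ LinearMap.range (values L z r φ)) : e = 0 := by
  by_contra he0
  have key : ∀ e ∈ LinearMap.ker (traces L (optOne z)), ∀ v, values L z r φ v = traces L r e →
      ∀ v', values L z r φ v' = 0 →
        e * ∑ a, v' a • z a ∈ LinearMap.ker (traces L (optOne z)) := by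
    intro e he v hv v' hv'
    have h1 : ∀ u ∈ yzspan U y z, ∀ x ∈ yzspan U y z,
        Algebra.trace L E (e * (u * x)) = combo L z φ v (u * x) := by
      intro u hu x hx
      refine eq_on_mul hr (g := traceMul U L e) (fun i v hv => ?_) (fun b => ?_) hu hx
      · rw [combo_y hφ _ _ hv, traceMul_apply, trace_y_mul, trace_mul_eq_zero he hv, mul_zero]
      · rw [← values_apply, hv]; rfl
    have h2 : ∀ u ∈ yzspan U y z, ∀ x ∈ yzspan U y z, combo L z φ v' (u * x) = 0 := by
      intro u hu x hx
      refine eq_on_mul hr (g' := 0) (fun i v hv => ?_) (fun b => ?_) hu hx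
      · rw [combo_y hφ _ _ hv]; rfl
      · rw [← values_apply, hv']; rfl
    refine mem_ker_traces ?_ fun d => ?_
    · rw [Finset.mul_sum, map_sum]
      refine Finset.sum_eq_zero fun a _ => ?_
      rw [mul_smul_comm, map_smul, trace_mul_eq_zero (U := U) (y := y) he (z_mem_yzspan a),
        smul_zero]
    · have h3 : ∀ a, combo L z φ v (z a * z d) = ∑ b, v b * algebraMap U L (φ (z b * (z a * z d))) :=
        fun a => combo_apply _ _ _
      rw [mul_assoc, Finset.sum_mul, Finset.mul_sum, map_sum]
      have h4 : ∀ a, Algebra.trace L E (e * (v' a • z a * z d)) =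
          ∑ b, v b * (v' a * algebraMap U L (φ (z a * (z b * z d)))) := by
        intro a
        rw [smul_mul_assoc, mul_smul_comm, map_smul, h1 _ (z_mem_yzspan a) _ (z_mem_yzspan d), h3,
          smul_eq_mul, Finset.mul_sum]
        refine Finset.sum_congr rfl fun b _ => ?_
        rw [mul_left_comm (z a) (z b)]; ring
      simp only [h4]
      rw [Finset.sum_comm]
      refine Finset.sum_eq_zero fun b _ => ?_
      rw [← Finset.mul_sum, ← combo_apply, h2 _ (z_mem_yzspan b) _ (z_mem_yzspan d), mul_zero]
  obtain ⟨v, hv⟩ := hev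
  -- the space of multipliers is small
  let F' : (Option (Fin c) → L) →ₗ[L] (Fin 3 → L) :=
    values L z r φ ∘ₗ LinearMap.funLeft L L some
  have h1 : Module.finrank L (LinearMap.ker F') ≤ 2 := by
    rw [← finrank_T hq hdeg]
    refine finrank_le_of_mul_mem hq he0 fun v' hv' => ?_
    rw [Fintype.sum_option, mul_add]
    refine add_mem ?_ (key e he v hv (fun a => v' (some a)) hv')
    rw [mul_smul_comm]
    exact Submodule.smul_mem _ _ (by simpa [optOne] using he)
  have h2 := LinearMap.finrank_range_add_finrank_ker F'
  rw [Module.finrank_fintype_fun_eq_card, Fintype.card_option, Fintype.card_fin] at h2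
  have h3 : Module.finrank L (LinearMap.range F') ≤
      Module.finrank L (LinearMap.range (values L z r φ)) :=
    Submodule.finrank_mono (LinearMap.range_comp_le_range _ _)
  have h4 := (LinearMap.range (values L z r φ)).finrank_le
  rw [Module.finrank_fintype_fun_eq_card, Fintype.card_fin] at h4
  have hc4 : c = 4 := by omega
  have htop : LinearMap.range (values L z r φ) = ⊤ := by
    refine Submodule.eq_top_of_finrank_eq ?_
    rw [Module.finrank_fintype_fun_eq_card, Fintype.card_fin]
    omega
  have h5 := LinearMap.finrank_range_add_finrank_ker (values L z r φ)
  rw [htop, finrank_top, Module.finrank_fintype_fun_eq_card, Module.finrank_fintype_fun_eq_card,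
    Fintype.card_fin, Fintype.card_fin] at h5
  obtain ⟨⟨v', hv'⟩, hne⟩ : ∃ x : LinearMap.ker (values L z r φ), x ≠ 0 := by
    have : Nontrivial (LinearMap.ker (values L z r φ)) :=
      Module.nontrivial_of_finrank_pos (R := L) (by omega)
    exact exists_ne 0
  obtain ⟨a, ha⟩ := mem_bot_of_mul_mem (finrank_T hq hdeg) (u := ∑ a, v' a • z a)
    (by rw [hdeg, hc4]; decide) (by
      intro e' he'
      have : traces L r e' ∈ LinearMap.range (values L z r φ) := htop ▸ Submodule.mem_top
      obtain ⟨v'', hv''⟩ := this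
      exact key e' he' v'' hv'' v' hv')
  have h6 := Fintype.linearIndependent_iff.1 hq (fun o => o.elim (-a) v') (by
    rw [Fintype.sum_option]
    simp only [optOne, Option.elim_none, Option.elim_some]
    rw [← ha, neg_smul, Algebra.smul_def, mul_one, neg_add_cancel])
  refine hne (Subtype.ext (funext fun b => ?_))
  exact h6 (some b)

end Cubics
end GenericProjection

namespace GenericProjection

section Cubics

variable {U L E : Type*} [Field U] [Field L] [Field E] [Algebra U L] [Algebra L E] [Algebra U E]
  [IsScalarTower U L E] {m c : ℕ} {y : Fin m → L} {z : Fin c → E} {r : Fin 3 → E}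

/-- A functional which vanishes on cubic forms in the ideal of `y` but not on all cubic forms. -/
theorem exists_cubic_functional
    (h : ¬ yzspan U y z * (yzspan U y z * yzspan U y z) ≤
      yspan U y E * (yzspan U y z * yzspan U y z)) :
    ∃ φ : E →ₗ[U] U, (∀ i, ∀ u ∈ yzspan U y z, ∀ v ∈ yzspan U y z,
      φ (algebraMap L E (y i) * (u * v)) = 0) ∧ ∃ a b d, φ (z a * (z b * z d)) ≠ 0 := by
  obtain ⟨x, hx, hx'⟩ := SetLike.not_le_iff_exists.1 h
  obtain ⟨φ, hφx, hφ⟩ := Submodule.exists_le_ker_of_notMem hx'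
  have hφ' : ∀ i, ∀ u ∈ yzspan U y z, ∀ v ∈ yzspan U y z,
      φ (algebraMap L E (y i) * (u * v)) = 0 := fun i u hu v hv =>
    hφ (Submodule.mul_mem_mul (y_mem_yspan i) (Submodule.mul_mem_mul hu hv))
  refine ⟨φ, hφ', ?_⟩
  by_contra! hz
  refine hφx ?_
  have h3 : ∀ a b, ∀ u ∈ yzspan U y z, φ (z a * (z b * u)) = 0 := by
    intro a b u hu
    have : yzspan U y z ≤ LinearMap.ker (φ ∘ₗ LinearMap.mulLeft U (z a * z b)) := by
      refine sup_le (Submodule.span_le.2 ?_) (Submodule.span_le.2 ?_)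
      · rintro _ ⟨i, rfl⟩
        have := hφ' i _ (z_mem_yzspan a) _ (z_mem_yzspan b)
        simpa [mul_comm, mul_left_comm, mul_assoc] using this
      · rintro _ ⟨d, rfl⟩
        simpa [mul_assoc] using hz a b d
    simpa [mul_assoc] using this hu
  have h2 : ∀ a, ∀ u ∈ yzspan U y z, ∀ v ∈ yzspan U y z, φ (z a * (u * v)) = 0 := by
    intro a u hu v hv
    have : yzspan U y z ≤ LinearMap.ker (φ ∘ₗ LinearMap.mulLeft U (z a * v)) := by
      refine sup_le (Submodule.span_le.2 ?_) (Submodule.span_le.2 ?_)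
      · rintro _ ⟨i, rfl⟩
        have := hφ' i _ (z_mem_yzspan a) _ hv
        simpa [mul_comm, mul_left_comm, mul_assoc] using this
      · rintro _ ⟨d, rfl⟩
        have := h3 a d v hv
        simpa [mul_comm, mul_left_comm, mul_assoc] using this
    have := this hu
    simpa [mul_comm, mul_left_comm, mul_assoc] using this
  have h1 : ∀ t ∈ yzspan U y z, ∀ u ∈ yzspan U y z, ∀ v ∈ yzspan U y z,
      φ (t * (u * v)) = 0 := by
    intro t ht u hu v hv
    have : yzspan U y z ≤ LinearMap.ker (φ ∘ₗ LinearMap.mulLeft U (u * v)) := by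
      refine sup_le (Submodule.span_le.2 ?_) (Submodule.span_le.2 ?_)
      · rintro _ ⟨i, rfl⟩
        rw [SetLike.mem_coe, LinearMap.mem_ker, LinearMap.comp_apply, LinearMap.mulLeft_apply,
          mul_comm]
        exact hφ' i _ hu _ hv
      · rintro _ ⟨d, rfl⟩
        rw [SetLike.mem_coe, LinearMap.mem_ker, LinearMap.comp_apply, LinearMap.mulLeft_apply,
          mul_comm]
        exact h2 d u hu v hv
    have := this ht
    rwa [LinearMap.mem_ker, LinearMap.comp_apply, LinearMap.mulLeft_apply, mul_comm] at this
  have h0 : yzspan U y z * (yzspan U y z * yzspan U y z) ≤ LinearMap.ker φ := by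
    rw [Submodule.mul_le]
    intro t ht q hq
    refine Submodule.mul_induction_on hq (fun u hu v hv => h1 t ht u hu v hv) fun a b ha hb => ?_
    rw [mul_add]; exact add_mem ha hb
  exact h0 hx

variable [CharZero L] [FiniteDimensional L E]

/-- If the functionals `φ(u ·)` are proportional on quadratic forms, then `φ` gives rise to a
functional on quadratic forms which is the square of a linear form. -/
theorem exists_square (hr : yzspan U y z * yzspan U y z ≤
      yspan U y E * yzspan U y z ⊔ Submodule.span U (Set.range r)) {φ : E →ₗ[U] U}
    (hφ : ∀ i, ∀ u ∈ yzspan U y z, ∀ v ∈ yzspan U y z, φ (algebraMap L E (y i) * (u * v)) = 0)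
    (hφ0 : ∃ a b d, φ (z a * (z b * z d)) ≠ 0)
    (hrank : Module.finrank L (LinearMap.range (values L z r φ)) ≤ 1) :
    ∃ ℓ θ : E →ₗ[U] U, (∀ i, ℓ (algebraMap L E (y i)) = 0) ∧ (∃ j, ℓ (z j) ≠ 0) ∧
      (∀ u ∈ yzspan U y z, ∀ v ∈ yzspan U y z, θ (u * v) = ℓ u * ℓ v) ∧
      ∀ v, ∃ a : L, ∀ b, values L z r φ v b = a * algebraMap U L (θ (r b)) := by
  obtain ⟨⟨g, v0, hv0⟩, hg⟩ := finrank_le_one_iff.1 hrank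
  have hinj : Function.Injective (algebraMap U L) := (algebraMap U L).injective
  set γ := combo L z φ v0 with hγ
  have hγr : ∀ b, γ (r b) = g b := fun b => by rw [← hv0, values_apply]
  have ht : ∀ v, ∃ t : L, ∀ b, values L z r φ v b = t * g b := by
    intro v
    obtain ⟨t, ht⟩ := hg ⟨_, v, rfl⟩
    exact ⟨t, fun b => (congrFun (congrArg Subtype.val ht) b).symm⟩
  have hz : ∀ a, ∃ t : L, ∀ u ∈ yzspan U y z, ∀ v ∈ yzspan U y z,
      algebraMap U L (φ (z a * (u * v))) = t * γ (u * v) := by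
    classical
    intro a
    obtain ⟨t, ht⟩ := ht (Pi.single a 1)
    refine ⟨t, fun u hu v hv => ?_⟩
    refine eq_on_mul hr (g := (Algebra.linearMap U L) ∘ₗ φ ∘ₗ LinearMap.mulLeft U (z a))
      (g' := t • γ) (fun i x hx => ?_) (fun b => ?_) hu hv
    · rw [LinearMap.smul_apply, hγ, combo_y hφ _ _ hx]
      have := hφ i _ (z_mem_yzspan a) _ hx
      simp only [LinearMap.comp_apply, LinearMap.mulLeft_apply, Algebra.linearMap_apply]
      rw [mul_left_comm, this, map_zero, smul_zero]
    · rw [LinearMap.smul_apply, hγr, smul_eq_mul, ← ht, values_apply, combo_apply]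
      simp [Pi.single_apply]
  have hG : ∀ w ∈ yzspan U y z, ∃ t : L, ∀ u ∈ yzspan U y z, ∀ v ∈ yzspan U y z,
      algebraMap U L (φ (w * (u * v))) = t * γ (u * v) := by
    intro w hw
    have hspan : yzspan U y z =
        Submodule.span U ((Set.range fun i => algebraMap L E (y i)) ∪ Set.range z) :=
      (Submodule.span_union _ _).symm
    rw [hspan] at hw
    refine Submodule.span_induction ?_ ⟨0, by simp⟩ ?_ ?_ hw
    · rintro _ (⟨i, rfl⟩ | ⟨a, rfl⟩)
      · exact ⟨0, fun u hu v hv => by rw [hφ i u hu v hv]; simp⟩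
      · exact hz a
    · rintro x x' _ _ ⟨t, ht⟩ ⟨t', ht'⟩
      refine ⟨t + t', fun u hu v hv => ?_⟩
      rw [add_mul, map_add, map_add, ht u hu v hv, ht' u hu v hv, add_mul]
    · rintro s x _ ⟨t, ht⟩
      refine ⟨algebraMap U L s * t, fun u hu v hv => ?_⟩
      rw [smul_mul_assoc, map_smul, smul_eq_mul, map_mul, ht u hu v hv, mul_assoc]
  have hminor : ∀ w ∈ yzspan U y z, ∀ w' ∈ yzspan U y z, ∀ u ∈ yzspan U y z,
      ∀ v ∈ yzspan U y z, ∀ u' ∈ yzspan U y z, ∀ v' ∈ yzspan U y z,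
      φ (w * (u * v)) * φ (w' * (u' * v')) = φ (w' * (u * v)) * φ (w * (u' * v')) := by
    intro w hw w' hw' u hu v hv u' hu' v' hv'
    obtain ⟨t, ht⟩ := hG w hw
    obtain ⟨t', ht'⟩ := hG w' hw'
    apply hinj
    rw [RingHom.map_mul, RingHom.map_mul, ht u hu v hv, ht' u' hu' v' hv', ht' u hu v hv, ht u' hu' v' hv']
    ring
  obtain ⟨a, b, d, habd⟩ := hφ0
  have hzz := fun a => z_mem_yzspan (U := U) (y := y) (z := z) a
  have haad : φ (z a * (z a * z d)) ≠ 0 := by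
    intro h0
    have := hminor _ (hzz a) _ (hzz b) _ (hzz b) _ (hzz d) _ (hzz a) _ (hzz d)
    rw [h0, mul_zero, mul_left_comm (z b) (z a)] at this
    exact habd (mul_self_eq_zero.1 this)
  have haaa : φ (z a * (z a * z a)) ≠ 0 := by
    intro h0
    have := hminor _ (hzz a) _ (hzz d) _ (hzz a) _ (hzz d) _ (hzz a) _ (hzz a)
    rw [h0, mul_zero, show z d * (z a * z a) = z a * (z a * z d) by ring] at this
    exact haad (mul_self_eq_zero.1 this)
  set μ := φ (z a * (z a * z a)) with hμ
  refine ⟨μ⁻¹ • φ ∘ₗ LinearMap.mulLeft U (z a * z a), μ⁻¹ • φ ∘ₗ LinearMap.mulLeft U (z a),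
    fun i => ?_, ⟨a, ?_⟩, fun u hu v hv => ?_, fun v => ?_⟩
  · have := hφ i _ (hzz a) _ (hzz a)
    rw [mul_comm] at this
    rw [LinearMap.smul_apply, LinearMap.comp_apply, LinearMap.mulLeft_apply, this, smul_zero]
  · simp only [LinearMap.smul_apply, LinearMap.comp_apply, LinearMap.mulLeft_apply, smul_eq_mul,
      mul_assoc]
    rw [← hμ, inv_mul_cancel₀ haaa]
    exact one_ne_zero
  · simp only [LinearMap.smul_apply, LinearMap.comp_apply, LinearMap.mulLeft_apply, smul_eq_mul]
    have := hminor _ hu _ (hzz a) _ (hzz a) _ hv _ (hzz a) _ (hzz a)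
    rw [← hμ] at this
    have h1 : φ (z a * (u * v)) = μ⁻¹ * (φ (z a * z a * u) * φ (z a * z a * v)) := by
      rw [eq_inv_mul_iff_mul_eq₀ haaa, mul_comm μ, show z a * (u * v) = u * (z a * v) by ring, this,
        show z a * z a * u = u * (z a * z a) by ring, mul_assoc (z a)]
      ring
    rw [h1]; ring
  · classical
    obtain ⟨s, hs⟩ := ht v
    obtain ⟨t, ht'⟩ := ht (Pi.single a 1)
    have hval : ∀ b, values L z r φ (Pi.single a 1) b = algebraMap U L (φ (z a * r b)) := by
      intro b
      rw [values_apply, combo_apply]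
      simp [Pi.single_apply]
    have ht0 : t ≠ 0 := by
      rintro rfl
      refine haaa (hinj ?_)
      rw [map_zero]
      refine eq_on_mul hr (g := (Algebra.linearMap U L) ∘ₗ φ ∘ₗ LinearMap.mulLeft U (z a))
        (g' := 0) (fun i x hx => ?_) (fun b => ?_) (hzz a) (hzz a)
      · have := hφ i _ (z_mem_yzspan a) _ hx
        simp only [LinearMap.comp_apply, LinearMap.mulLeft_apply, Algebra.linearMap_apply]
        rw [mul_left_comm, this, map_zero]; rfl
      · have := hval b
        rw [ht', zero_mul] at this
        exact this.symm
    have hμ' : algebraMap U L μ ≠ 0 := fun h => haaa (hinj (by rw [h, map_zero]))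
    refine ⟨s * t⁻¹ * algebraMap U L μ, fun b => ?_⟩
    simp only [LinearMap.smul_apply, LinearMap.comp_apply, LinearMap.mulLeft_apply, smul_eq_mul,
      map_mul, map_inv₀]
    rw [← hval, ht', hs]
    field_simp

/-- The cubic forms are generated by the quadratic ones over `y`. -/
theorem cubes_le (hr : yzspan U y z * yzspan U y z ≤
      yspan U y E * yzspan U y z ⊔ Submodule.span U (Set.range r))
    (hq : LinearIndependent L (optOne z)) (hc : 4 ≤ c)
    (hdeg : Module.finrank L E = c + 3)
    (htan : ∀ ℓ θ : E →ₗ[U] U, (∀ i, ℓ (algebraMap L E (y i)) = 0) → (∃ j, ℓ (z j) ≠ 0) →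
      (∀ u ∈ yzspan U y z, ∀ v ∈ yzspan U y z, θ (u * v) = ℓ u * ℓ v) →
      ∃ Θ ψ : E →ₗ[U] L, (∀ i, ψ (algebraMap L E (y i)) = y i) ∧
        ∀ u ∈ yzspan U y z, ∀ v ∈ yzspan U y z,
          Θ (u * v) = algebraMap U L (ℓ u) * ψ v + ψ u * algebraMap U L (ℓ v)) :
    yzspan U y z * (yzspan U y z * yzspan U y z) ≤
      yspan U y E * (yzspan U y z * yzspan U y z) := by
  by_contra hcon
  obtain ⟨φ, hφ, hφ0⟩ := exists_cubic_functional hcon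
  set T := LinearMap.ker (traces L (optOne z)) with hT
  set S := T.map (traces L r) with hS
  have hSrank : Module.finrank L S = 2 := by
    rw [← finrank_T hq hdeg, hS]
    refine (LinearEquiv.finrank_eq (LinearEquiv.ofBijective
      ((traces L r).submoduleMap T) ⟨?_, LinearMap.submoduleMap_surjective _ _⟩)).symm
    rw [← LinearMap.ker_eq_bot, LinearMap.ker_eq_bot']
    intro e he
    exact Subtype.ext (eq_zero_of_traces_r hr hq (by omega) hdeg e.2 (congrArg Subtype.val he))
  have hdisj : S ⊓ LinearMap.range (values L z r φ) = ⊥ := by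
    rw [eq_bot_iff]
    rintro _ ⟨⟨e, he, rfl⟩, hev⟩
    have := eq_zero_of_traces_eq_values hr hq hc hdeg hφ he hev
    simp [this]
  have hsum := Submodule.finrank_sup_add_finrank_inf_eq S (LinearMap.range (values L z r φ))
  rw [hdisj, finrank_bot, add_zero, hSrank] at hsum
  have hle := (S ⊔ LinearMap.range (values L z r φ)).finrank_le
  rw [Module.finrank_fintype_fun_eq_card, Fintype.card_fin] at hle
  obtain ⟨ℓ, θ, hℓy, ⟨j0, hj0⟩, hθ, hprop⟩ := exists_square hr hφ hφ0 (by omega)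
  obtain ⟨Θ, ψ, hψ, hΘ⟩ := htan ℓ θ hℓy ⟨j0, hj0⟩ hθ
  have hrange : LinearMap.range (values L z r φ) ≠ ⊥ := by
    intro h0
    obtain ⟨a, b, d, habd⟩ := hφ0
    classical
    have h1 : values L z r φ (Pi.single a 1) = 0 := by
      rw [← Submodule.mem_bot L, ← h0]; exact ⟨_, rfl⟩
    refine habd ((algebraMap U L).injective ?_)
    rw [map_zero]
    refine eq_on_mul hr (g := (Algebra.linearMap U L) ∘ₗ φ ∘ₗ LinearMap.mulLeft U (z a))
        (g' := 0) (fun i x hx => ?_) (fun b => ?_) (z_mem_yzspan b) (z_mem_yzspan d)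
    · have := hφ i _ (z_mem_yzspan a) _ hx
      simp only [LinearMap.comp_apply, LinearMap.mulLeft_apply, Algebra.linearMap_apply]
      rw [mul_left_comm, this, map_zero]; rfl
    · have := congrFun h1 b
      rw [values_apply, combo_apply] at this
      simpa [Pi.single_apply] using this
  have hpos : 0 < Module.finrank L (LinearMap.range (values L z r φ)) :=
    Module.finrank_pos_iff.2 ((Submodule.nontrivial_iff_ne_bot).2 hrange)
  have htop : S ⊔ LinearMap.range (values L z r φ) = ⊤ := by
    refine Submodule.eq_top_of_finrank_eq ?_
    rw [Module.finrank_fintype_fun_eq_card, Fintype.card_fin]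
    omega
  obtain ⟨e0, he0⟩ : (fun o : Option (Fin c) => o.elim 0 fun a => algebraMap U L (ℓ (z a))) ∈
      LinearMap.range (traces L (optOne z)) := range_traces hq ▸ Submodule.mem_top
  have he01 : Algebra.trace L E e0 = 0 := by
    have := congrFun he0 none
    simpa [optOne] using this
  have he0z : ∀ a, Algebra.trace L E (e0 * z a) = algebraMap U L (ℓ (z a)) := fun a =>
    congrFun he0 (some a)
  have hmem : (fun b => Θ (r b) - Algebra.trace L E (e0 * r b)) ∈
      S ⊔ LinearMap.range (values L z r φ) := htop ▸ Submodule.mem_top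
  obtain ⟨_, ⟨e', he', rfl⟩, _, ⟨v, rfl⟩, hsumr⟩ := Submodule.mem_sup.1 hmem
  obtain ⟨a, ha⟩ := hprop v
  have he'1 : Algebra.trace L E e' = 0 := by
    have := congrFun (show traces L (optOne z) e' = 0 from he') none
    simpa [optOne] using this
  have he'z : ∀ a, Algebra.trace L E (e' * z a) = 0 := fun a =>
    trace_mul_eq_zero (U := U) (y := y) he' (z_mem_yzspan a)
  set e := e0 + e' with he
  have he1 : Algebra.trace L E e = 0 := by rw [he, map_add, he01, he'1, add_zero]
  have hez : ∀ a, Algebra.trace L E (e * z a) = algebraMap U L (ℓ (z a)) := fun a => by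
    rw [he, add_mul, map_add, he0z, he'z, add_zero]
  have heG : ∀ u ∈ yzspan U y z, Algebra.trace L E (e * u) = algebraMap U L (ℓ u) := by
    intro u hu
    have h1 : yzspan U y z ≤ LinearMap.ker (traceMul U L e - (Algebra.linearMap U L) ∘ₗ ℓ) := by
      refine sup_le (Submodule.span_le.2 ?_) (Submodule.span_le.2 ?_)
      · rintro _ ⟨i, rfl⟩
        have := trace_y_mul (L := L) (y := y) e 1 i
        rw [mul_one, mul_one, he1, mul_zero] at this
        simp [this, hℓy]
      · rintro _ ⟨a, rfl⟩
        simp [hez]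
    have h2 := h1 hu
    rw [LinearMap.mem_ker, LinearMap.sub_apply, sub_eq_zero] at h2
    exact h2
  have hquad : ∀ u ∈ yzspan U y z, ∀ v ∈ yzspan U y z, Algebra.trace L E (e * (u * v)) =
      algebraMap U L (ℓ u) * ψ v + ψ u * algebraMap U L (ℓ v) -
        a * (algebraMap U L (ℓ u) * algebraMap U L (ℓ v)) := by
    intro u hu v hv
    have := eq_on_mul hr (g := traceMul U L e) (g' := Θ - a • (Algebra.linearMap U L) ∘ₗ θ)
      (fun i x hx => ?_) (fun b => ?_) hu hv
    · simp only [traceMul_apply, LinearMap.sub_apply, LinearMap.smul_apply, LinearMap.comp_apply,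
        Algebra.linearMap_apply, hθ u hu v hv, hΘ u hu v hv, smul_eq_mul, map_mul] at this
      exact this
    · simp only [traceMul_apply, LinearMap.sub_apply, LinearMap.smul_apply, LinearMap.comp_apply,
        Algebra.linearMap_apply, hθ _ (y_mem_yzspan i) x hx, hΘ _ (y_mem_yzspan i) x hx, hℓy,
        trace_y_mul, heG x hx, hψ]
      simp
    · have h1 := congrFun hsumr b
      simp only [Pi.add_apply, traces_apply, ha] at h1
      simp only [traceMul_apply, LinearMap.sub_apply, LinearMap.smul_apply, LinearMap.comp_apply,
        Algebra.linearMap_apply, smul_eq_mul, he, add_mul, map_add]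
      linear_combination h1
  have hene : e ≠ 0 := by
    intro h0
    have := hez j0
    rw [h0, zero_mul, map_zero] at this
    exact hj0 ((algebraMap U L).injective (by rw [← this, map_zero]))
  -- multipliers of `e` annihilated by both `ℓ` and `ψ`
  let P : (Option (Fin c) → L) →ₗ[L] (Fin 2 → L) :=
    Fintype.linearCombination L fun o => o.elim ![0, 1]
      fun j => ![algebraMap U L (ℓ (z j)), ψ (z j)]
  have hP0 : ∀ v, P v 0 = ∑ j, v (some j) * algebraMap U L (ℓ (z j)) := by
    intro v
    simp [P, Fintype.linearCombination_apply, Fintype.sum_option]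
  have hP1 : ∀ v, P v 1 = v none + ∑ j, v (some j) * ψ (z j) := by
    intro v
    simp [P, Fintype.linearCombination_apply, Fintype.sum_option]
  have hker : Module.finrank L (LinearMap.ker P) ≤ Module.finrank L T := by
    refine finrank_le_of_mul_mem hq hene fun v hv => ?_
    have hv0 := hP0 v
    have hv1 := hP1 v
    rw [show P v = 0 from hv, Pi.zero_apply] at hv0 hv1
    have hexp : ∀ x, Algebra.trace L E (e * (∑ o, v o • optOne z o) * x) =
        v none * Algebra.trace L E (e * x) +
          ∑ j, v (some j) * Algebra.trace L E (e * (z j * x)) := by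
      intro x
      rw [Fintype.sum_option, mul_add, add_mul, map_add, Finset.mul_sum, Finset.sum_mul, map_sum]
      simp only [optOne, Option.elim_none, Option.elim_some, mul_smul_comm, smul_mul_assoc,
        mul_one, map_smul, smul_eq_mul, mul_assoc]
    refine mem_ker_traces ?_ fun d => ?_
    · have := hexp 1
      simp only [mul_one, he1, hez] at this
      rw [this, mul_zero, zero_add, ← hv0]
    · rw [hexp, hez]
      simp only [hquad _ (z_mem_yzspan _) _ (z_mem_yzspan d)]
      have h1 : ∑ j, v (some j) * (algebraMap U L (ℓ (z j)) * ψ (z d) +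
          ψ (z j) * algebraMap U L (ℓ (z d)) -
          a * (algebraMap U L (ℓ (z j)) * algebraMap U L (ℓ (z d)))) =
          (∑ j, v (some j) * algebraMap U L (ℓ (z j))) * ψ (z d) +
          (∑ j, v (some j) * ψ (z j)) * algebraMap U L (ℓ (z d)) -
          a * (∑ j, v (some j) * algebraMap U L (ℓ (z j))) * algebraMap U L (ℓ (z d)) := by
        rw [Finset.sum_mul, Finset.sum_mul, Finset.mul_sum, Finset.sum_mul,
          ← Finset.sum_add_distrib, ← Finset.sum_sub_distrib]
        exact Finset.sum_congr rfl fun j _ => by ring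
      rw [h1, ← hv0]
      linear_combination -algebraMap U L (ℓ (z d)) * hv1
  have h1 := LinearMap.finrank_range_add_finrank_ker P
  have h2 := (LinearMap.range P).finrank_le
  rw [Module.finrank_fintype_fun_eq_card, Fintype.card_option, Fintype.card_fin] at h1
  rw [Module.finrank_fintype_fun_eq_card, Fintype.card_fin] at h2
  rw [finrank_T hq hdeg] at hker
  omega

end Cubics
end GenericProjection

namespace GenericProjection

theorem algebraicIndependent_of_card_eq {k E S T : Type*} [Field k] [Field E] [Algebra k E]
    [Fintype S] [Fintype T] {v : S → E} {u : T → E} (hu : AlgebraicIndependent k u)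
    (hcard : Fintype.card S = Fintype.card T)
    (halg : Algebra.IsAlgebraic (IntermediateField.adjoin k (Set.range v)) E) :
    AlgebraicIndependent k v := by
  have h1 : Algebra.IsAlgebraic (Algebra.adjoin k (Set.range v)) E :=
    IntermediateField.isAlgebraic_adjoin_iff_top.1 halg
  refine (Algebra.IsAlgebraic.isTranscendenceBasis_of_lift_le_trdeg_of_finite k v ?_).1
  have h2 := hu.lift_cardinalMk_le_trdeg
  rw [Cardinal.mk_fintype, Cardinal.lift_natCast] at h2 ⊢
  rw [hcard]
  simpa using h2

variable {k R E : Type*} [Field k] [CommRing R] [IsDomain R] [Algebra k R] [Field E] [Algebra k E]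
  [Algebra R E] [IsScalarTower k R E] {n c : ℕ} {X : Fin (n + 1) ⊕ Fin c → R}
  {w : Fin (n + 1) × Fin c → E}

theorem adjoin_forms_eq_top (hX : IsConeRing k X) (hw : IsGeneric R w) :
    IntermediateField.adjoin (coefField k w) (Set.range fun s => algebraMap R E (X s)) = ⊤ := by
  refine top_unique fun e _ => ?_
  have hR : ∀ r : R, algebraMap R E r ∈
      IntermediateField.adjoin (coefField k w) (Set.range fun s => algebraMap R E (X s)) := by
    intro r
    have hr : r ∈ Algebra.adjoin k (Set.range X) := hX.adjoin_eq_top ▸ Algebra.mem_top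
    refine Algebra.adjoin_induction ?_ ?_ ?_ ?_ hr
    · rintro _ ⟨s, rfl⟩
      exact IntermediateField.subset_adjoin _ _ ⟨s, rfl⟩
    · intro a
      rw [← IsScalarTower.algebraMap_apply k R E]
      exact IntermediateField.algebraMap_mem _ (algebraMap k (coefField k w) a)
    · intro a b _ _ ha hb; rw [map_add]; exact add_mem ha hb
    · intro a b _ _ ha hb; rw [map_mul]; exact mul_mem ha hb
  have hp : ∀ p : MvPolynomial (Fin (n + 1) × Fin c) R, aeval w p ∈
      IntermediateField.adjoin (coefField k w) (Set.range fun s => algebraMap R E (X s)) := by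
    intro p
    induction p using MvPolynomial.induction_on with
    | C a => rw [aeval_C]; exact hR a
    | add p q hp hq => rw [map_add]; exact add_mem hp hq
    | mul_X p i hp =>
      rw [map_mul, aeval_X]
      exact mul_mem hp (IntermediateField.algebraMap_mem _
        (⟨w i, w_mem_coefField k w i⟩ : coefField k w))
  obtain ⟨p, q, hq, h⟩ := hw.frac e
  have : e = aeval w p / aeval w q := by rw [eq_div_iff hq, mul_comm, h]
  rw [this]
  exact div_mem (hp p) (hp q)

variable (k X w) in
/-- The field generated by the projection. -/
abbrev projField : IntermediateField (coefField k w) E :=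
  IntermediateField.adjoin (coefField k w) (Set.range (proj X w))

theorem step' (hX : IsConeRing k X) (hw : IsGeneric R w) : ∃ a, ∀ m, a ≤ m →
    Submodule.span (coefField k w) (Set.range fun s => algebraMap R E (X s)) ^ (m + 1) ≤
    Submodule.span (coefField k w) (Set.range (proj X w)) *
      Submodule.span (coefField k w) (Set.range fun s => algebraMap R E (X s)) ^ m := by
  rw [← forms_eq]
  exact exists_step hX hw

theorem proj_mem_span (i) : proj X w i ∈
    Submodule.span (coefField k w) (Set.range fun s => algebraMap R E (X s)) := by
  rw [← forms_eq]; exact proj_mem_forms i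

theorem finite_projField (hX : IsConeRing k X) (hw : IsGeneric R w) :
    Module.Finite (projField k X w) E := by
  obtain ⟨a, ha⟩ := step' hX hw
  have h := span_pow_eq_top (K := coefField k w) (x := fun s => algebraMap R E (X s))
    (y := proj X w) proj_mem_span (proj_ne_zero hX hw 0) ha (adjoin_forms_eq_top hX hw)
  exact h.1

theorem algebraicIndependent_sumElim (hX : IsConeRing k X) (hw : IsGeneric R w) :
    AlgebraicIndependent k (Sum.elim (proj X w) w) := by
  obtain ⟨t, ht⟩ := hX.exists_basis
  have h1 := ht.1.sumElim_comp hw.indep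
  refine algebraicIndependent_of_card_eq h1 (by simp [add_comm]) ?_
  have hfin := finite_projField hX hw
  have halg : Algebra.IsAlgebraic (projField k X w) E := inferInstance
  have h2 := IntermediateField.adjoin_adjoin_left k (Set.range w) (Set.range (proj X w))
  rw [Set.Sum.elim_range, Set.union_comm, ← h2]
  exact halg

theorem algebraicIndependent_proj (hX : IsConeRing k X) (hw : IsGeneric R w) :
    AlgebraicIndependent (coefField k w) (proj X w) :=
  IntermediateField.algebraicIndependent_adjoin_iff.2
    (AlgebraicIndependent.sumElim_iff.1 (algebraicIndependent_sumElim hX hw)).2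

theorem finrank_projField (hX : IsConeRing k X) (hw : IsGeneric R w) :
    Module.finrank (projField k X w) E = c + 3 := by
  obtain ⟨a, ha⟩ := step' hX hw
  refine finrank_adjoin_eq (d := c + 3) ?_ proj_mem_span (algebraicIndependent_proj hX hw) ha
    (adjoin_forms_eq_top hX hw) ?_
  · rw [← forms_eq]
    exact indepPowers_bc hw.indep hX.graded
  · rw [← forms_eq]
    have hfin : Module.Finite k (Submodule.span k (Set.range X)) :=
      Module.Finite.span_of_finite k (Set.finite_range X)
    have : ∀ m, Module.finrank (coefField k w) (forms k X w ^ m : Submodule _ E) =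
        Module.finrank k (Submodule.span k (Set.range X) ^ m : Submodule k R) := by
      intro m
      rw [← bc_pow]
      exact finrank_bc hw.indep _
    simp only [this]
    exact hX.growth

end GenericProjection

namespace GenericProjection
open scoped TensorProduct

section Domain
variable {k R : Type*} [Field k] [CommRing R] [IsDomain R] [Algebra k R]

theorem exists_forall_productMap_ne_zero (a : R ⊗[k] R) (ha : a ≠ 0) : ∃ r : R, r ≠ 0 ∧
    ∀ ev : R →ₐ[k] k, ev r ≠ 0 →
      Algebra.TensorProduct.productMap ((Algebra.ofId k R).comp ev) (AlgHom.id k R) a ≠ 0 := by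
  let b := Module.Free.chooseBasis k R
  let B := Algebra.TensorProduct.basis R b
  have h0 : B.repr a ≠ 0 := fun h => ha (B.repr.map_eq_zero_iff.1 h)
  obtain ⟨i, hi⟩ := Finsupp.ne_iff.1 h0
  refine ⟨B.repr a i, hi, fun ev hev h => hev ?_⟩
  have h1 : Algebra.TensorProduct.productMap ((Algebra.ofId k R).comp ev) (AlgHom.id k R) a =
      (B.repr a).sum fun i r => ev r • b i := by
    conv_lhs => rw [← B.linearCombination_repr a, Finsupp.linearCombination_apply, Finsupp.sum,
      map_sum]
    refine Finset.sum_congr rfl fun i _ => ?_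
    rw [Algebra.TensorProduct.basis_apply, TensorProduct.smul_tmul', smul_eq_mul, mul_one,
      Algebra.TensorProduct.productMap_apply_tmul]
    simp [Algebra.ofId_apply, Algebra.smul_def]
  rw [h1] at h
  have h2 := congrArg (fun r => b.repr r i) h
  simp only [Finsupp.sum, map_sum, map_smul, Module.Basis.repr_self, Finsupp.coe_finset_sum,
    Finset.sum_apply, Finsupp.smul_single, Finsupp.single_apply, map_zero, Finsupp.coe_zero,
    Pi.zero_apply, Finset.sum_ite_eq'] at h2
  rw [if_pos (Finsupp.mem_support_iff.2 hi)] at h2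
  simpa using h2

theorem isDomain_tensorProduct (hsep : ∀ r : R, r ≠ 0 → ∃ ev : R →ₐ[k] k, ev r ≠ 0) :
    IsDomain (R ⊗[k] R) := by
  have : Nontrivial (R ⊗[k] R) :=
    (Algebra.TensorProduct.basis R (Module.Free.chooseBasis k R)).repr.toEquiv.nontrivial
  have : NoZeroDivisors (R ⊗[k] R) := by
    refine ⟨fun {a b} hab => ?_⟩
    by_contra! h
    obtain ⟨r, hr, h1⟩ := exists_forall_productMap_ne_zero a h.1
    obtain ⟨s, hs, h2⟩ := exists_forall_productMap_ne_zero b h.2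
    obtain ⟨ev, hev⟩ := hsep _ (mul_ne_zero hr hs)
    rw [map_mul] at hev
    refine mul_ne_zero (h1 ev (left_ne_zero_of_mul hev)) (h2 ev (right_ne_zero_of_mul hev)) ?_
    rw [← map_mul, hab, map_zero]
  exact NoZeroDivisors.to_isDomain _

end Domain

/-- An algebra homomorphism that is injective on a family over which everything is algebraic is
injective. -/
theorem injective_of_algebraicIndependent {k S Ω T : Type*} [Field k] [CommRing S] [IsDomain S]
    [Algebra k S] [Field Ω] [Algebra k Ω] (f : S →ₐ[k] Ω) (v : T → S)
    (hv : AlgebraicIndependent k fun i => f (v i))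
    (halg : Algebra.IsAlgebraic (Algebra.adjoin k (Set.range v)) S) : Function.Injective f := by
  rw [injective_iff_map_eq_zero]
  intro s hs
  by_contra h0
  refine Ideal.comap_ne_bot_of_algebraic_mem (R := Algebra.adjoin k (Set.range v))
    (I := RingHom.ker f) h0 hs (halg.isAlgebraic s) ?_
  rw [eq_bot_iff]
  rintro ⟨x, hx⟩ hxm
  rw [Algebra.adjoin_range_eq_range_aeval] at hx
  obtain ⟨p, rfl⟩ := hx
  have h1 : f (aeval v p) = 0 := hxm
  have h2 : aeval (fun i => f (v i)) p = 0 := by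
    rw [← h1, ← comp_aeval_apply]
  have h3 : p = 0 := hv (h2.trans (map_zero _).symm)
  subst h3
  exact Subtype.ext (map_zero _)

theorem isAlgebraic_map {k R S T : Type*} [Field k] [CommRing R] [Algebra k R] [CommRing S]
    [Algebra k S] {t : T → R} (ht : Algebra.IsAlgebraic (Algebra.adjoin k (Set.range t)) R)
    (f : R →ₐ[k] S) (hf : Function.Injective f) (B : Subalgebra k S) (hB : ∀ i, f (t i) ∈ B)
    (r : R) : IsAlgebraic B (f r) := by
  have hle : Algebra.adjoin k (Set.range t) ≤ B.comap f :=
    Algebra.adjoin_le (by rintro _ ⟨i, rfl⟩; exact hB i)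
  let g : Algebra.adjoin k (Set.range t) →ₐ[k] B :=
    (f.comp (Algebra.adjoin k (Set.range t)).val).codRestrict B fun x => hle x.2
  refine (ht.isAlgebraic r).ringHom_of_comp_eq (g : _ →+* B) (f : R →+* S) ?_ rfl
  intro x y hxy
  exact Subtype.ext (hf (congrArg Subtype.val hxy))

end GenericProjection

namespace GenericProjection
open scoped TensorProduct

theorem card_ne_column {n c : ℕ} (j : Fin c) :
    (n + 1) + Fintype.card {q : Fin (n + 1) × Fin c // q.2 ≠ j} = (n + 1) * c := by
  have h := Fintype.card_subtype_compl (fun q : Fin (n + 1) × Fin c => q.2 = j)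
  have h2 : Fintype.card {q : Fin (n + 1) × Fin c // q.2 = j} = n + 1 := by
    rw [Fintype.card_congr (β := Fin (n + 1)) ⟨fun q => q.1.1, fun i => ⟨(i, j), rfl⟩, ?_,
      fun i => rfl⟩]
    · simp
    · rintro ⟨⟨i, j'⟩, rfl⟩; rfl
  have h3 := Fintype.card_subtype_le (fun q : Fin (n + 1) × Fin c => q.2 = j)
  rw [h2] at h h3
  simp only [Fintype.card_prod, Fintype.card_fin] at h h3
  have : Fintype.card {q : Fin (n + 1) × Fin c // q.2 ≠ j} = (n + 1) * c - (n + 1) := by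
    convert h
  omega

variable {k R E Ω : Type*} [Field k] [CommRing R] [IsDomain R] [Algebra k R] [Field E]
  [Algebra k E] [Algebra R E] [IsScalarTower k R E] [Field Ω] [Algebra k Ω] [Algebra E Ω]
  [IsScalarTower k E Ω] {n c : ℕ} {X : Fin (n + 1) ⊕ Fin c → R} {w : Fin (n + 1) × Fin c → E}

variable (X w) in
/-- A nontrivial conjugate of the inclusion over the field of the projection. -/
structure IsConj (σ : E →ₐ[k] Ω) : Prop where
  map_w : ∀ q, σ (w q) = algebraMap E Ω (w q)
  map_proj : ∀ i, σ (proj X w i) = algebraMap E Ω (proj X w i)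
  ne : σ ≠ IsScalarTower.toAlgHom k E Ω

variable (R) in
/-- The homomorphism on `R ⊗ R` given by the inclusion and a conjugate. -/
def pair (σ : E →ₐ[k] Ω) : R ⊗[k] R →ₐ[k] Ω :=
  Algebra.TensorProduct.productMap
    ((IsScalarTower.toAlgHom k E Ω).comp (IsScalarTower.toAlgHom k R E))
    (σ.comp (IsScalarTower.toAlgHom k R E))

theorem pair_tmul (σ : E →ₐ[k] Ω) (r s : R) :
    pair R σ (r ⊗ₜ s) = algebraMap E Ω (algebraMap R E r) * σ (algebraMap R E s) :=
  Algebra.TensorProduct.productMap_apply_tmul _ _ _ _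

variable (k) in
/-- The difference of the two copies of an element. -/
def delta (r : R) : R ⊗[k] R := r ⊗ₜ 1 - 1 ⊗ₜ r

theorem pair_delta (σ : E →ₐ[k] Ω) (r : R) :
    pair R σ (delta k r) = algebraMap E Ω (algebraMap R E r) - σ (algebraMap R E r) := by
  simp [delta, pair_tmul]

theorem IsConj.linear {σ : E →ₐ[k] Ω} (h : IsConj X w σ) (i) :
    pair R σ (delta k (X (.inl i))) +
      ∑ j, algebraMap E Ω (w (i, j)) * pair R σ (delta k (X (.inr j))) = 0 := by
  have h1 := h.map_proj i
  simp only [proj, map_add, map_sum, map_mul, h.map_w] at h1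
  simp only [pair_delta, mul_sub, Finset.sum_sub_distrib]
  linear_combination h1.symm

theorem IsConj.exists_ne {σ : E →ₐ[k] Ω} (h : IsConj X w σ) (hX : IsConeRing k X)
    (hw : IsGeneric R w) : ∃ j, pair R σ (delta k (X (.inr j))) ≠ 0 := by
  by_contra! h0
  refine h.ne ?_
  have hx : ∀ s, σ (algebraMap R E (X s)) = algebraMap E Ω (algebraMap R E (X s)) := by
    rintro (i | j)
    · have := h.linear i
      simp only [h0, mul_zero, Finset.sum_const_zero, add_zero, pair_delta] at this
      exact (sub_eq_zero.1 this).symm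
    · have := h0 j
      rw [pair_delta] at this
      exact (sub_eq_zero.1 this).symm
  have hR : ∀ r : R, σ (algebraMap R E r) = algebraMap E Ω (algebraMap R E r) := by
    have : σ.comp (IsScalarTower.toAlgHom k R E) =
        (IsScalarTower.toAlgHom k E Ω).comp (IsScalarTower.toAlgHom k R E) := by
      refine AlgHom.ext_of_adjoin_eq_top hX.adjoin_eq_top ?_
      rintro _ ⟨s, rfl⟩
      exact hx s
    exact fun r => DFunLike.congr_fun this r
  have hp : ∀ p : MvPolynomial (Fin (n + 1) × Fin c) R,
      σ (aeval w p) = algebraMap E Ω (aeval w p) := by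
    intro p
    induction p using MvPolynomial.induction_on with
    | C a => simpa using hR a
    | add p q hp hq => simp only [map_add, hp, hq]
    | mul_X p i hp => simp only [map_mul, hp, aeval_X, h.map_w]
  ext e
  obtain ⟨p, q, hq, he⟩ := hw.frac e
  have h1 := congrArg σ he
  have h2 := congrArg (algebraMap E Ω) he
  rw [map_mul, hp, hp] at h1
  rw [map_mul] at h2
  have h3 : algebraMap E Ω (aeval w q) ≠ 0 := (map_ne_zero _).2 hq
  exact mul_left_cancel₀ h3 (h1.trans h2.symm)

/-- Two generic conjugate points together with all but one column of the coefficients are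
algebraically independent. -/
theorem IsConj.algebraicIndependent {σ : E →ₐ[k] Ω} (h : IsConj X w σ) (hX : IsConeRing k X)
    (hw : IsGeneric R w) (hΩ : Algebra.IsAlgebraic E Ω) {t : Fin (n + 1) → R}
    (ht : IsTranscendenceBasis k t) {j : Fin c} (hj : pair R σ (delta k (X (.inr j))) ≠ 0) :
    AlgebraicIndependent k (Sum.elim (Sum.elim
      (fun i => algebraMap E Ω (algebraMap R E (t i))) fun i => σ (algebraMap R E (t i)))
      fun q : {q : Fin (n + 1) × Fin c // q.2 ≠ j} => algebraMap E Ω (w q)) := by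
  classical
  set v := (Sum.elim (Sum.elim
      (fun i => algebraMap E Ω (algebraMap R E (t i))) fun i => σ (algebraMap R E (t i)))
      fun q : {q : Fin (n + 1) × Fin c // q.2 ≠ j} => algebraMap E Ω (w q)) with hv
  have hinj : Function.Injective (algebraMap R E) := hw.indep.algebraMap_injective
  have h1 : AlgebraicIndependent k (fun s => algebraMap E Ω
      (Sum.elim (w) (algebraMap R E ∘ t) s)) :=
    (ht.1.sumElim_comp hw.indep).map' (f := IsScalarTower.toAlgHom k E Ω)
      (algebraMap E Ω).injective
  refine algebraicIndependent_of_card_eq h1 ?_ ?_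
  · have := card_ne_column (n := n) j
    simp only [Fintype.card_sum, Fintype.card_fin, Fintype.card_prod]
    omega
  set F := IntermediateField.adjoin k (Set.range v) with hF
  have hvF : ∀ s, v s ∈ F := fun s => IntermediateField.subset_adjoin _ _ ⟨s, rfl⟩
  let B := algebraicClosure F Ω
  have hFB : ∀ x ∈ F, x ∈ B := fun x hx => B.algebraMap_mem ⟨x, hx⟩
  have hι : ∀ r : R, algebraMap E Ω (algebraMap R E r) ∈ B := fun r =>
    mem_algebraicClosure_iff.2 (isAlgebraic_map ht.isAlgebraic
      ((IsScalarTower.toAlgHom k E Ω).comp (IsScalarTower.toAlgHom k R E))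
      ((algebraMap E Ω).injective.comp hinj) F.toSubalgebra
      (fun i => hvF (.inl (.inl i))) r)
  have hσ : ∀ r : R, σ (algebraMap R E r) ∈ B := fun r =>
    mem_algebraicClosure_iff.2 (isAlgebraic_map ht.isAlgebraic
      (σ.comp (IsScalarTower.toAlgHom k R E))
      (σ.injective.comp hinj) F.toSubalgebra
      (fun i => hvF (.inl (.inr i))) r)
  have hΔ : ∀ r : R, pair R σ (delta k r) ∈ B := fun r => by
    rw [pair_delta]; exact sub_mem (hι r) (hσ r)
  have hwB : ∀ q, algebraMap E Ω (w q) ∈ B := by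
    rintro ⟨i, j'⟩
    by_cases hjj : j' = j
    · subst hjj
      have h2 := h.linear i
      rw [← Finset.add_sum_erase _ _ (Finset.mem_univ j')] at h2
      have h3 : algebraMap E Ω (w (i, j')) = -(pair R σ (delta k (X (.inl i))) +
          ∑ x ∈ Finset.univ.erase j', algebraMap E Ω (w (i, x)) *
            pair R σ (delta k (X (.inr x)))) / pair R σ (delta k (X (.inr j'))) := by
        rw [eq_div_iff hj]
        linear_combination h2
      rw [h3]
      refine div_mem (neg_mem (add_mem (hΔ _) (sum_mem fun x hx => mul_mem ?_ (hΔ _)))) (hΔ _)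
      exact hFB _ (hvF (.inr ⟨(i, x), Finset.ne_of_mem_erase hx⟩))
    · exact hFB _ (hvF (.inr ⟨(i, j'), hjj⟩))
  have hp : ∀ p : MvPolynomial (Fin (n + 1) × Fin c) R, algebraMap E Ω (aeval w p) ∈ B := by
    intro p
    induction p using MvPolynomial.induction_on with
    | C a => simpa using hι a
    | add p q hp hq => simpa only [map_add] using add_mem hp hq
    | mul_X p i hp => simpa only [map_mul, aeval_X] using mul_mem hp (hwB i)
  have hE : ∀ e, algebraMap E Ω e ∈ B := by
    intro e
    obtain ⟨p, q, hq, he⟩ := hw.frac e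
    have : e = aeval w p / aeval w q := by rw [eq_div_iff hq, mul_comm, he]
    rw [this, map_div₀]
    exact div_mem (hp p) (hp q)
  let g : E →+* B := (algebraMap E Ω).codRestrict B.toSubring hE
  refine ⟨fun x => ?_⟩
  have h4 : IsAlgebraic B x :=
    (hΩ.isAlgebraic x).ringHom_of_comp_eq g (RingHom.id Ω) g.injective rfl
  exact h4.restrictScalars F

end GenericProjection

namespace GenericProjection
open scoped TensorProduct

variable {k R E Ω : Type*} [Field k] [CommRing R] [IsDomain R] [Algebra k R] [Field E]
  [Algebra k E] [Algebra R E] [IsScalarTower k R E] [Field Ω] [Algebra k Ω] [Algebra E Ω]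
  [IsScalarTower k E Ω] {n c : ℕ} {X : Fin (n + 1) ⊕ Fin c → R} {w : Fin (n + 1) × Fin c → E}

variable (R) in
/-- Evaluation at a pair of conjugate points. -/
def evPair {V : Type*} (u : V → E) (σ : E →ₐ[k] Ω) : MvPolynomial V (R ⊗[k] R) →ₐ[k] Ω :=
  aevalTower (pair R σ) fun q => algebraMap E Ω (u q)

theorem evPair_C {V : Type*} (u : V → E) (σ : E →ₐ[k] Ω) (a : R ⊗[k] R) :
    evPair R u σ (C a) = pair R σ a := aevalTower_C _ _ _

theorem evPair_X {V : Type*} (u : V → E) (σ : E →ₐ[k] Ω) (q : V) :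
    evPair R u σ (MvPolynomial.X q) = algebraMap E Ω (u q) := aevalTower_X _ _ _

theorem IsConj.injective_evPair {σ : E →ₐ[k] Ω} (h : IsConj X w σ) (hX : IsConeRing k X)
    (hw : IsGeneric R w) (hΩ : Algebra.IsAlgebraic E Ω) {j : Fin c}
    (hj : pair R σ (delta k (X (.inr j))) ≠ 0) :
    Function.Injective
      (evPair R (fun q : {q : Fin (n + 1) × Fin c // q.2 ≠ j} => w q) σ) := by
  obtain ⟨t, ht⟩ := hX.exists_basis
  have hdom : IsDomain (R ⊗[k] R) := isDomain_tensorProduct hX.separated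
  let v : (Fin (n + 1) ⊕ Fin (n + 1)) ⊕ {q : Fin (n + 1) × Fin c // q.2 ≠ j} →
      MvPolynomial {q : Fin (n + 1) × Fin c // q.2 ≠ j} (R ⊗[k] R) :=
    Sum.elim (Sum.elim (fun i => C (t i ⊗ₜ 1)) fun i => C (1 ⊗ₜ t i)) MvPolynomial.X
  refine injective_of_algebraicIndependent _ v ?_ ?_
  · convert h.algebraicIndependent hX hw hΩ ht hj using 1
    funext s
    rcases s with (i | i) | q
    · simp [v, evPair_C, pair_tmul]
    · simp [v, evPair_C, pair_tmul]
    · simp [v, evPair_X]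
  set B := Algebra.adjoin k (Set.range v) with hB
  have hvB : ∀ s, v s ∈ B := fun s => Algebra.subset_adjoin ⟨s, rfl⟩
  let D := Subalgebra.algebraicClosure B
    (MvPolynomial {q : Fin (n + 1) × Fin c // q.2 ≠ j} (R ⊗[k] R))
  have hCinj : Function.Injective (C : R ⊗[k] R →
      MvPolynomial {q : Fin (n + 1) × Fin c // q.2 ≠ j} (R ⊗[k] R)) := C_injective _ _
  have hil : Function.Injective (Algebra.TensorProduct.includeLeft : R →ₐ[k] R ⊗[k] R) :=
    Algebra.TensorProduct.includeLeft_injective (S := k) (algebraMap k R).injective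
  have hir : Function.Injective (Algebra.TensorProduct.includeRight : R →ₐ[k] R ⊗[k] R) :=
    Algebra.TensorProduct.includeRight_injective (algebraMap k R).injective
  have hl : ∀ r : R, C (r ⊗ₜ[k] (1 : R)) ∈ D := fun r =>
    isAlgebraic_map ht.isAlgebraic
      ((IsScalarTower.toAlgHom k (R ⊗[k] R) (MvPolynomial
        {q : Fin (n + 1) × Fin c // q.2 ≠ j} (R ⊗[k] R))).comp
        (Algebra.TensorProduct.includeLeft : R →ₐ[k] R ⊗[k] R))
      (hCinj.comp hil) B (fun i => hvB (.inl (.inl i))) r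
  have hr : ∀ r : R, C ((1 : R) ⊗ₜ[k] r) ∈ D := fun r =>
    isAlgebraic_map ht.isAlgebraic
      ((IsScalarTower.toAlgHom k (R ⊗[k] R) (MvPolynomial
        {q : Fin (n + 1) × Fin c // q.2 ≠ j} (R ⊗[k] R))).comp
        (Algebra.TensorProduct.includeRight : R →ₐ[k] R ⊗[k] R))
      (hCinj.comp hir) B (fun i => hvB (.inl (.inr i))) r
  refine ⟨fun x => ?_⟩
  change x ∈ D
  induction x using MvPolynomial.induction_on with
  | C a =>
    induction a using TensorProduct.induction_on with
    | zero => rw [C_0]; exact zero_mem _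
    | tmul r s =>
      have : r ⊗ₜ[k] s = (r ⊗ₜ 1) * (1 ⊗ₜ s) := by simp
      rw [this, C_mul]
      exact mul_mem (hl r) (hr s)
    | add a b ha hb => rw [C_add]; exact add_mem ha hb
  | add p q hp hq => exact add_mem hp hq
  | mul_X p i hp => exact mul_mem hp (D.algebraMap_mem ⟨_, hvB (.inr i)⟩)

/-- The relations between a generic point and a nontrivial conjugate do not depend on the
conjugate. -/
theorem IsConj.evPair_eq_zero {σ τ : E →ₐ[k] Ω} (hσ : IsConj X w σ) (hτ : IsConj X w τ)
    (hX : IsConeRing k X) (hw : IsGeneric R w) (hΩ : Algebra.IsAlgebraic E Ω)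
    {P : MvPolynomial (Fin (n + 1) × Fin c) (R ⊗[k] R)} (hP : evPair R w σ P = 0) :
    evPair R w τ P = 0 := by
  have hdom : IsDomain (R ⊗[k] R) := isDomain_tensorProduct hX.separated
  obtain ⟨j, hj⟩ := hσ.exists_ne hX hw
  obtain ⟨j', hj'⟩ := hτ.exists_ne hX hw
  have hδ : delta k (X (.inr j)) ≠ 0 := fun h => hj (by rw [h, map_zero])
  have hjτ : pair R τ (delta k (X (.inr j))) ≠ 0 := by
    intro h
    refine hδ (C_injective {q : Fin (n + 1) × Fin c // q.2 ≠ j'} _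
      (hτ.injective_evPair hX hw hΩ hj' ?_))
    rw [evPair_C, h, C_0, map_zero]
  let S := MvPolynomial {q : Fin (n + 1) × Fin c // q.2 ≠ j} (R ⊗[k] R)
  let K := FractionRing S
  let d : R → K := fun r => algebraMap S K (C (delta k r))
  let u : Fin (n + 1) × Fin c → S := fun q =>
    if h : q.2 ≠ j then MvPolynomial.X ⟨q, h⟩ else 0
  let ψ : MvPolynomial (Fin (n + 1) × Fin c) (R ⊗[k] R) →+* K :=
    eval₂Hom ((algebraMap S K).comp C) fun q =>
      if q.2 ≠ j then algebraMap S K (u q) else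
        -(d (X (.inl q.1)) + ∑ x ∈ Finset.univ.erase j,
          algebraMap S K (u (q.1, x)) * d (X (.inr x))) / d (X (.inr j))
  have key : ∀ ρ : E →ₐ[k] Ω, IsConj X w ρ → pair R ρ (delta k (X (.inr j))) ≠ 0 →
      ∃ f : K →+* Ω, ∀ P, evPair R w ρ P = f (ψ P) := by
    intro ρ hρ hjρ
    have hi := hρ.injective_evPair hX hw hΩ hjρ
    let f : K →+* Ω := IsFractionRing.lift (g := (evPair R (fun q : {q : Fin (n + 1) × Fin c //
      q.2 ≠ j} => w q) ρ : S →+* Ω)) hi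
    have hf : ∀ s : S, f (algebraMap S K s) = evPair R (fun q : {q : Fin (n + 1) × Fin c //
      q.2 ≠ j} => w q) ρ s := fun s => IsFractionRing.lift_algebraMap hi s
    have hd : ∀ r, f (d r) = pair R ρ (delta k r) := fun r => (hf _).trans (evPair_C _ _ _)
    have hu : ∀ q, q.2 ≠ j → f (algebraMap S K (u q)) = algebraMap E Ω (w q) := by
      intro q hq
      rw [hf]
      simp only [u, dif_pos hq]
      rw [evPair_X]
    refine ⟨f, fun P => ?_⟩
    have : (evPair R w ρ : _ →+* Ω) = f.comp ψ := by
      refine MvPolynomial.ringHom_ext ?_ ?_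
      · intro a
        simp only [RingHom.coe_coe, evPair_C, RingHom.comp_apply, ψ, eval₂Hom_C]
        rw [hf, evPair_C]
      · rintro ⟨i, x⟩
        simp only [RingHom.coe_coe, evPair_X, RingHom.comp_apply, ψ, eval₂Hom_X']
        by_cases hx : x = j
        · subst hx
          rw [if_neg (by simp), map_div₀, map_neg, map_add, map_sum, hd, hd, eq_div_iff hjρ]
          have h2 := hρ.linear i
          rw [← Finset.add_sum_erase _ _ (Finset.mem_univ x)] at h2
          rw [Finset.sum_congr rfl fun y hy => by
            rw [map_mul, hd, hu _ (Finset.ne_of_mem_erase hy)]]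
          linear_combination h2
        · rw [if_pos hx, hu _ hx]
    exact DFunLike.congr_fun this P
  obtain ⟨f, hf⟩ := key σ hσ hj
  obtain ⟨g, hg⟩ := key τ hτ hjτ
  rw [hf] at hP
  rw [hg, f.injective (hP.trans (map_zero f).symm), map_zero]

/-- An element fixed by one nontrivial conjugation is fixed by all of them. -/
theorem IsConj.map_eq {σ τ : E →ₐ[k] Ω} (hσ : IsConj X w σ) (hτ : IsConj X w τ)
    (hX : IsConeRing k X) (hw : IsGeneric R w) (hΩ : Algebra.IsAlgebraic E Ω) {g : E}
    (hg : σ g = algebraMap E Ω g) : τ g = algebraMap E Ω g := by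
  obtain ⟨p, q, hq, he⟩ := hw.frac g
  let l : R →+* R ⊗[k] R := (Algebra.TensorProduct.includeLeft : R →ₐ[k] R ⊗[k] R)
  let r : R →+* R ⊗[k] R := (Algebra.TensorProduct.includeRight : R →ₐ[k] R ⊗[k] R)
  have hl : ∀ (ρ : E →ₐ[k] Ω) (f : MvPolynomial (Fin (n + 1) × Fin c) R),
      evPair R w ρ (map l f) = algebraMap E Ω (aeval w f) := by
    intro ρ f
    induction f using MvPolynomial.induction_on with
    | C a => simp [evPair_C, l, pair_tmul]
    | add p q hp hq => simp only [map_add, hp, hq]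
    | mul_X p i hp => simp only [map_mul, hp, aeval_X, map_X, evPair_X]
  have hr : ∀ ρ : E →ₐ[k] Ω, IsConj X w ρ → ∀ f : MvPolynomial (Fin (n + 1) × Fin c) R,
      evPair R w ρ (map r f) = ρ (aeval w f) := by
    intro ρ hρ f
    induction f using MvPolynomial.induction_on with
    | C a => simp [evPair_C, r, pair_tmul]
    | add p q hp hq => simp only [map_add, hp, hq]
    | mul_X p i hp => simp only [map_mul, hp, aeval_X, map_X, evPair_X, hρ.map_w]
  have key : ∀ ρ : E →ₐ[k] Ω, IsConj X w ρ → (ρ g = algebraMap E Ω g ↔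
      evPair R w ρ (map r p * map l q - map l p * map r q) = 0) := by
    intro ρ hρ
    have hq1 : algebraMap E Ω (aeval w q) ≠ 0 := (map_ne_zero _).2 hq
    have hq2 : ρ (aeval w q) ≠ 0 := (map_ne_zero _).2 hq
    rw [map_sub, map_mul, map_mul, hl, hl, hr ρ hρ, hr ρ hρ, ← he, map_mul, map_mul]
    have : ρ (aeval w q) * ρ g * algebraMap E Ω (aeval w q) -
        algebraMap E Ω (aeval w q) * algebraMap E Ω g * ρ (aeval w q) =
        (ρ (aeval w q) * algebraMap E Ω (aeval w q)) * (ρ g - algebraMap E Ω g) := by ring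
    rw [this, mul_eq_zero, sub_eq_zero]
    exact ⟨fun h => Or.inr h, fun h => h.resolve_left (mul_ne_zero hq2 hq1)⟩
  exact (key τ hτ).2 (hσ.evPair_eq_zero hτ hX hw hΩ ((key σ hσ).1 hg))

end GenericProjection

namespace GenericProjection

/-- If all nontrivial conjugates behave alike, there are no proper intermediate fields. -/
theorem adjoin_eq_top_of_conjugates {L E Ω : Type*} [Field L] [Field E] [Algebra L E]
    [FiniteDimensional L E] [CharZero L] [Field Ω] [IsAlgClosed Ω] [Algebra L Ω] [Algebra E Ω]
    [IsScalarTower L E Ω]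
    (h : ∀ (σ τ : E →ₐ[L] Ω) (g : E), σ ≠ IsScalarTower.toAlgHom L E Ω →
      τ ≠ IsScalarTower.toAlgHom L E Ω → σ g = algebraMap E Ω g → τ g = algebraMap E Ω g)
    {g : E} (hg : g ∉ (⊥ : IntermediateField L E)) :
    IntermediateField.adjoin L {g} = ⊤ := by
  set M := IntermediateField.adjoin L {g} with hM
  have hgM : g ∈ M := IntermediateField.mem_adjoin_simple_self L g
  by_contra hne
  have h1 : Module.finrank M E ≠ 1 := fun h1 => hne (IntermediateField.finrank_eq_one_iff_eq_top.1 h1)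
  have hpos : 0 < Module.finrank M E := Module.finrank_pos
  have hcard := AlgHom.card M E Ω
  obtain ⟨σ, hσ⟩ : ∃ σ : E →ₐ[M] Ω, σ ≠ IsScalarTower.toAlgHom M E Ω :=
    Fintype.exists_ne_of_one_lt_card (by rw [hcard]; omega) _
  have hσg : σ.restrictScalars L g = algebraMap E Ω g := by
    have h2 := σ.commutes (⟨g, hgM⟩ : M)
    exact h2
  have hσ' : σ.restrictScalars L ≠ IsScalarTower.toAlgHom L E Ω := by
    intro h2
    refine hσ (AlgHom.ext fun e => ?_)
    exact DFunLike.congr_fun h2 e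
  have hall : ∀ τ : E →ₐ[L] Ω, τ g = algebraMap E Ω g := by
    intro τ
    by_cases hτ : τ = IsScalarTower.toAlgHom L E Ω
    · rw [hτ]; rfl
    · exact h _ τ g hσ' hτ hσg
  have hle : Module.finrank L M ≤ 1 := by
    rw [← AlgHom.card L M Ω]
    refine Fintype.card_le_one_iff.2 fun a b => ?_
    obtain ⟨a', ha'⟩ := IsAlgClosed.surjective_domRestrict_of_isAlgebraic (E := E) (K := L)
      (M := Ω) (L := M) a
    obtain ⟨b', hb'⟩ := IsAlgClosed.surjective_domRestrict_of_isAlgebraic (E := E) (K := L)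
      (M := Ω) (L := M) b
    refine IntermediateField.algHom_ext_of_eq_adjoin L hM ?_
    rintro x hx
    obtain rfl : x = g := hx
    rw [← ha', ← hb']
    exact (hall a').trans (hall b').symm
  refine hg ?_
  have : M = ⊥ := IntermediateField.finrank_eq_one_iff.1 (by
    have := Module.finrank_pos (R := L) (M := M); omega)
  exact this ▸ hgM

theorem mem_bot_of_mul_mem_of_adjoin {L E : Type*} [Field L] [Field E] [Algebra L E]
    {g : E} (hg : IntermediateField.adjoin L {g} = ⊤) (hfin : FiniteDimensional L E)
    {Q : Submodule L E} (h1 : 1 ∈ Q) (hQ : ∀ q ∈ Q, g * q ∈ Q) : Q = ⊤ := by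
  have hintegral : IsIntegral L g := Algebra.IsIntegral.isIntegral g
  have h2 := IntermediateField.adjoin_simple_toSubalgebra_of_isAlgebraic hintegral.isAlgebraic
  rw [hg, IntermediateField.top_toSubalgebra] at h2
  refine top_unique fun e _ => ?_
  have h3 : e ∈ Algebra.adjoin L {g} := h2 ▸ Algebra.mem_top
  have h4 : ∀ q ∈ Q, e * q ∈ Q := by
    refine Algebra.adjoin_induction ?_ ?_ ?_ ?_ h3
    · rintro x hx
      obtain rfl : x = g := hx
      exact hQ
    · intro a q hq
      rw [← Algebra.smul_def]
      exact Q.smul_mem a hq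
    · intro a b _ _ ha hb q hq
      rw [add_mul]; exact add_mem (ha q hq) (hb q hq)
    · intro a b _ _ ha hb q hq
      rw [mul_assoc]; exact ha _ (hb q hq)
  simpa using h4 1 h1

variable {k R E : Type*} [Field k] [CharZero k] [CommRing R] [IsDomain R] [Algebra k R] [Field E]
  [Algebra k E] [Algebra R E] [IsScalarTower k R E] {n c : ℕ} {X : Fin (n + 1) ⊕ Fin c → R}
  {w : Fin (n + 1) × Fin c → E}

theorem adjoin_eq_top_of_notMem (hX : IsConeRing k X) (hw : IsGeneric R w) {g : E}
    (hg : g ∉ (⊥ : IntermediateField (projField k X w) E)) :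
    IntermediateField.adjoin (projField k X w) {g} = ⊤ := by
  have hfin := finite_projField hX hw
  have hchar : CharZero (projField k X w) :=
    charZero_of_injective_algebraMap (algebraMap k (projField k X w)).injective
  have htower : IsScalarTower k (projField k X w) E :=
    IsScalarTower.of_algebraMap_eq fun x => rfl
  have htower' : IsScalarTower k (projField k X w) (AlgebraicClosure E) :=
    IsScalarTower.of_algebraMap_eq fun x => by
      rw [IsScalarTower.algebraMap_apply k E (AlgebraicClosure E)]; rfl
  have hkey : ∀ σ : E →ₐ[projField k X w] AlgebraicClosure E,
      σ ≠ IsScalarTower.toAlgHom (projField k X w) E (AlgebraicClosure E) →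
      IsConj X w (σ.restrictScalars k) := by
    intro σ hσ
    refine ⟨fun q => ?_, fun i => ?_, fun h => hσ ?_⟩
    · exact σ.commutes (algebraMap (coefField k w) (projField k X w) ⟨w q, w_mem_coefField k w q⟩)
    · exact σ.commutes ⟨proj X w i, IntermediateField.subset_adjoin _ _ ⟨i, rfl⟩⟩
    · exact AlgHom.ext fun e => DFunLike.congr_fun h e
  refine adjoin_eq_top_of_conjugates (Ω := AlgebraicClosure E) ?_ hg
  intro σ τ g hσ hτ h
  exact (hkey σ hσ).map_eq (hkey τ hτ) hX hw inferInstance h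

theorem mem_projField_of_mul_mem (hX : IsConeRing k X) (hw : IsGeneric R w) {g : E}
    {Q : Submodule (projField k X w) E} (h1 : 1 ∈ Q) (hQ : ∀ q ∈ Q, g * q ∈ Q)
    (hrank : Module.finrank (projField k X w) Q ≤ c + 2) : g ∈ projField k X w := by
  have hfin := finite_projField hX hw
  by_contra hg
  have h2 := adjoin_eq_top_of_notMem hX hw (g := g) (fun h => hg (by
    obtain ⟨x, rfl⟩ := IntermediateField.mem_bot.1 h
    exact x.2))
  have h3 := mem_bot_of_mul_mem_of_adjoin h2 hfin h1 hQ
  rw [h3, finrank_top, finrank_projField hX hw] at hrank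
  omega

end GenericProjection

namespace GenericProjection

/-- A polynomial has degree at most `D` in the second block of variables. -/
def DegLE {k σ τ : Type*} [CommRing k] : ℕ → MvPolynomial (σ ⊕ τ) k → Prop
  | 0, a => ∀ p, pderiv (.inr p) a = 0
  | D + 1, a => ∀ p, DegLE D (pderiv (.inr p) a)

section degLE
variable {k σ τ : Type*} [CommRing k]

theorem DegLE.zero : ∀ D : ℕ, DegLE D (0 : MvPolynomial (σ ⊕ τ) k)
  | 0 => fun p => map_zero _
  | D + 1 => fun p => by rw [map_zero]; exact DegLE.zero D

theorem DegLE.add : ∀ {D : ℕ} {a b : MvPolynomial (σ ⊕ τ) k}, DegLE D a → DegLE D b →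
    DegLE D (a + b)
  | 0, a, b, ha, hb => fun p => by rw [map_add, ha, hb, add_zero]
  | D + 1, a, b, ha, hb => fun p => by rw [map_add]; exact (ha p).add (hb p)

theorem pderiv_rename_inl (s : MvPolynomial σ k) (p : τ) :
    pderiv (Sum.inr p) (rename (Sum.inl : σ → σ ⊕ τ) s) = 0 := by
  classical
  refine pderiv_eq_zero_of_notMem_vars fun h => ?_
  have := vars_rename _ _ h
  simp at this

theorem pderiv_rename_mul (s : MvPolynomial σ k) (a : MvPolynomial (σ ⊕ τ) k) (p : τ) :
    pderiv (Sum.inr p) (rename Sum.inl s * a) = rename Sum.inl s * pderiv (Sum.inr p) a := by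
  rw [pderiv_mul, pderiv_rename_inl, zero_mul, zero_add]

theorem DegLE.rename_mul (s : MvPolynomial σ k) : ∀ {D : ℕ} {a : MvPolynomial (σ ⊕ τ) k},
    DegLE D a → DegLE D (rename Sum.inl s * a)
  | 0, a, ha => fun p => by rw [pderiv_rename_mul, ha, mul_zero]
  | D + 1, a, ha => fun p => by rw [pderiv_rename_mul]; exact (ha p).rename_mul s

theorem degLE_monomial : ∀ (D : ℕ) (m : σ ⊕ τ →₀ ℕ) (r : k), m.degree ≤ D →
    DegLE D (monomial m r)
  | 0, m, r, h => fun p => by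
    have : m = 0 := (Finsupp.degree_eq_zero_iff m).1 (Nat.le_zero.1 h)
    subst this
    exact pderiv_C
  | D + 1, m, r, h => fun p => by
    rw [pderiv_monomial]
    by_cases hm : m (.inr p) = 0
    · rw [hm, Nat.cast_zero, mul_zero, monomial_zero]
      exact DegLE.zero D
    · refine degLE_monomial D _ _ ?_
      have h1 : Finsupp.single (Sum.inr p) 1 ≤ m :=
        Finsupp.single_le_iff.2 (Nat.one_le_iff_ne_zero.2 hm)
      have h2 := congrArg Finsupp.degree (tsub_add_cancel_of_le h1)
      rw [map_add, Finsupp.degree_single] at h2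
      omega

theorem degLE_totalDegree {D : ℕ} (a : MvPolynomial (σ ⊕ τ) k) (h : a.totalDegree ≤ D) :
    DegLE D a := by
  have key : ∀ s : Finset (σ ⊕ τ →₀ ℕ), (∀ m ∈ s, m ∈ a.support) →
      DegLE D (∑ m ∈ s, monomial m (coeff m a)) := by
    intro s
    classical
    induction s using Finset.induction_on with
    | empty => intro _; rw [Finset.sum_empty]; exact DegLE.zero D
    | insert m s hm ih =>
      intro hs
      rw [Finset.sum_insert hm]
      refine (degLE_monomial D m _ ?_).add (ih fun m' h' => hs _ (Finset.mem_insert_of_mem h'))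
      exact (le_totalDegree (hs m (Finset.mem_insert_self _ _))).trans h
  rw [a.as_sum]
  exact key a.support fun _ h => h

theorem exists_rename_of_degLE_zero {k : Type*} [Field k] [CharZero k]
    {a : MvPolynomial (σ ⊕ τ) k} (ha : DegLE 0 a) : ∃ s, a = rename Sum.inl s := by
  classical
  obtain ⟨s, hs⟩ := exists_rename_eq_of_vars_subset_range a (Sum.inl : σ → σ ⊕ τ)
    Sum.inl_injective (by
    rintro (q | p) hx
    · exact ⟨q, rfl⟩
    · exfalso
      obtain ⟨m, hm, hp⟩ := (mem_vars _).1 (Finset.mem_coe.1 hx)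
      have h2 := congrArg (coeff (m - Finsupp.single (Sum.inr p) 1)) (ha p)
      rw [coeff_pderiv, coeff_zero] at h2
      have h3 : Finsupp.single (Sum.inr p) 1 ≤ m :=
        Finsupp.single_le_iff.2 (Nat.one_le_iff_ne_zero.2 (Finsupp.mem_support_iff.1 hp))
      rw [tsub_add_cancel_of_le h3, mul_eq_zero] at h2
      rcases h2 with h2 | h2
      · exact mem_support_iff.1 hm h2
      · exact Nat.cast_add_one_ne_zero _ h2)
  exact ⟨s, hs.symm⟩

end degLE

theorem pderiv_aeval {k A σ V : Type*} [CommRing k] [CommRing A] [Algebra k A] [Fintype σ]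
    (u : σ → MvPolynomial V A) (F : MvPolynomial σ k) (q : V) :
    pderiv q (aeval u F) = ∑ s, aeval u (pderiv s F) * pderiv q (u s) := by
  classical
  induction F using MvPolynomial.induction_on with
  | C a =>
    simp [IsScalarTower.algebraMap_apply k A (MvPolynomial V A), MvPolynomial.algebraMap_eq]
  | add f g hf hg => simp only [map_add, hf, hg, add_mul, Finset.sum_add_distrib]
  | mul_X f i hf =>
    have h1 : ∑ s, aeval u f * aeval u (pderiv s (X i : MvPolynomial σ k)) * pderiv q (u s) =
        aeval u f * pderiv q (u i) := by
      rw [Finset.sum_eq_single i]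
      · rw [pderiv_X_self, map_one, mul_one]
      · intro s _ hs
        rw [pderiv_X_of_ne hs.symm, map_zero, mul_zero, zero_mul]
      · intro h
        exact absurd (Finset.mem_univ i) h
    rw [map_mul, pderiv_mul, hf, aeval_X, ← h1, Finset.sum_mul, ← Finset.sum_add_distrib]
    refine Finset.sum_congr rfl fun s _ => ?_
    rw [pderiv_mul, map_add, map_mul, map_mul, aeval_X]
    generalize aeval u (pderiv s f) = a1
    generalize aeval u (pderiv s (X i : MvPolynomial σ k)) = a2
    generalize aeval u f = a3
    ring

section integrality
variable {U E J : Type*} [Field U] [Field E] [Algebra U E] {n a : ℕ} {x : J → E}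
  {y : Fin (n + 1) → E}

theorem isIntegral_of_step [Finite J] (hy : ∀ i, y i ∈ Submodule.span U (Set.range x))
    (hy0 : y 0 ≠ 0) (hstep : ∀ m, a ≤ m → Submodule.span U (Set.range x) ^ (m + 1) ≤
      Submodule.span U (Set.range y) * Submodule.span U (Set.range x) ^ m) (j : J) :
    IsIntegral (Algebra.adjoin U (Set.range y)) (x j) := by
  set G := Submodule.span U (Set.range x) with hG
  refine isIntegral_of_smul_mem_submodule (M := E)
    (Submodule.span (Algebra.adjoin U (Set.range y)) ((G ^ a : Submodule U E) : Set E)) ?_ ?_ _ ?_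
  · intro h
    have h1 : y 0 ^ a ∈ Submodule.span (Algebra.adjoin U (Set.range y))
        ((G ^ a : Submodule U E) : Set E) :=
      Submodule.subset_span (Submodule.pow_mem_pow _ (hy 0) a)
    rw [h, Submodule.mem_bot] at h1
    exact pow_ne_zero _ hy0 h1
  · have h1 : (G ^ a).FG := (Submodule.fg_span (Set.finite_range x)).pow a
    obtain ⟨s, hs⟩ := h1
    refine ⟨s, ?_⟩
    rw [← hs]
    exact (Submodule.span_span_of_tower U _ _).symm
  · intro v hv
    refine Submodule.span_induction ?_ ?_ ?_ ?_ hv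
    · intro v hv
      have h1 : x j * v ∈ G ^ (a + 1) := by
        rw [pow_succ']
        exact Submodule.mul_mem_mul (Submodule.subset_span ⟨j, rfl⟩) hv
      have h2 : Submodule.span U (Set.range y) * G ^ a ≤ (Submodule.span (Algebra.adjoin U
          (Set.range y)) ((G ^ a : Submodule U E) : Set E)).restrictScalars U := by
        refine Submodule.mul_le.2 fun u hu v hv => ?_
        have hu' : u ∈ Algebra.adjoin U (Set.range y) := Algebra.span_le_adjoin _ _ hu
        exact Submodule.smul_mem _ (⟨u, hu'⟩ : Algebra.adjoin U (Set.range y))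
          (Submodule.subset_span hv)
      exact h2 (hstep a le_rfl h1)
    · rw [smul_zero]; exact zero_mem _
    · intro u v _ _ hu hv; rw [smul_add]; exact add_mem hu hv
    · intro r v _ hv
      rw [smul_comm]; exact Submodule.smul_mem _ r hv

open scoped IntermediateField.algebraAdjoinAdjoin in
theorem mem_adjoin_of_isIntegral (hy : AlgebraicIndependent U y) {g : E}
    (hg : g ∈ IntermediateField.adjoin U (Set.range y))
    (hintegral : IsIntegral (Algebra.adjoin U (Set.range y)) g) :
    g ∈ Algebra.adjoin U (Set.range y) := by
  have h1 : IsIntegrallyClosed (Algebra.adjoin U (Set.range y)) :=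
    IsIntegrallyClosed.of_equiv hy.aevalEquiv.toRingEquiv
  have h2 : IsIntegral (Algebra.adjoin U (Set.range y))
      (⟨g, hg⟩ : IntermediateField.adjoin U (Set.range y)) :=
    (isIntegral_algebraMap_iff (algebraMap (IntermediateField.adjoin U (Set.range y)) E).injective).1
      hintegral
  obtain ⟨r, hr⟩ := IsIntegrallyClosed.isIntegral_iff.1 h2
  have h3 : (r : E) = g := congrArg Subtype.val hr
  exact h3 ▸ r.2

end integrality

end GenericProjection

namespace GenericProjection

variable {k R E : Type*} [Field k] [CharZero k] [CommRing R] [IsDomain R] [Algebra k R] [Field E]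
  [Algebra k E] [Algebra R E] [IsScalarTower k R E] {n c : ℕ} {X : Fin (n + 1) ⊕ Fin c → R}
  {w : Fin (n + 1) × Fin c → E}

theorem exists_clear_coefficients {g : E}
    (hg : g ∈ Algebra.adjoin (coefField k w) (Set.range (proj X w))) :
    ∃ (s : MvPolynomial (Fin (n + 1) × Fin c) k)
      (b : MvPolynomial ((Fin (n + 1) × Fin c) ⊕ Fin (n + 1)) k),
      aeval w s ≠ 0 ∧ aeval w s * g = aeval (Sum.elim w (proj X w)) b := by
  have hs : ∀ s : MvPolynomial (Fin (n + 1) × Fin c) k,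
      aeval (Sum.elim w (proj X w)) (rename Sum.inl s) = aeval w s := by
    intro s; rw [aeval_rename]; rfl
  refine Algebra.adjoin_induction ?_ ?_ ?_ ?_ hg
  · rintro _ ⟨i, rfl⟩
    exact ⟨1, MvPolynomial.X (.inr i), by simp, by simp⟩
  · intro u
    obtain ⟨q, p, hq, h⟩ := exists_common_denominator (K := k) (S := Unit) w (fun _ => u)
    refine ⟨q, rename Sum.inl (p ()), hq, ?_⟩
    rw [hs, ← h ()]
    rfl
  · rintro x y _ _ ⟨s, b, hs0, h⟩ ⟨t, d, ht0, h'⟩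
    refine ⟨s * t, rename Sum.inl t * b + rename Sum.inl s * d, ?_, ?_⟩
    · rw [map_mul]; exact mul_ne_zero hs0 ht0
    · rw [map_mul, map_add, map_mul, map_mul, hs, hs, ← h, ← h']; ring
  · rintro x y _ _ ⟨s, b, hs0, h⟩ ⟨t, d, ht0, h'⟩
    refine ⟨s * t, b * d, ?_, ?_⟩
    · rw [map_mul]; exact mul_ne_zero hs0 ht0
    · rw [map_mul, map_mul, ← h, ← h']; ring

theorem eq_zero_of_relation_constant (hX : IsConeRing k X) (hw : IsGeneric R w)
    (α : Fin c → coefField k w) {g : E}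
    (hg : g ∈ Algebra.adjoin (coefField k w) (Set.range (proj X w)))
    (h : ∑ j, α j • algebraMap R E (X (.inr j)) = g) (j) : α j = 0 := by
  have hind : IndepPowers (forms k X w) := indepPowers_bc hw.indep hX.graded
  rw [Algebra.adjoin_range_eq_range_aeval] at hg
  obtain ⟨F, rfl⟩ := hg
  have hmem : ∑ j, α j • algebraMap R E (X (.inr j)) ∈ forms k X w ^ 1 := by
    rw [pow_one]
    exact Submodule.sum_mem _ fun j _ => Submodule.smul_mem _ _ (algebraMap_mem_forms _)
  set N := max 2 (F.totalDegree + 1)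
  have h1 := hind.eq (N := N)
    (f := fun m => if m = 1 then ∑ j, α j • algebraMap R E (X (.inr j)) else 0)
    (g := fun m => aeval (proj X w) (homogeneousComponent m F)) (m := 1) ?_ ?_ ?_ (by omega)
  · rw [if_pos rfl] at h1
    have h2 : aeval (proj X w) (homogeneousComponent 1 F) ∈ projSpan k X w := by
      have := (mem_span_pow_iff (proj X w) 1 _).2
        ⟨homogeneousComponent 1 F, homogeneousComponent_isHomogeneous 1 F, rfl⟩
      rwa [pow_one] at this
    obtain ⟨β, hβ⟩ := (Submodule.mem_span_range_iff_exists_fun (coefField k w)).1 h2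
    have hli := linearIndependent_algebraMap hX hw
    rw [Fintype.linearIndependent_iff] at hli
    have h3 := hli (Sum.elim β fun j => (∑ i, β i * ⟨w (i, j), w_mem_coefField k w _⟩) - α j) ?_
    · have hβ0 : ∀ i, β i = 0 := fun i => h3 (.inl i)
      have := h3 (.inr j)
      simpa [hβ0] using this
    · rw [Fintype.sum_sum_type]
      simp only [Sum.elim_inl, Sum.elim_inr, sub_smul, Finset.sum_sub_distrib]
      rw [h1, ← hβ]
      have h4 : ∀ i, β i • proj X w i = β i • algebraMap R E (X (.inl i)) +
          ∑ j, (β i * (⟨w (i, j), w_mem_coefField k w _⟩ : coefField k w)) •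
            algebraMap R E (X (.inr j)) := by
        intro i
        simp only [proj, smul_add, Finset.smul_sum, mul_smul]
        rfl
      simp only [h4, Finset.sum_add_distrib, Finset.sum_smul]
      rw [Finset.sum_comm]
      abel
  · intro m
    beta_reduce
    split_ifs with hm
    · subst hm; exact hmem
    · exact zero_mem _
  · intro m
    exact aeval_mem_pow proj_mem_forms (homogeneousComponent_isHomogeneous m F)
  · rw [← map_sum, sum_range_homogeneousComponent F (by omega : F.totalDegree < N),
      Finset.sum_ite_eq', if_pos (Finset.mem_range.2 (by omega)), h]
    rfl

end GenericProjection

namespace GenericProjection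

variable {k R E : Type*} [Field k] [CommRing R] [Algebra k R] [Field E]
  [Algebra k E] [Algebra R E] [IsScalarTower k R E] {n c : ℕ} {X : Fin (n + 1) ⊕ Fin c → R}
  {w : Fin (n + 1) × Fin c → E}

theorem relation_pderiv (hw : IsGeneric R w)
    {a : Fin c → MvPolynomial ((Fin (n + 1) × Fin c) ⊕ Fin (n + 1)) k}
    {b : MvPolynomial ((Fin (n + 1) × Fin c) ⊕ Fin (n + 1)) k}
    (h : ∑ j, aeval (Sum.elim w (proj X w)) (a j) * algebraMap R E (X (.inr j)) =
      aeval (Sum.elim w (proj X w)) b) (q : Fin (n + 1) × Fin c) :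
    ∑ j, (aeval (Sum.elim w (proj X w)) (pderiv (.inl q) (a j)) +
        aeval (Sum.elim w (proj X w)) (pderiv (.inr q.1) (a j)) * algebraMap R E (X (.inr q.2))) *
          algebraMap R E (X (.inr j)) =
      aeval (Sum.elim w (proj X w)) (pderiv (.inl q) b) +
        aeval (Sum.elim w (proj X w)) (pderiv (.inr q.1) b) * algebraMap R E (X (.inr q.2)) := by
  classical
  let u : (Fin (n + 1) × Fin c) ⊕ Fin (n + 1) → MvPolynomial (Fin (n + 1) × Fin c) R :=
    Sum.elim MvPolynomial.X fun i => C (X (.inl i)) + ∑ j, MvPolynomial.X (i, j) * C (X (.inr j))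
  have hu : ∀ F : MvPolynomial ((Fin (n + 1) × Fin c) ⊕ Fin (n + 1)) k,
      aeval w (aeval u F) = aeval (Sum.elim w (proj X w)) F := by
    intro F
    have h1 : ((aeval w : MvPolynomial (Fin (n + 1) × Fin c) R →ₐ[R] E).restrictScalars k).comp
        (aeval u) = aeval (Sum.elim w (proj X w)) := by
      refine MvPolynomial.algHom_ext fun s => ?_
      rcases s with s | i
      · simp [u]
      · simp [u, proj]
    exact congrArg (fun f => f F) h1
  have hC : ∀ r : R, aeval w (C r : MvPolynomial (Fin (n + 1) × Fin c) R) = algebraMap R E r :=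
    fun r => by simp
  have hd : ∀ F : MvPolynomial ((Fin (n + 1) × Fin c) ⊕ Fin (n + 1)) k,
      pderiv q (aeval u F) = aeval u (pderiv (.inl q) F) +
        aeval u (pderiv (.inr q.1) F) * C (X (.inr q.2)) := by
    intro F
    have h1 : ∀ s, pderiv q (u (.inl s)) = if s = q then 1 else 0 := by
      intro s
      split_ifs with hs
      · subst hs; exact pderiv_X_self _
      · exact pderiv_X_of_ne (fun h => hs h)
    have h2 : ∀ i, pderiv q (u (.inr i)) = if i = q.1 then C (X (.inr q.2)) else 0 := by
      intro i
      simp only [u, Sum.elim_inr, map_add, pderiv_C, zero_add, map_sum, pderiv_mul, mul_zero,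
        add_zero]
      split_ifs with hi
      · rw [Finset.sum_eq_single q.2]
        · subst hi; rw [pderiv_X_self, one_mul]
        · intro j _ hj
          rw [pderiv_X_of_ne (fun h => hj (congrArg Prod.snd h)), zero_mul]
        · intro h; exact absurd (Finset.mem_univ _) h
      · refine Finset.sum_eq_zero fun j _ => ?_
        rw [pderiv_X_of_ne (fun h => hi (congrArg Prod.fst h)), zero_mul]
    rw [pderiv_aeval, Fintype.sum_sum_type]
    simp only [h1, h2, mul_ite, mul_one, mul_zero, Finset.sum_ite_eq', Finset.mem_univ, if_true]
  have h3 : ∑ j, aeval u (a j) * C (X (.inr j)) = aeval u b := by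
    refine hw.indep ?_
    rw [hu, ← h, map_sum]
    exact Finset.sum_congr rfl fun j _ => by rw [map_mul, hu, hC]
  have h4 := congrArg (fun F => aeval w (pderiv q F)) h3
  simp only [map_sum, pderiv_mul, pderiv_C, mul_zero, add_zero, hd, map_add, map_mul, hu, hC] at h4
  exact h4

variable [IsDomain R] [CharZero k]

theorem aeval_mem_projField (F : MvPolynomial ((Fin (n + 1) × Fin c) ⊕ Fin (n + 1)) k) :
    aeval (Sum.elim w (proj X w)) F ∈
      Algebra.adjoin (coefField k w) (Set.range (proj X w)) := by
  induction F using MvPolynomial.induction_on with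
  | C r =>
    rw [aeval_C, IsScalarTower.algebraMap_apply k (coefField k w) E]
    exact Subalgebra.algebraMap_mem _ _
  | add f g hf hg => rw [map_add]; exact add_mem hf hg
  | mul_X f s hf =>
    rw [map_mul, aeval_X]
    refine mul_mem hf ?_
    rcases s with s | i
    · exact Subalgebra.algebraMap_mem _ (⟨w s, w_mem_coefField k w s⟩ : coefField k w)
    · exact Algebra.subset_adjoin ⟨i, rfl⟩

theorem isIntegral_coordinate (hX : IsConeRing k X) (hw : IsGeneric R w) (s) :
    IsIntegral (Algebra.adjoin (coefField k w) (Set.range (proj X w))) (algebraMap R E (X s)) := by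
  obtain ⟨a, ha⟩ := step' hX hw
  exact isIntegral_of_step (U := coefField k w) (y := proj X w)
    (x := fun s => algebraMap R E (X s)) proj_mem_span (proj_ne_zero hX hw 0) ha s

theorem relation_defect_mem (hX : IsConeRing k X) (hw : IsGeneric R w)
    {a : Fin c → MvPolynomial ((Fin (n + 1) × Fin c) ⊕ Fin (n + 1)) k}
    {b : MvPolynomial ((Fin (n + 1) × Fin c) ⊕ Fin (n + 1)) k}
    (h : ∑ j, aeval (Sum.elim w (proj X w)) (a j) * algebraMap R E (X (.inr j)) =
      aeval (Sum.elim w (proj X w)) b) (p : Fin (n + 1)) :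
    ∑ j, aeval (Sum.elim w (proj X w)) (pderiv (.inr p) (a j)) * algebraMap R E (X (.inr j)) -
      aeval (Sum.elim w (proj X w)) (pderiv (.inr p) b) ∈
      Algebra.adjoin (coefField k w) (Set.range (proj X w)) := by
  set z : Fin c → E := fun j => algebraMap R E (X (.inr j)) with hz
  set Q : Submodule (projField k X w) E :=
    Submodule.span (projField k X w) (Set.range (optOne z)) with hQ
  have hL : ∀ F, aeval (Sum.elim w (proj X w)) F ∈ projField k X w := fun F =>
    IntermediateField.algebra_adjoin_le_adjoin _ _ (aeval_mem_projField F)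
  have h1 : (1 : E) ∈ Q := Submodule.subset_span ⟨none, rfl⟩
  have hzQ : ∀ j, z j ∈ Q := fun j => Submodule.subset_span ⟨some j, rfl⟩
  have hmul : ∀ F, ∀ u ∈ Q, aeval (Sum.elim w (proj X w)) F * u ∈ Q := fun F u hu =>
    Q.smul_mem (⟨_, hL F⟩ : projField k X w) hu
  have hmul1 : ∀ F, aeval (Sum.elim w (proj X w)) F ∈ Q := fun F => by
    have := hmul F 1 h1
    rwa [mul_one] at this
  set g := ∑ j, aeval (Sum.elim w (proj X w)) (pderiv (.inr p) (a j)) * z j -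
      aeval (Sum.elim w (proj X w)) (pderiv (.inr p) b) with hg
  have hgQ : ∀ u ∈ Q, g * u ∈ Q := by
    intro u hu
    induction hu using Submodule.span_induction with
    | mem u hu =>
      obtain ⟨o, rfl⟩ := hu
      rcases o with _ | j
      · change g * 1 ∈ Q
        rw [mul_one]
        exact sub_mem (Submodule.sum_mem _ fun j _ => hmul _ _ (hzQ j)) (hmul1 _)
      · change g * z j ∈ Q
        have h2 := relation_pderiv hw h (p, j)
        have h3 : g * z j = aeval (Sum.elim w (proj X w)) (pderiv (.inl (p, j)) b) -
            ∑ i, aeval (Sum.elim w (proj X w)) (pderiv (.inl (p, j)) (a i)) * z i := by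
          simp only [add_mul, Finset.sum_add_distrib] at h2
          rw [hg, sub_mul, Finset.sum_mul]
          have h4 : ∑ i, aeval (Sum.elim w (proj X w)) (pderiv (.inr p) (a i)) * z i * z j =
              ∑ i, aeval (Sum.elim w (proj X w)) (pderiv (.inr p) (a i)) * z j * z i :=
            Finset.sum_congr rfl fun i _ => by ring
          rw [h4]
          linear_combination h2
        rw [h3]
        exact sub_mem (hmul1 _) (Submodule.sum_mem _ fun i _ => hmul _ _ (hzQ i))
    | zero => rw [mul_zero]; exact zero_mem _
    | add u v _ _ hu hv => rw [mul_add]; exact add_mem hu hv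
    | smul r u _ hu => rw [mul_smul_comm]; exact Q.smul_mem r hu
  have hrank : Module.finrank (projField k X w) Q ≤ c + 2 := by
    refine (finrank_range_le_card (optOne z)).trans ?_
    simp
  have hgL : g ∈ projField k X w := mem_projField_of_mul_mem hX hw h1 hgQ hrank
  refine mem_adjoin_of_isIntegral (algebraicIndependent_proj hX hw) hgL ?_
  have hintegral : ∀ F, IsIntegral (Algebra.adjoin (coefField k w) (Set.range (proj X w)))
      (aeval (Sum.elim w (proj X w)) F) := fun F =>
    isIntegral_algebraMap (R := Algebra.adjoin (coefField k w) (Set.range (proj X w)))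
      (x := ⟨_, aeval_mem_projField F⟩)
  exact (IsIntegral.sum _ fun j _ => (hintegral _).mul (isIntegral_coordinate hX hw _)).sub (hintegral _)

theorem aeval_sumElim_injective (hX : IsConeRing k X) (hw : IsGeneric R w) :
    Function.Injective (aeval (R := k) (Sum.elim w (proj X w))) := by
  have h := (algebraicIndependent_sumElim hX hw).comp _ Sum.swap_leftInverse.injective
  have h1 : Sum.elim (proj X w) w ∘ Sum.swap = Sum.elim w (proj X w) := by
    funext s; rcases s with s | s <;> rfl
  rw [h1] at h
  exact h

theorem eq_zero_of_relation (hX : IsConeRing k X) (hw : IsGeneric R w) : ∀ (D : ℕ)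
    {a : Fin c → MvPolynomial ((Fin (n + 1) × Fin c) ⊕ Fin (n + 1)) k}
    {b : MvPolynomial ((Fin (n + 1) × Fin c) ⊕ Fin (n + 1)) k}, (∀ j, DegLE D (a j)) →
    ∑ j, aeval (Sum.elim w (proj X w)) (a j) * algebraMap R E (X (.inr j)) =
      aeval (Sum.elim w (proj X w)) b → ∀ j, a j = 0
  | 0, a, b, ha, h, j => by
    choose α hα using fun j => exists_rename_of_degLE_zero (ha j)
    have hs : ∀ s : MvPolynomial (Fin (n + 1) × Fin c) k,
        aeval (Sum.elim w (proj X w)) (rename Sum.inl s) = aeval w s := by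
      intro s; rw [aeval_rename]; rfl
    have hmem : ∀ s : MvPolynomial (Fin (n + 1) × Fin c) k, aeval w s ∈ coefField k w := by
      intro s
      have h1 : aeval w s ∈ Algebra.adjoin k (Set.range w) := by
        rw [Algebra.adjoin_range_eq_range_aeval]; exact ⟨s, rfl⟩
      exact IntermediateField.algebra_adjoin_le_adjoin _ _ h1
    have h1 := eq_zero_of_relation_constant hX hw (fun j => ⟨_, hmem (α j)⟩)
      (aeval_mem_projField (X := X) b) (by
        rw [← h]
        refine Finset.sum_congr rfl fun j _ => ?_
        rw [hα j, hs]
        rfl) j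
    have h2 : aeval w (α j) = 0 := congrArg Subtype.val h1
    refine aeval_sumElim_injective hX hw ?_
    rw [hα j, hs, h2, map_zero]
  | D + 1, a, b, ha, h, j => by
    have hs : ∀ s : MvPolynomial (Fin (n + 1) × Fin c) k,
        aeval (Sum.elim w (proj X w)) (rename Sum.inl s) = aeval w s := by
      intro s; rw [aeval_rename]; rfl
    have h0 : ∀ p j, pderiv (.inr p) (a j) = 0 := by
      intro p j
      obtain ⟨s, b', hs0, hb'⟩ := exists_clear_coefficients (relation_defect_mem hX hw h p)
      have h1 := eq_zero_of_relation hX hw D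
        (a := fun j => rename Sum.inl s * pderiv (.inr p) (a j))
        (b := b' + rename Sum.inl s * pderiv (.inr p) b)
        (fun j => DegLE.rename_mul s (ha j p)) (by
          rw [map_add, ← hb', map_mul, hs, mul_sub, Finset.mul_sum, sub_add_cancel]
          refine Finset.sum_congr rfl fun j _ => ?_
          rw [map_mul, hs, mul_assoc]) j
      refine (mul_eq_zero.1 h1).resolve_left fun h2 => hs0 ?_
      rw [← hs, h2, map_zero]
    exact eq_zero_of_relation hX hw 0 (fun j p => h0 p j) h j

end GenericProjection

namespace GenericProjection

variable {k R E : Type*} [Field k] [CommRing R] [Algebra k R] [Field E]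
  [Algebra k E] [Algebra R E] [IsScalarTower k R E] {n c : ℕ} {X : Fin (n + 1) ⊕ Fin c → R}
  {w : Fin (n + 1) × Fin c → E} [IsDomain R] [CharZero k]

theorem linearIndependent_optOne (hX : IsConeRing k X) (hw : IsGeneric R w) :
    LinearIndependent (projField k X w) (optOne fun j => algebraMap R E (X (.inr j))) := by
  rw [Fintype.linearIndependent_iff]
  intro g hg
  have hmem : ∀ u : projField k X w,
      (u : E) ∈ IntermediateField.adjoin k (Set.range (Sum.elim w (proj X w))) := by
    intro u
    rw [Set.Sum.elim_range, ← IntermediateField.adjoin_adjoin_left]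
    exact u.2
  obtain ⟨Q, P, hQ, hP⟩ := exists_common_denominator (K := k) (Sum.elim w (proj X w))
    (fun o => ⟨_, hmem (g o)⟩)
  replace hP : ∀ o, aeval (Sum.elim w (proj X w)) Q * (g o : E) =
    aeval (Sum.elim w (proj X w)) (P o) := hP
  rw [Fintype.sum_option] at hg
  replace hg : (g none : E) * 1 +
    ∑ j, (g (some j) : E) * algebraMap R E (X (.inr j)) = 0 := hg
  have h1 := eq_zero_of_relation hX hw (Finset.univ.sup fun j => (P (some j)).totalDegree)
    (a := fun j => P (some j)) (b := -P none)
    (fun j => degLE_totalDegree _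
      (Finset.le_sup (f := fun j => (P (some j)).totalDegree) (Finset.mem_univ j))) (by
      rw [map_neg, ← hP none]
      have h2 := congrArg (fun x => aeval (Sum.elim w (proj X w)) Q * x) hg
      beta_reduce at h2
      rw [mul_zero, mul_add, Finset.mul_sum, mul_one] at h2
      have h3 : ∑ j, aeval (Sum.elim w (proj X w)) (P (some j)) * algebraMap R E (X (.inr j)) =
          ∑ j, aeval (Sum.elim w (proj X w)) Q *
            ((g (some j) : E) * algebraMap R E (X (.inr j))) :=
        Finset.sum_congr rfl fun j _ => by rw [← hP, mul_assoc]
      rw [h3]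
      linear_combination h2)
  have h2 : ∀ j, g (some j) = 0 := by
    intro j
    have h3 := hP (some j)
    have h4 : P (some j) = 0 := h1 j
    rw [h4, map_zero] at h3
    exact Subtype.ext ((mul_eq_zero.1 h3).resolve_left hQ)
  intro o
  rcases o with _ | j
  · simp only [h2, ZeroMemClass.coe_zero, zero_mul, Finset.sum_const_zero, add_zero, mul_one] at hg
    exact Subtype.ext hg
  · exact h2 j

end GenericProjection

namespace GenericProjection

theorem exists_three_generators {U E : Type*} [Field U] [AddCommGroup E] [Module U E] {S : Set E}
    {A B : Submodule U E} [Module.Finite U B] (hB : B = Submodule.span U S) (hAB : A ≤ B)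
    (hrank : Module.finrank U B ≤ Module.finrank U A + 3) :
    ∃ r : Fin 3 → E, (∀ a, r a = 0 ∨ r a ∈ S) ∧ B ≤ A ⊔ Submodule.span U (Set.range r) := by
  classical
  have hspan : Submodule.span U (A.mkQ '' S) = B.map A.mkQ := by rw [hB, Submodule.map_span]
  have hfin : Module.Finite U (Submodule.span U (A.mkQ '' S)) := by
    rw [hspan]; infer_instance
  have hle : Module.finrank U (Submodule.span U (A.mkQ '' S)) ≤ 3 := by
    rw [hspan]
    have h1 := LinearMap.finrank_range_add_finrank_ker (A.mkQ.comp B.subtype)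
    rw [LinearMap.range_comp, Submodule.range_subtype, LinearMap.ker_comp, Submodule.ker_mkQ,
      (Submodule.comapSubtypeEquivOfLe hAB).finrank_eq] at h1
    omega
  obtain ⟨f, hf, hspan', -⟩ := Submodule.exists_fun_fin_finrank_span_eq U (A.mkQ '' S)
  choose g hg hgf using hf
  refine ⟨fun a => if h : (a : ℕ) < Module.finrank U (Submodule.span U (A.mkQ '' S)) then
    g ⟨a, h⟩ else 0, fun a => ?_, fun x hx => ?_⟩
  · beta_reduce
    split_ifs
    · exact Or.inr (hg _)
    · exact Or.inl rfl
  · have h1 : A.mkQ x ∈ (Submodule.span U (Set.range g)).map A.mkQ := by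
      rw [Submodule.map_span, ← Set.range_comp, show A.mkQ ∘ g = f from funext hgf, hspan', hspan]
      exact ⟨x, hx, rfl⟩
    obtain ⟨u, hu, hux⟩ := h1
    have h2 : x - u ∈ A := by
      rw [← Submodule.ker_mkQ A, LinearMap.mem_ker, map_sub, hux, sub_self]
    rw [← sub_add_cancel x u]
    refine Submodule.add_mem_sup h2 (Submodule.span_mono ?_ hu)
    rintro _ ⟨i, rfl⟩
    refine ⟨⟨i, lt_of_lt_of_le i.2 hle⟩, ?_⟩
    beta_reduce
    rw [dif_pos i.2]

variable {U L E : Type*} [Field U] [Field L] [Field E] [Algebra U L] [Algebra L E] [Algebra U E]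
  [IsScalarTower U L E] {m c : ℕ} {y : Fin m → L} {z : Fin c → E}

theorem le_finrank_yspan_mul (hy : AlgebraicIndependent U y) (hz : LinearIndependent L (optOne z)) :
    (m + 1).choose 2 + c * m ≤ Module.finrank U (yspan U y E * yzspan U y z : Submodule U E) := by
  have hfinh : ∀ d, Module.Finite U (homogeneousSubmodule (Fin m) U d) := fun d =>
    Module.Finite.iff_fg.2 (homogeneousSubmodule_fg _ _ _)
  have := hfinh 1
  have := hfinh 2
  have hfg : (yspan U y E * yzspan U y z : Submodule U E).FG :=
    (Submodule.fg_span (Set.finite_range _)).mul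
      ((Submodule.fg_span (Set.finite_range _)).sup (Submodule.fg_span (Set.finite_range _)))
  have hfin : Module.Finite U (yspan U y E * yzspan U y z : Submodule U E) :=
    Module.Finite.iff_fg.2 hfg
  set A : MvPolynomial (Fin m) U →ₗ[U] E :=
    (IsScalarTower.toAlgHom U L E).toLinearMap.comp (aeval y).toLinearMap with hA
  have hA' : ∀ p, A p = algebraMap L E (aeval y p) := fun p => rfl
  have hApow : ∀ d p, p ∈ homogeneousSubmodule (Fin m) U d → A p ∈ yspan U y E ^ d := by
    intro d p hp
    have h1 : A p = aeval (fun i => algebraMap L E (y i)) p := by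
      rw [hA']
      exact (MvPolynomial.aeval_algebraMap_apply E y p).symm
    rw [h1]
    exact (mem_span_pow_iff _ _ _).2 ⟨p, hp, rfl⟩
  set Ψ : (homogeneousSubmodule (Fin m) U 2 × (Fin c → homogeneousSubmodule (Fin m) U 1)) →ₗ[U] E :=
    (A.comp (Submodule.subtype _)).coprod
      (∑ j, (LinearMap.mulRight U (z j)).comp
        ((A.comp (Submodule.subtype _)).comp (LinearMap.proj j))) with hΨ
  have hΨ' : ∀ p l, Ψ (p, l) = algebraMap L E (aeval y (p : MvPolynomial (Fin m) U)) +
      ∑ j, algebraMap L E (aeval y (l j : MvPolynomial (Fin m) U)) * z j := by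
    intro p l
    simp [hΨ, hA']
  have hinj : Function.Injective Ψ := by
    rw [← LinearMap.ker_eq_bot, LinearMap.ker_eq_bot']
    rintro ⟨p, l⟩ h
    rw [hΨ'] at h
    rw [Fintype.linearIndependent_iff] at hz
    have h1 := hz (fun o => o.elim (aeval y (p : MvPolynomial (Fin m) U))
      fun j => aeval y (l j : MvPolynomial (Fin m) U)) (by
        rw [Fintype.sum_option]
        simp only [Algebra.smul_def]
        change algebraMap L E (aeval y (p : MvPolynomial (Fin m) U)) * 1 + _ = 0
        rw [mul_one]
        exact h)
    have h0 : ∀ q : MvPolynomial (Fin m) U, aeval y q = 0 → q = 0 := fun q hq =>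
      hy (hq.trans (map_zero _).symm)
    have hp : p = 0 := Subtype.ext (h0 _ (h1 none))
    have hl : l = 0 := funext fun j => Subtype.ext (h0 _ (h1 (some j)))
    rw [hp, hl]; rfl
  have hrange : LinearMap.range Ψ ≤ (yspan U y E * yzspan U y z : Submodule U E) := by
    rintro _ ⟨⟨p, l⟩, rfl⟩
    rw [hΨ']
    refine add_mem ?_ (Submodule.sum_mem _ fun j _ => ?_)
    · have h1 := hApow 2 p p.2
      rw [pow_two] at h1
      exact (mul_le_mul' le_rfl le_sup_left : yspan U y E * yspan U y E ≤ yspan U y E * yzspan U y z) h1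
    · have h1 := hApow 1 (l j) (l j).2
      rw [pow_one] at h1
      exact Submodule.mul_mem_mul h1 (z_mem_yzspan j)
  have h1 := Submodule.finrank_mono hrange
  rw [LinearMap.finrank_range_of_inj hinj, Module.finrank_prod, Module.finrank_pi_fintype,
    finrank_homogeneousSubmodule, finrank_homogeneousSubmodule] at h1
  simpa using h1

end GenericProjection

namespace GenericProjection

theorem linearMap_eq_of_quadratic {k σ M : Type*} [CommRing k] [AddCommGroup M] [Module k M]
    (f g : MvPolynomial σ k →ₗ[k] M) (h : ∀ s t, f (X s * X t) = g (X s * X t))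
    {q : MvPolynomial σ k} (hq : q.IsHomogeneous 2) : f q = g q := by
  have h1 : q ∈ (Submodule.span k (Set.range (X : σ → MvPolynomial σ k))) ^ 2 := by
    rw [← homogeneousSubmodule_one_eq_span_X, homogeneousSubmodule_one_pow]
    exact hq
  rw [pow_two, Submodule.span_mul_span] at h1
  refine LinearMap.eqOn_span (f := f) (g := g) ?_ h1
  rintro _ ⟨_, ⟨s, rfl⟩, _, ⟨t, rfl⟩, rfl⟩
  exact h s t

theorem exists_factor {K A B M : Type*} [Field K] [AddCommGroup A] [AddCommGroup B]
    [AddCommGroup M] [Module K A] [Module K B] [Module K M] (g : A →ₗ[K] B) (D : A →ₗ[K] M)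
    (h : LinearMap.ker g ≤ LinearMap.ker D) : ∃ f : B →ₗ[K] M, ∀ a, f (g a) = D a := by
  obtain ⟨f, hf⟩ := LinearMap.exists_extend
    (((LinearMap.ker g).liftQ D h).comp g.quotKerEquivRange.symm.toLinearMap)
  refine ⟨f, fun a => ?_⟩
  have h1 := congrArg (fun F => F ⟨g a, LinearMap.mem_range_self g a⟩) hf
  simp only [LinearMap.comp_apply, Submodule.subtype_apply, LinearEquiv.coe_coe] at h1
  rw [h1]
  have h2 : g.quotKerEquivRange.symm ⟨g a, LinearMap.mem_range_self g a⟩ =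
      Submodule.Quotient.mk a := by
    rw [LinearEquiv.symm_apply_eq]
    rfl
  rw [h2]
  exact Submodule.liftQ_apply _ _ _

theorem exists_linearMap_eq {K V M ι : Type*} [Field K] [AddCommGroup V] [AddCommGroup M]
    [Module K V] [Module K M] {x : ι → V} (hx : LinearIndependent K x) (v : ι → M) :
    ∃ ψ : V →ₗ[K] M, ∀ s, ψ (x s) = v s := by
  obtain ⟨ψ, hψ⟩ := LinearMap.exists_extend ((Module.Basis.span hx).constr K v)
  refine ⟨ψ, fun s => ?_⟩
  have h1 := congrArg (fun F => F (Module.Basis.span hx s)) hψ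
  simp only [LinearMap.comp_apply, Submodule.subtype_apply, Module.Basis.constr_basis] at h1
  rw [← h1, Module.Basis.span_apply]

variable {k U L E : Type*} [Field k] [Field U] [Field L] [Field E] [Algebra k U] [Algebra k L]
  [Algebra k E] [Algebra U L] [Algebra U E] [Algebra L E] [IsScalarTower k U L]
  [IsScalarTower k U E] [IsScalarTower U L E] {m c : ℕ} {x : Fin m ⊕ Fin c → E} {y : Fin m → L}
  {ω : Fin m × Fin c → U}

theorem exists_tangent (hω : Function.Injective (aeval (R := k) ω))
    (hden : ∀ f : Fin m ⊕ Fin c → U, ∃ (Q : MvPolynomial (Fin m × Fin c) k)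
      (P : Fin m ⊕ Fin c → MvPolynomial (Fin m × Fin c) k), aeval ω Q ≠ 0 ∧
      ∀ s, aeval ω Q * f s = aeval ω (P s))
    (hx : LinearIndependent U x)
    (hxy : ∀ i, algebraMap L E (y i) = x (.inl i) + ∑ j, ω (i, j) • x (.inr j))
    (hext : ∀ D : MvPolynomial (Fin m ⊕ Fin c) k →ₗ[k] L,
      (∀ q, q.IsHomogeneous 2 → aeval x q = 0 → D q = 0) →
      ∃ F : E →ₗ[U] L, ∀ q : MvPolynomial (Fin m ⊕ Fin c) k, q.IsHomogeneous 2 →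
        F (aeval x q) = D q)
    (ℓ θ : E →ₗ[U] U) (hℓ : ∀ i, ℓ (algebraMap L E (y i)) = 0) (hℓz : ∃ j, ℓ (x (.inr j)) ≠ 0)
    (hθ : ∀ s t, θ (x s * x t) = ℓ (x s) * ℓ (x t)) :
    ∃ (Θ ψ : E →ₗ[U] L), (∀ i, ψ (algebraMap L E (y i)) = y i) ∧
      ∀ u ∈ Submodule.span U (Set.range x), ∀ v ∈ Submodule.span U (Set.range x),
        Θ (u * v) = algebraMap U L (ℓ u) * ψ v + ψ u * algebraMap U L (ℓ v) := by
  classical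
  obtain ⟨j₀, hj₀⟩ := hℓz
  obtain ⟨Q, P, hQ, hP⟩ := hden fun s => ℓ (x s)
  have hlin : ∀ i, P (.inl i) + ∑ j, X (i, j) * P (.inr j) = 0 := by
    intro i
    refine hω ?_
    have h1 := hℓ i
    rw [hxy, map_add, map_sum] at h1
    simp only [map_smul, smul_eq_mul] at h1
    simp only [map_add, map_sum, map_mul, aeval_X, ← hP, map_zero]
    have h2 : ∑ j, ω (i, j) * (aeval ω Q * ℓ (x (.inr j))) =
        aeval ω Q * ∑ j, ω (i, j) * ℓ (x (.inr j)) := by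
      rw [Finset.mul_sum]; exact Finset.sum_congr rfl fun j _ => by ring
    rw [h2, ← mul_add, h1, mul_zero]
  have hscale : ∀ (d : ℕ) (q : MvPolynomial (Fin m ⊕ Fin c) k), q.IsHomogeneous d →
      aeval ω (aeval P q) = aeval ω Q ^ d * aeval (fun s => ℓ (x s)) q := by
    intro d q hq
    have h1 : aeval ω (aeval P q) = aeval (fun s => aeval ω Q * ℓ (x s)) q := by
      have h2 : (aeval ω).comp (aeval P) = aeval (R := k) (fun s => aeval ω Q * ℓ (x s)) := by
        refine MvPolynomial.algHom_ext fun s => ?_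
        simp [hP]
      exact congrArg (fun f => f q) h2
    rw [h1, aeval_mul_const hq]
  have hθq : ∀ q : MvPolynomial (Fin m ⊕ Fin c) k, q.IsHomogeneous 2 →
      θ (aeval x q) = aeval (fun s => ℓ (x s)) q := by
    intro q hq
    refine linearMap_eq_of_quadratic ((θ.restrictScalars k).comp (aeval x).toLinearMap)
      (aeval fun s => ℓ (x s)).toLinearMap (fun s t => ?_) hq
    simp [hθ]
  have hquad : ∀ q : MvPolynomial (Fin m ⊕ Fin c) k, q.IsHomogeneous 2 → aeval x q = 0 →
      aeval P q = 0 := by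
    intro q hq h0
    refine hω ?_
    rw [hscale 2 q hq, ← hθq q hq, h0, map_zero, mul_zero, map_zero]
  have hPj : aeval ω (P (.inr j₀)) ≠ 0 := by rw [← hP]; exact mul_ne_zero hQ hj₀
  set e : Fin m → Fin m ⊕ Fin c → U := fun i s =>
    -(aeval ω (pderiv (i, j₀) (P s)) / aeval ω (P (.inr j₀))) with he
  obtain ⟨ψ, hψ⟩ := exists_linearMap_eq hx fun s => ∑ i, e i s • y i
  have he1 : ∀ i i', e i (.inl i') + ∑ j, ω (i', j) * e i (.inr j) = if i = i' then 1 else 0 := by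
    intro i i'
    have h1 := congrArg (fun F => aeval ω (pderiv (i, j₀) F)) (hlin i')
    simp only [map_add, map_sum, pderiv_mul, map_mul, aeval_X, map_zero,
      Finset.sum_add_distrib] at h1
    have h2 : ∑ j, aeval ω (pderiv (i, j₀) (X (i', j) : MvPolynomial (Fin m × Fin c) k)) *
        aeval ω (P (.inr j)) = if i = i' then aeval ω (P (.inr j₀)) else 0 := by
      split_ifs with hi
      · subst hi
        rw [Finset.sum_eq_single j₀]
        · rw [pderiv_X_self, map_one, one_mul]
        · intro j _ hj
          rw [pderiv_X_of_ne (fun h => hj (congrArg Prod.snd h)), map_zero, zero_mul]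
        · intro h; exact absurd (Finset.mem_univ _) h
      · refine Finset.sum_eq_zero fun j _ => ?_
        rw [pderiv_X_of_ne (fun h => hi (congrArg Prod.fst h).symm), map_zero, zero_mul]
    rw [h2] at h1
    have h3 : e i (.inl i') + ∑ j, ω (i', j) * e i (.inr j) =
        -((aeval ω (pderiv (i, j₀) (P (.inl i'))) +
          ∑ j, ω (i', j) * aeval ω (pderiv (i, j₀) (P (.inr j)))) / aeval ω (P (.inr j₀))) := by
      simp only [he, add_div, Finset.sum_div, neg_add, mul_neg, Finset.sum_neg_distrib,
        mul_div_assoc]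
    rw [h3]
    have h4 : aeval ω (pderiv (i, j₀) (P (.inl i'))) +
          ∑ j, ω (i', j) * aeval ω (pderiv (i, j₀) (P (.inr j))) =
        -(if i = i' then aeval ω (P (.inr j₀)) else 0) := by
      linear_combination h1
    rw [h4]
    split_ifs
    · rw [neg_div, neg_neg, div_self hPj]
    · simp
  have hψy : ∀ i, ψ (algebraMap L E (y i)) = y i := by
    intro i'
    rw [hxy, map_add, map_sum]
    simp only [map_smul, hψ, Finset.smul_sum, smul_smul]
    rw [Finset.sum_comm, ← Finset.sum_add_distrib]
    simp only [← Finset.sum_smul, ← add_smul, he1, ite_smul, one_smul, zero_smul]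
    rw [Finset.sum_ite_eq' Finset.univ i' y, if_pos (Finset.mem_univ _)]
  set D : MvPolynomial (Fin m ⊕ Fin c) k →ₗ[k] L :=
    ∑ s, (LinearMap.mulRight k (ψ (x s))).comp (((IsScalarTower.toAlgHom k U L).toLinearMap.comp
      (aeval fun s => ℓ (x s)).toLinearMap).comp (pderiv s).toLinearMap) with hD
  have hD' : ∀ q, D q = ∑ s, algebraMap U L (aeval (fun s => ℓ (x s)) (pderiv s q)) * ψ (x s) := by
    intro q
    simp [hD]
  obtain ⟨Θ, hΘ⟩ := hext D (by
    intro q hq h0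
    have h1 : ∀ i, ∑ s, aeval (fun s => ℓ (x s)) (pderiv s q) * e i s = 0 := by
      intro i
      have h2 := congrArg (fun F => aeval ω (pderiv (i, j₀) F)) (hquad q hq h0)
      beta_reduce at h2
      rw [pderiv_aeval, map_sum, map_zero, map_zero] at h2
      have h3 : ∀ s, (pderiv s q).IsHomogeneous 1 := fun s => hq.pderiv
      simp only [map_mul, hscale 1 _ (h3 _)] at h2
      have h4 : ∑ s, aeval (fun s => ℓ (x s)) (pderiv s q) * e i s =
          -((∑ s, aeval ω Q ^ 1 * aeval (fun s => ℓ (x s)) (pderiv s q) *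
            aeval ω (pderiv (i, j₀) (P s))) / (aeval ω Q * aeval ω (P (.inr j₀)))) := by
        rw [Finset.sum_div, ← Finset.sum_neg_distrib]
        refine Finset.sum_congr rfl fun s _ => ?_
        simp only [he]
        field_simp
      rw [h4, h2, zero_div, neg_zero]
    rw [hD']
    simp only [hψ, Finset.mul_sum]
    rw [Finset.sum_comm]
    refine Finset.sum_eq_zero fun i _ => ?_
    have h2 := congrArg (fun a => algebraMap U L a * y i) (h1 i)
    beta_reduce at h2
    rw [map_zero, zero_mul, map_sum, Finset.sum_mul] at h2
    rw [← h2]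
    refine Finset.sum_congr rfl fun s _ => ?_
    rw [Algebra.smul_def, map_mul, mul_assoc])
  refine ⟨Θ, ψ, hψy, fun u hu v hv => ?_⟩
  induction hu, hv using Submodule.span_induction₂ with
  | mem_mem a b ha hb =>
    obtain ⟨s, rfl⟩ := ha
    obtain ⟨t, rfl⟩ := hb
    have h1 := hΘ (X s * X t) ((isHomogeneous_X k s).mul (isHomogeneous_X k t))
    rw [map_mul, aeval_X, aeval_X] at h1
    rw [h1, hD']
    have h2 : ∀ r, aeval (fun s => ℓ (x s)) (pderiv r (X s * X t : MvPolynomial (Fin m ⊕ Fin c) k)) =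
        (if r = s then ℓ (x t) else 0) + if r = t then ℓ (x s) else 0 := by
      intro r
      rw [pderiv_mul, map_add, map_mul, map_mul, aeval_X, aeval_X]
      congr 1
      · split_ifs with h
        · subst h; rw [pderiv_X_self, map_one, one_mul]
        · rw [pderiv_X_of_ne (Ne.symm h), map_zero, zero_mul]
      · split_ifs with h
        · subst h; rw [pderiv_X_self, map_one, mul_one]
        · rw [pderiv_X_of_ne (Ne.symm h), map_zero, mul_zero]
    simp only [h2, map_add, add_mul, Finset.sum_add_distrib, apply_ite (algebraMap U L), map_zero,
      ite_mul, zero_mul, Finset.sum_ite_eq', Finset.mem_univ, if_true]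
    ring
  | zero_left => simp
  | zero_right => simp
  | add_left a b c _ _ _ h1 h2 => simp only [add_mul, map_add, h1, h2]; ring
  | add_right a b c _ _ _ h1 h2 => simp only [mul_add, map_add, h1, h2]; ring
  | smul_left r a b _ _ h =>
    rw [smul_mul_assoc, map_smul Θ, h, map_smul ψ, map_smul ℓ, smul_eq_mul, map_mul,
      Algebra.smul_def, Algebra.smul_def]
    ring
  | smul_right r a b _ _ h =>
    rw [mul_smul_comm, map_smul Θ, h, map_smul ψ, map_smul ℓ, smul_eq_mul, map_mul,
      Algebra.smul_def, Algebra.smul_def]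
    ring

end GenericProjection

namespace GenericProjection

variable {k R E : Type*} [Field k] [CommRing R] [Algebra k R] [Field E]
  [Algebra k E] [Algebra R E] [IsScalarTower k R E] {n c : ℕ} {X : Fin (n + 1) ⊕ Fin c → R}
  {w : Fin (n + 1) × Fin c → E}

variable (k w) in
/-- The coefficients of the projection, as elements of the field they generate. -/
def coefElt (q : Fin (n + 1) × Fin c) : coefField k w := ⟨w q, w_mem_coefField k w q⟩

variable (k X w) in
/-- The coordinates of the projection, as elements of the field they generate. -/
def projElt (i : Fin (n + 1)) : projField k X w :=
  ⟨proj X w i, IntermediateField.subset_adjoin _ _ ⟨i, rfl⟩⟩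

theorem coe_aeval_coefElt (F : MvPolynomial (Fin (n + 1) × Fin c) k) :
    ((aeval (coefElt k w) F : coefField k w) : E) = aeval w F :=
  (MvPolynomial.aeval_algebraMap_apply E (coefElt k w) F).symm

variable [IsDomain R]

theorem yspan_projElt :
    yspan (coefField k w) (projElt k X w) E = projSpan k X w := rfl

theorem yzspan_projElt : yzspan (coefField k w) (projElt k X w)
    (fun j => algebraMap R E (X (.inr j))) = forms k X w := by
  refine le_antisymm (sup_le (yspan_projElt.le.trans projSpan_le_forms) ?_) forms_le
  rw [Submodule.span_le]
  rintro _ ⟨j, rfl⟩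
  exact algebraMap_mem_forms _

variable [CharZero k]

theorem exists_tangent_proj (hX : IsConeRing k X) (hw : IsGeneric R w)
    (ℓ θ : E →ₗ[coefField k w] coefField k w) (hℓ : ∀ i, ℓ (proj X w i) = 0)
    (hℓz : ∃ j, ℓ (algebraMap R E (X (.inr j))) ≠ 0)
    (hθ : ∀ u ∈ forms k X w, ∀ v ∈ forms k X w, θ (u * v) = ℓ u * ℓ v) :
    ∃ (Θ ψ : E →ₗ[coefField k w] projField k X w), (∀ i, ψ (proj X w i) = projElt k X w i) ∧
      ∀ u ∈ forms k X w, ∀ v ∈ forms k X w,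
        Θ (u * v) = algebraMap (coefField k w) (projField k X w) (ℓ u) * ψ v +
          ψ u * algebraMap (coefField k w) (projField k X w) (ℓ v) := by
  have h1 : IsScalarTower k (coefField k w) (projField k X w) :=
    IsScalarTower.of_algebraMap_eq fun x => rfl
  have hcomp : ∀ q : MvPolynomial (Fin (n + 1) ⊕ Fin c) k,
      aeval (fun s => algebraMap R E (X s)) q = algebraMap R E (aeval X q) := fun q =>
    MvPolynomial.aeval_algebraMap_apply E X q
  have h3 : Module.Finite k (Submodule.span k (Set.range X)) :=
    Module.Finite.iff_fg.2 (Submodule.fg_span (Set.finite_range _))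
  have h := exists_tangent (k := k) (U := coefField k w) (L := projField k X w) (E := E)
    (x := fun s => algebraMap R E (X s)) (y := projElt k X w) (ω := coefElt k w)
    (by
      intro F G hFG
      have h2 := congrArg (algebraMap (coefField k w) E) hFG
      have h3 : aeval w F = aeval w G := by
        rw [← coe_aeval_coefElt (w := w), ← coe_aeval_coefElt (w := w)]; exact h2
      have h4 := (algebraicIndependent_sumElim hX hw).comp _ Sum.inr_injective
      exact h4 h3)
    (by
      intro f
      obtain ⟨Q, P, hQ, hP⟩ := exists_common_denominator (K := k) w f
      refine ⟨Q, P, fun h => hQ ?_, fun s => Subtype.ext ?_⟩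
      · rw [← coe_aeval_coefElt (w := w), h]; rfl
      · rw [coe_aeval_coefElt, ← hP s, ← coe_aeval_coefElt (w := w)]; rfl)
    (linearIndependent_algebraMap hX hw)
    (fun i => rfl)
    (by
      intro D hD
      obtain ⟨f, hf⟩ := exists_factor
        ((aeval (R := k) X).toLinearMap.comp (homogeneousSubmodule _ k 2).subtype)
        (D.comp (homogeneousSubmodule _ k 2).subtype) (by
          rintro ⟨q, hq⟩ h2
          have h3 : aeval X q = 0 := h2
          refine hD q hq ?_
          rw [hcomp, h3, map_zero])
      obtain ⟨F, hF⟩ := exists_extend_bc hw.indep (Submodule.span k (Set.range X) ^ 2)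
        (f.comp (Submodule.subtype _))
      refine ⟨F, fun q hq => ?_⟩
      have h2 := hF ⟨aeval X q, (mem_span_pow_iff X 2 _).2 ⟨q, hq, rfl⟩⟩
      rw [hcomp]
      refine h2.trans ?_
      exact hf ⟨q, hq⟩)
    ℓ θ hℓ hℓz (fun s t => hθ _ (algebraMap_mem_forms s) _ (algebraMap_mem_forms t))
  rw [← forms_eq] at h
  exact h

theorem exists_generic_generators (hc : 4 ≤ c) (hX : IsConeRing k X) (hw : IsGeneric R w) :
    ∃ r : Fin 3 → R, (∀ a, r a ∈ Submodule.span k (Set.range X) ^ 2) ∧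
      forms k X w * forms k X w ≤ projSpan k X w * forms k X w ⊔
        Submodule.span (coefField k w) (Set.range fun a => algebraMap R E (r a)) ∧
      forms k X w * (forms k X w * forms k X w) ≤
        projSpan k X w * (forms k X w * forms k X w) := by
  have h2 : forms k X w * forms k X w =
      bc (coefField k w) (Submodule.span k (Set.range X) ^ 2) := by
    rw [bc_pow, pow_two]
  have hfin : Module.Finite (coefField k w)
      (forms k X w * forms k X w : Submodule (coefField k w) E) := by
    refine Module.Finite.iff_fg.2 ?_
    have h3 : (forms k X w).FG := by
      rw [forms_eq]; exact Submodule.fg_span (Set.finite_range _)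
    exact h3.mul h3
  have hrank : Module.finrank (coefField k w)
      (forms k X w * forms k X w : Submodule (coefField k w) E) =
      (n + 2).choose 2 + (n + 1) * c + 3 := by
    have h3 : Module.Finite k (Submodule.span k (Set.range X)) :=
      Module.Finite.iff_fg.2 (Submodule.fg_span (Set.finite_range _))
    rw [h2, finrank_bc hw.indep, hX.finrank_sq]
  have hind : AlgebraicIndependent (coefField k w) (projElt k X w) :=
    AlgebraicIndependent.of_comp (projField k X w).val (algebraicIndependent_proj hX hw)
  have hlow : (n + 2).choose 2 + c * (n + 1) ≤ _ := le_finrank_yspan_mul hind (linearIndependent_optOne hX hw)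
  rw [yspan_projElt, yzspan_projElt] at hlow
  have hS : forms k X w * forms k X w = Submodule.span (coefField k w)
      (algebraMap R E '' (Submodule.span k (Set.range X) ^ 2 : Submodule k R)) := h2
  obtain ⟨r', hr', hle⟩ := exists_three_generators hS
    (mul_le_mul' projSpan_le_forms le_rfl : projSpan k X w * forms k X w ≤ _)
    (by rw [hrank]; rw [mul_comm c] at hlow; omega)
  have hr'' : ∀ a, ∃ s ∈ Submodule.span k (Set.range X) ^ 2, algebraMap R E s = r' a := by
    intro a
    rcases hr' a with h | ⟨s, hs, h⟩
    · exact ⟨0, zero_mem _, by rw [h, map_zero]⟩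
    · exact ⟨s, hs, h⟩
  choose r hr hrr using hr''
  obtain rfl : (fun a => algebraMap R E (r a)) = r' := funext hrr
  refine ⟨r, hr, hle, ?_⟩
  have hfinL := finite_projField hX hw
  have h := cubes_le (U := coefField k w) (L := projField k X w) (E := E) (y := projElt k X w)
    (z := fun j => algebraMap R E (X (.inr j))) (r := fun a => algebraMap R E (r a))
    (by rw [yspan_projElt, yzspan_projElt]; exact hle)
    (linearIndependent_optOne hX hw) hc (finrank_projField hX hw)
    (by
      rw [yzspan_projElt]
      exact exists_tangent_proj hX hw)
  rw [yspan_projElt, yzspan_projElt] at h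
  exact h

end GenericProjection

namespace GenericProjection

theorem exists_sum_of_mem_span_mul {K A J : Type*} [CommRing K] [CommRing A] [Algebra K A] [Fintype J]
    {y : J → A} {G : Submodule K A} {u : A} (hu : u ∈ Submodule.span K (Set.range y) * G) :
    ∃ g : J → A, (∀ i, g i ∈ G) ∧ u = ∑ i, y i * g i := by
  refine Submodule.mul_induction_on hu (fun a ha b hb => ?_) ?_
  · obtain ⟨t, rfl⟩ := (Submodule.mem_span_range_iff_exists_fun K).1 ha
    refine ⟨fun i => t i • b, fun i => G.smul_mem _ hb, ?_⟩
    rw [Finset.sum_mul]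
    exact Finset.sum_congr rfl fun i _ => by rw [smul_mul_assoc, mul_smul_comm]
  · rintro _ _ ⟨g, hg, rfl⟩ ⟨g', hg', rfl⟩
    refine ⟨fun i => g i + g' i, fun i => add_mem (hg i) (hg' i), ?_⟩
    simp only [mul_add, Finset.sum_add_distrib]

theorem aeval_mem_of_coeffsIn {k R W : Type*} [Field k] [CommRing R] [Algebra k R]
    {V : Submodule k R} {p : MvPolynomial W R} (hp : coeffsIn V p) (w₀ : W → k) :
    aeval (fun v => algebraMap k R (w₀ v)) p ∈ V := by
  rw [aeval_def, eval₂_eq]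
  refine Submodule.sum_mem _ fun d _ => ?_
  have h1 : ∏ i ∈ d.support, algebraMap k R (w₀ i) ^ d i =
      algebraMap k R (∏ i ∈ d.support, w₀ i ^ d i) := by
    simp only [map_prod, map_pow]
  rw [h1, mul_comm, ← Algebra.smul_def]
  exact V.smul_mem _ (hp d)

variable {k R E : Type*} [Field k] [CommRing R] [Algebra k R] [Field E]
  [Algebra k E] [Algebra R E] [IsScalarTower k R E] {n c : ℕ} {X : Fin (n + 1) ⊕ Fin c → R}
  {w : Fin (n + 1) × Fin c → E}

/-- The coordinates of the projection with scalar coefficients. -/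
def scalarProj (X : Fin (n + 1) ⊕ Fin c → R) (w₀ : Fin (n + 1) × Fin c → k) (i : Fin (n + 1)) : R :=
  X (.inl i) + ∑ j, w₀ (i, j) • X (.inr j)

theorem exists_specialization_mem (hw : IsGeneric R w) {V : Submodule k R} {r : Fin 3 → R} {u : R}
    (hu : algebraMap R E u ∈ projSpan k X w * bc (coefField k w) V ⊔
      Submodule.span (coefField k w) (Set.range fun a => algebraMap R E (r a))) :
    ∃ Q : MvPolynomial (Fin (n + 1) × Fin c) k, Q ≠ 0 ∧ ∀ w₀, eval w₀ Q ≠ 0 →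
      u ∈ Submodule.span k (Set.range (scalarProj X w₀)) * V ⊔ Submodule.span k (Set.range r) := by
  obtain ⟨a, ha, b, hb, hab⟩ := Submodule.mem_sup.1 hu
  obtain ⟨g, hg, rfl⟩ := exists_sum_of_mem_span_mul ha
  obtain ⟨t, rfl⟩ := (Submodule.mem_span_range_iff_exists_fun (coefField k w)).1 hb
  obtain ⟨Q, p, hQ, hp, hQp⟩ := exists_of_forall_mem_bc (k := k) (R := R) (S := Fin (n + 1) ⊕ Fin 3) w
    (V := Sum.elim (fun _ => V) fun _ => 1) (u := Sum.elim g fun a => (t a : E)) (by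
      rintro (i | a)
      · exact hg i
      · change (t a : E) ∈ bc (coefField k w) (1 : Submodule k R)
        rw [bc_one]
        exact Submodule.mem_one.2 ⟨t a, rfl⟩)
  refine ⟨Q, fun h => hQ (by rw [h, map_zero]), fun w₀ hw₀ => ?_⟩
  have hrel : map (algebraMap k R) Q * C u =
      ∑ i, (C (X (.inl i)) + ∑ j, MvPolynomial.X (i, j) * C (X (.inr j))) * p (.inl i) +
        ∑ a, p (.inr a) * C (r a) := by
    refine hw.indep ?_
    have hC : ∀ r : R, aeval w (C r : MvPolynomial (Fin (n + 1) × Fin c) R) = algebraMap R E r :=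
      fun r => by simp
    simp only [map_add, map_sum, map_mul, aeval_X, hC, aeval_map_algebraMap, ← hQp, Sum.elim_inl,
      Sum.elim_inr, ← hab, mul_add, Finset.mul_sum, Algebra.smul_def]
    congr 1
    · refine Finset.sum_congr rfl fun i _ => ?_
      rw [proj]; ring
    · refine Finset.sum_congr rfl fun a _ => ?_
      rw [mul_assoc]; rfl
  have h1 := congrArg (aeval fun v => algebraMap k R (w₀ v)) hrel
  have hC : ∀ r : R, aeval (fun v => algebraMap k R (w₀ v))
      (C r : MvPolynomial (Fin (n + 1) × Fin c) R) = r := fun r => by simp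
  have hQ0 : aeval (fun v => algebraMap k R (w₀ v)) (map (algebraMap k R) Q) =
      algebraMap k R (eval w₀ Q) := by
    rw [MvPolynomial.aeval_map_algebraMap]
    exact MvPolynomial.aeval_algebraMap_apply R w₀ Q
  simp only [map_add, map_sum, map_mul, aeval_X, hC, hQ0] at h1
  have h2 : u = (eval w₀ Q)⁻¹ • (algebraMap k R (eval w₀ Q) * u) := by
    rw [← Algebra.smul_def, smul_smul, inv_mul_cancel₀ hw₀, one_smul]
  rw [h2, h1]
  refine Submodule.smul_mem _ _ (Submodule.add_mem_sup ?_ ?_)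
  · refine Submodule.sum_mem _ fun i _ => Submodule.mul_mem_mul ?_
      (aeval_mem_of_coeffsIn (hp (.inl i)) w₀)
    refine Submodule.subset_span ⟨i, ?_⟩
    simp only [scalarProj, Algebra.smul_def]
  · refine Submodule.sum_mem _ fun a _ => ?_
    obtain ⟨s, hs⟩ := Submodule.mem_one.1 (aeval_mem_of_coeffsIn (hp (.inr a)) w₀)
    rw [← hs, ← Algebra.smul_def]
    exact Submodule.smul_mem _ _ (Submodule.subset_span ⟨a, rfl⟩)

theorem exists_specialization_le (hw : IsGeneric R w) {V V' : Submodule k R} [Module.Finite k V']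
    {r : Fin 3 → R}
    (h : bc (coefField k w) V' ≤ projSpan k X w * bc (coefField k w) V ⊔
      Submodule.span (coefField k w) (Set.range fun a => algebraMap R E (r a))) :
    ∃ Q : MvPolynomial (Fin (n + 1) × Fin c) k, Q ≠ 0 ∧ ∀ w₀, eval w₀ Q ≠ 0 →
      V' ≤ Submodule.span k (Set.range (scalarProj X w₀)) * V ⊔ Submodule.span k (Set.range r) := by
  obtain ⟨S, hS⟩ := Module.Finite.iff_fg.1 (inferInstance : Module.Finite k V')
  have h1 : ∀ u : S, ∃ Q : MvPolynomial (Fin (n + 1) × Fin c) k, Q ≠ 0 ∧ ∀ w₀, eval w₀ Q ≠ 0 →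
      (u : R) ∈ Submodule.span k (Set.range (scalarProj X w₀)) * V ⊔
        Submodule.span k (Set.range r) := fun u =>
    exists_specialization_mem hw (h (algebraMap_mem_bc _ (by
      rw [← hS]; exact Submodule.subset_span u.2)))
  choose Q hQ hQu using h1
  refine ⟨∏ u, Q u, Finset.prod_ne_zero_iff.2 fun u _ => hQ u, fun w₀ hw₀ => ?_⟩
  rw [map_prod, Finset.prod_ne_zero_iff] at hw₀
  rw [← hS, Submodule.span_le]
  exact fun u hu => hQu ⟨u, hu⟩ w₀ (hw₀ _ (Finset.mem_univ _))

variable (R) in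
theorem exists_isGeneric [IsDomain R] (W : Type*) :
    IsGeneric R fun v : W => algebraMap (MvPolynomial W R) (FractionRing (MvPolynomial W R))
      (MvPolynomial.X v) where
  indep := by
    have h1 : AlgebraicIndependent R (MvPolynomial.X : W → MvPolynomial W R) :=
      MvPolynomial.algebraicIndependent_X W R
    exact h1.map' (f := Algebra.algHom R (MvPolynomial W R) (FractionRing (MvPolynomial W R)))
      (IsFractionRing.injective _ _)
  frac := by
    intro e
    obtain ⟨p, q, hq, rfl⟩ := IsFractionRing.div_surjective (A := MvPolynomial W R) e
    have h1 : ∀ p : MvPolynomial W R,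
        aeval (fun v : W => algebraMap (MvPolynomial W R) (FractionRing (MvPolynomial W R))
          (MvPolynomial.X v)) p = algebraMap _ (FractionRing (MvPolynomial W R)) p := by
      intro p
      have h2 := MvPolynomial.aeval_algebraMap_apply (FractionRing (MvPolynomial W R))
        (MvPolynomial.X : W → MvPolynomial W R) p
      rw [aeval_X_left_apply] at h2
      exact h2
    have h0 : algebraMap _ (FractionRing (MvPolynomial W R)) q ≠ 0 := by
      simpa using nonZeroDivisors.ne_zero hq
    refine ⟨p, q, by rw [h1]; exact h0, ?_⟩
    rw [h1, h1, mul_div_cancel₀ _ h0]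

theorem exists_generators [IsDomain R] [CharZero k] (hc : 4 ≤ c) (hX : IsConeRing k X) :
    ∃ (w₀ : Fin (n + 1) × Fin c → k) (r : Fin 3 → R),
      (∀ a, r a ∈ Submodule.span k (Set.range X) ^ 2) ∧
      Submodule.span k (Set.range X) ^ 2 ≤ Submodule.span k (Set.range (scalarProj X w₀)) *
        Submodule.span k (Set.range X) ⊔ Submodule.span k (Set.range r) ∧
      Submodule.span k (Set.range X) ^ 3 ≤ Submodule.span k (Set.range (scalarProj X w₀)) *
        Submodule.span k (Set.range X) ^ 2 := by
  have hw := exists_isGeneric R (Fin (n + 1) × Fin c)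
  set w := fun v : Fin (n + 1) × Fin c => algebraMap (MvPolynomial (Fin (n + 1) × Fin c) R)
    (FractionRing (MvPolynomial (Fin (n + 1) × Fin c) R)) (MvPolynomial.X v)
  have h3 : Module.Finite k (Submodule.span k (Set.range X)) :=
    Module.Finite.iff_fg.2 (Submodule.fg_span (Set.finite_range _))
  obtain ⟨r, hr, h2, h3⟩ := exists_generic_generators hc hX hw
  have e2 : forms k X w * forms k X w =
      bc (coefField k w) (Submodule.span k (Set.range X) ^ 2) := by
    rw [bc_pow, pow_two]
  have e3 : forms k X w * (forms k X w * forms k X w) =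
      bc (coefField k w) (Submodule.span k (Set.range X) ^ 3) := by
    rw [bc_pow, pow_succ', pow_two]
  rw [e2] at h2
  rw [e3, e2] at h3
  obtain ⟨Q, hQ, hQ2⟩ := exists_specialization_le hw h2
  obtain ⟨P, hP, hP3⟩ := exists_specialization_le hw (r := 0) (h3.trans le_sup_left)
  have hPQ : P * Q ≠ 0 := mul_ne_zero hP hQ
  obtain ⟨w₀, hw₀⟩ : ∃ w₀, eval w₀ (P * Q) ≠ 0 := by
    by_contra! h
    exact hPQ (MvPolynomial.funext fun w₀ => by rw [h, map_zero])
  rw [map_mul] at hw₀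
  refine ⟨w₀, r, hr, hQ2 w₀ (right_ne_zero_of_mul hw₀), ?_⟩
  refine (hP3 w₀ (left_ne_zero_of_mul hw₀)).trans (sup_le le_rfl ?_)
  rw [Submodule.span_le]
  rintro _ ⟨a, rfl⟩
  exact zero_mem _

end GenericProjection

namespace GenericProjection

section Depth

open CategoryTheory Abelian RingTheory.Sequence

theorem subsingleton_hom_quotient_of_ext {R : Type} [CommRing R] (N : ModuleCat.{0} R) :
    ∀ (ls : List R) (M : ModuleCat.{0} R) (p : ℕ), ls.length < p →
      (∀ i < p, Subsingleton (Ext N M i)) → IsWeaklyRegular M ls →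
      Subsingleton (N →ₗ[R] M ⧸ (Ideal.ofList ls • ⊤ : Submodule R M))
  | [], M, p, hp, hext, _ => by
    have h0 := hext 0 (by omega)
    have h1 : Subsingleton (N →ₗ[R] M) :=
      (Ext.addEquiv₀.trans ModuleCat.homAddEquiv).subsingleton_congr.1 h0
    have e : (M ⧸ (Ideal.ofList ([] : List R) • ⊤ : Submodule R M)) ≃ₗ[R] M :=
      Submodule.quotEquivOfEqBot _ (by simp)
    exact ⟨fun f g => LinearMap.ext fun x => e.injective
      (LinearMap.congr_fun (Subsingleton.elim (e.toLinearMap ∘ₗ f) (e.toLinearMap ∘ₗ g)) x)⟩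
  | l :: ls, M, p, hp, hext, hreg => by
    rw [isWeaklyRegular_cons_iff] at hreg
    have h1 : ∀ i < p - 1, Subsingleton (Ext N (ModuleCat.of R (QuotSMulTop l M)) i) := by
      intro i hi
      have zero1 := AddCommGrpCat.isZero_of_iff_subsingleton.mpr (hext i (by omega))
      have zero2 := AddCommGrpCat.isZero_of_iff_subsingleton.mpr (hext (i + 1) (by omega))
      exact AddCommGrpCat.subsingleton_of_isZero <| ShortComplex.Exact.isZero_of_both_zeros
        ((Ext.covariant_sequence_exact₃' N hreg.1.smulShortComplex_shortExact) i (i + 1) rfl)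
        (zero1.eq_zero_of_src _) (zero2.eq_zero_of_tgt _)
    have h2 := subsingleton_hom_quotient_of_ext N ls (ModuleCat.of R (QuotSMulTop l M)) (p - 1)
      (by simp only [List.length_cons] at hp; omega) h1 hreg.2
    have e := Submodule.quotOfListConsSMulTopEquivQuotSMulTopInner M l ls
    exact ⟨fun f g => LinearMap.ext fun x => e.injective
      (LinearMap.congr_fun (h2.elim (e.toLinearMap ∘ₗ f) (e.toLinearMap ∘ₗ g)) x)⟩

/-- If `R / (ls)` has a nonzero element killed by an ideal containing a power of `m`, then a regular
sequence in `m` is not longer than `ls`. -/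
theorem length_le_of_isRegular {R : Type} [CommRing R] [IsNoetherianRing R] {m J : Ideal R}
    (hm : m ≠ ⊤) (hJ : m ≤ J.radical) {ls fs : List R} (hls : IsWeaklyRegular R ls) {s : R}
    (hs : s ∉ Ideal.ofList ls) (hJs : ∀ a ∈ J, a * s ∈ Ideal.ofList ls)
    (hfs : IsRegular R fs) (hfm : ∀ f ∈ fs, f ∈ m) : fs.length ≤ ls.length := by
  by_contra! hlt
  have hsupp : Module.support R (ModuleCat.of R (R ⧸ J)) ⊆ PrimeSpectrum.zeroLocus (m : Set R) := by
    change Module.support R (R ⧸ J) ⊆ _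
    rw [Module.support_eq_zeroLocus, Ideal.annihilator_quotient,
      PrimeSpectrum.zeroLocus_subset_zeroLocus_iff]
    exact hJ
  have hfin : Module.Finite R (ModuleCat.of R (R ⧸ J)) :=
    inferInstanceAs (Module.Finite R (R ⧸ J))
  have hfin' : Module.Finite R (ModuleCat.of R R) := inferInstanceAs (Module.Finite R R)
  have hext := ModuleCat.subsingleton_ext_of_exists_isRegular m (ModuleCat.of R (R ⧸ J)) hsupp
    (ModuleCat.of R R) (by
      change m • (⊤ : Submodule R R) < ⊤
      rw [smul_eq_mul, Ideal.mul_top]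
      exact lt_top_iff_ne_top.2 hm) fs hfm hfs
  have h := subsingleton_hom_quotient_of_ext (ModuleCat.of R (R ⧸ J)) ls (ModuleCat.of R R)
    fs.length hlt hext hls
  change Subsingleton ((R ⧸ J) →ₗ[R] R ⧸ (Ideal.ofList ls • ⊤ : Submodule R R)) at h
  have htop : (Ideal.ofList ls • ⊤ : Submodule R R) = Ideal.ofList ls := by
    rw [smul_eq_mul, Ideal.mul_top]
  let φ : (R ⧸ J) →ₗ[R] R ⧸ (Ideal.ofList ls • ⊤ : Submodule R R) :=
    Submodule.mapQ J _ (LinearMap.mulRight R s) fun a ha => by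
      rw [htop]
      exact hJs a ha
  have h1 : φ (Submodule.Quotient.mk 1) = 0 := by rw [Subsingleton.elim φ 0]; rfl
  have h2 : φ (Submodule.Quotient.mk 1) = Submodule.Quotient.mk (1 * s) := rfl
  rw [h2, Submodule.Quotient.mk_eq_zero, htop, one_mul] at h1
  exact hs h1

theorem isWeaklyRegular_iff_mem {R : Type*} [CommRing R] (rs : List R) :
    IsWeaklyRegular R rs ↔ ∀ (i : ℕ) (h : i < rs.length) (g : R),
      rs[i] * g ∈ Ideal.ofList (rs.take i) → g ∈ Ideal.ofList (rs.take i) := by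
  rw [isWeaklyRegular_iff]
  refine forall₂_congr fun i h => ?_
  have htop : (Ideal.ofList (rs.take i) • ⊤ : Submodule R R) = Ideal.ofList (rs.take i) := by
    rw [smul_eq_mul, Ideal.mul_top]
  rw [isSMulRegular_quotient_iff_mem_of_smul_mem, htop]
  rfl

theorem mem_ofList_map_iff {S R : Type*} [CommRing S] [CommRing R] (π : S →+* R)
    (hπ : Function.Surjective π) (fs : List S) (g : S) :
    π g ∈ Ideal.ofList (fs.map π) ↔ g ∈ RingHom.ker π ⊔ Ideal.ofList fs := by
  rw [sup_comm, ← Ideal.comap_map_of_surjective' π hπ, Ideal.mem_comap, Ideal.map_span]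
  have : (π '' {r | r ∈ fs}) = {r | r ∈ fs.map π} := by ext; simp
  rw [this]

theorem isRegular_map_iff {S R : Type*} [CommRing S] [CommRing R] (π : S →+* R)
    (hπ : Function.Surjective π) (fs : List S) :
    IsRegular R (fs.map π) ↔
      (∀ i : Fin fs.length, ∀ g : S,
        fs.get i * g ∈ RingHom.ker π ⊔ Ideal.span {h | ∃ j : Fin fs.length, j < i ∧ fs.get j = h} →
        g ∈ RingHom.ker π ⊔ Ideal.span {h | ∃ j : Fin fs.length, j < i ∧ fs.get j = h}) ∧
      RingHom.ker π ⊔ Ideal.span {h | ∃ j : Fin fs.length, fs.get j = h} ≠ ⊤ := by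
  rw [isRegular_iff, isWeaklyRegular_iff_mem]
  refine and_congr ?_ ?_
  · have hset : ∀ i : Fin fs.length, {h | ∃ j : Fin fs.length, j < i ∧ fs.get j = h} =
        {h | h ∈ fs.take i} := by
      intro i
      ext h
      simp only [Set.mem_setOf_eq, List.mem_take_iff_getElem, List.get_eq_getElem]
      constructor
      · rintro ⟨j, hj, rfl⟩
        exact ⟨j, by have := j.2; have : (j : ℕ) < i := hj; omega, rfl⟩
      · rintro ⟨j, hj, rfl⟩
        exact ⟨⟨j, by omega⟩, by rw [Fin.lt_def]; simp only; omega, rfl⟩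
    constructor
    · intro H i g hg
      rw [hset, ← mem_ofList_map_iff π hπ, map_mul] at hg
      rw [hset, ← mem_ofList_map_iff π hπ]
      have := H i (by simp) (π g)
      simp only [List.getElem_map, ← List.map_take] at this
      exact this hg
    · intro H i hi g hg
      obtain ⟨g, rfl⟩ := hπ g
      have hi' : i < fs.length := by simpa using hi
      have := H ⟨i, hi'⟩ g
      rw [hset, ← mem_ofList_map_iff π hπ, ← mem_ofList_map_iff π hπ, map_mul] at this
      simp only [List.getElem_map, ← List.map_take] at hg ⊢
      exact this hg
  · have hset : {h | ∃ j : Fin fs.length, fs.get j = h} = {h | h ∈ fs} := by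
      ext h
      simp [List.mem_iff_get]
    rw [hset, smul_eq_mul, Ideal.mul_top, ne_comm, not_iff_not, Ideal.eq_top_iff_one,
      Ideal.eq_top_iff_one, ← mem_ofList_map_iff π hπ, map_one]

end Depth

end GenericProjection

namespace GenericProjection

theorem exists_primitive_relation {K E I J : Type*} [Field K] [Field E] [Algebra K E] [Fintype J]
    {y : I → E} (hy : AlgebraicIndependent K y) {g : J → E}
    (hg : Submodule.span (IntermediateField.adjoin K (Set.range y)) (Set.range g) = ⊤)
    (hcard : Module.finrank (IntermediateField.adjoin K (Set.range y)) E + 1 = Fintype.card J) :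
    ∃ κ : J → MvPolynomial I K, (∃ t, κ t ≠ 0) ∧ ∑ t, aeval y (κ t) * g t = 0 ∧
      ∀ v : J → MvPolynomial I K, ∑ t, aeval y (v t) * g t = 0 → ∃ b, ∀ t, v t = b * κ t := by
  classical
  set L := IntermediateField.adjoin K (Set.range y) with hL
  set Φ := Fintype.linearCombination L g with hΦ
  have hrange : LinearMap.range Φ = ⊤ := by
    rw [hΦ, Fintype.range_linearCombination, hg]
  have h1 := LinearMap.finrank_range_add_finrank_ker Φ
  rw [hrange, finrank_top, Module.finrank_fintype_fun_eq_card, ← hcard] at h1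
  have h2 : Module.finrank L (LinearMap.ker Φ) = 1 := by omega
  obtain ⟨e, he0, he⟩ := finrank_eq_one_iff'.1 h2
  have hinj : Function.Injective (aeval y : MvPolynomial I K →ₐ[K] E) := hy
  have hprop : ∀ v : J → MvPolynomial I K, ∑ t, aeval y (v t) * g t = 0 →
      ∃ a : L, ∀ t, aeval y (v t) = (a : E) * ((e : J → L) t : E) := by
    intro v hv
    have hmem : (fun t => (⟨aeval y (v t), aeval_mem_adjoin y _⟩ : L)) ∈ LinearMap.ker Φ := by
      rw [LinearMap.mem_ker, hΦ, Fintype.linearCombination_apply]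
      exact hv
    obtain ⟨a, ha⟩ := he ⟨_, hmem⟩
    refine ⟨a, fun t => ?_⟩
    have h3 := congrFun (congrArg Subtype.val ha) t
    exact (congrArg Subtype.val h3).symm
  have hcross : ∀ u v : J → MvPolynomial I K, ∑ t, aeval y (u t) * g t = 0 →
      ∑ t, aeval y (v t) * g t = 0 → ∀ s t, u s * v t = u t * v s := by
    intro u v hu hv s t
    obtain ⟨a, ha⟩ := hprop u hu
    obtain ⟨b, hb⟩ := hprop v hv
    apply hinj
    rw [map_mul, map_mul, ha, hb, ha, hb]
    ring
  obtain ⟨Q, P, hQ, hP⟩ := exists_common_denominator y (fun t => (e : J → L) t)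
  have hPrel : ∑ t, aeval y (P t) * g t = 0 := by
    have h3 : Φ e = 0 := e.2
    have h4 : ∑ t, ((e : J → L) t : E) * g t = 0 :=
      (Fintype.linearCombination_apply L g e).symm.trans h3
    simp only [← hP, mul_assoc]
    rw [← Finset.mul_sum, h4, mul_zero]
  have hP0 : ∃ t, P t ≠ 0 := by
    by_contra! h
    apply he0
    ext t
    have h3 := hP t
    rw [h t, map_zero] at h3
    exact (mul_eq_zero.1 h3).resolve_left hQ
  letI : NormalizedGCDMonoid (MvPolynomial I K) := Classical.choice inferInstance
  obtain ⟨t₀, ht₀⟩ := hP0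
  obtain ⟨κ, hκ, hκ1⟩ := Finset.extract_gcd P (s := Finset.univ) ⟨t₀, Finset.mem_univ _⟩
  have hd : Finset.univ.gcd P ≠ 0 := by
    intro h
    exact ht₀ (by rw [hκ _ (Finset.mem_univ _), h, zero_mul])
  have hκt₀ : κ t₀ ≠ 0 := by
    intro h
    exact ht₀ (by rw [hκ _ (Finset.mem_univ _), h, mul_zero])
  have hκrel : ∑ t, aeval y (κ t) * g t = 0 := by
    have h3 : aeval y (Finset.univ.gcd P) * ∑ t, aeval y (κ t) * g t = 0 := by
      rw [← hPrel, Finset.mul_sum]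
      refine Finset.sum_congr rfl fun t _ => ?_
      rw [hκ t (Finset.mem_univ _), map_mul, mul_assoc]
    refine (mul_eq_zero.1 h3).resolve_left fun h => hd (hinj ?_)
    rw [h, map_zero]
  refine ⟨κ, ⟨t₀, hκt₀⟩, hκrel, fun v hv => ?_⟩
  have hdvd : κ t₀ ∣ v t₀ := by
    have h3 : κ t₀ ∣ Finset.univ.gcd fun t => v t₀ * κ t :=
      Finset.dvd_gcd fun t _ => ⟨v t, by rw [hcross κ v hκrel hv t₀ t]; ring⟩
    have h4 := h3.trans (Finset.gcd_mul_left' Finset.univ κ (v t₀)).dvd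
    rwa [hκ1, mul_one] at h4
  obtain ⟨b, hb⟩ := hdvd
  refine ⟨b, fun t => mul_left_cancel₀ hκt₀ ?_⟩
  rw [hcross κ v hκrel hv t₀ t, hb]
  ring

end GenericProjection

namespace GenericProjection

section Specialize

variable {k : Type*} [Field k] {n : ℕ} (β : Fin n → k)

/-- The linear form `X_{j+1} - β_j X_0`. -/
def lineForm (j : Fin n) : MvPolynomial (Fin (n + 1)) k := X j.succ - C (β j) * X 0

/-- The substitution of `β_j X_0` for `X_{j+1}`, for `j < i`. -/
def lineSubst (i : ℕ) : MvPolynomial (Fin (n + 1)) k →ₐ[k] MvPolynomial (Fin (n + 1)) k :=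
  aeval (Fin.cons (X 0) fun j : Fin n => if (j : ℕ) < i then C (β j) * X 0 else X j.succ)

/-- The ideal generated by the forms `lineForm β j`, for `j < i`. -/
def lineIdeal (i : ℕ) : Ideal (MvPolynomial (Fin (n + 1)) k) :=
  Ideal.span {p | ∃ j : Fin n, (j : ℕ) < i ∧ lineForm β j = p}

theorem lineSubst_X_zero (i : ℕ) : lineSubst β i (X 0) = X 0 := by
  rw [lineSubst, aeval_X, Fin.cons_zero]

theorem lineSubst_X_succ (i : ℕ) (j : Fin n) : lineSubst β i (X j.succ) =
    if (j : ℕ) < i then C (β j) * X 0 else X j.succ := by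
  rw [lineSubst, aeval_X, Fin.cons_succ]

theorem lineSubst_C (i : ℕ) (a : k) : lineSubst β i (C a) = C a := by
  rw [lineSubst, aeval_C]; rfl

theorem lineSubst_lineForm (i : ℕ) (j : Fin n) : lineSubst β i (lineForm β j) =
    if (j : ℕ) < i then 0 else lineForm β j := by
  rw [lineForm, map_sub, map_mul, lineSubst_X_succ, lineSubst_X_zero, lineSubst_C]
  split_ifs
  · rw [sub_self]
  · rfl

theorem sub_lineSubst_mem (i : ℕ) (p : MvPolynomial (Fin (n + 1)) k) :
    p - lineSubst β i p ∈ lineIdeal β i := by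
  induction p using MvPolynomial.induction_on with
  | C a => rw [lineSubst_C, sub_self]; exact zero_mem _
  | add p q hp hq =>
    rw [map_add, add_sub_add_comm]
    exact add_mem hp hq
  | mul_X p j hp =>
    have h1 : X j - lineSubst β i (X j) ∈ lineIdeal β i := by
      refine Fin.cases ?_ (fun j => ?_) j
      · rw [lineSubst_X_zero, sub_self]; exact zero_mem _
      · rw [lineSubst_X_succ]
        split_ifs with hj
        · exact Ideal.subset_span ⟨j, hj, rfl⟩
        · rw [sub_self]; exact zero_mem _
    have h2 : p * X j - lineSubst β i (p * X j) =
        X j * (p - lineSubst β i p) + lineSubst β i p * (X j - lineSubst β i (X j)) := by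
      rw [map_mul]; ring
    rw [h2]
    exact add_mem (Ideal.mul_mem_left _ _ hp) (Ideal.mul_mem_left _ _ h1)

theorem mem_lineIdeal_iff {i : ℕ} {p : MvPolynomial (Fin (n + 1)) k} :
    p ∈ lineIdeal β i ↔ lineSubst β i p = 0 := by
  refine ⟨fun h => ?_, fun h => ?_⟩
  · have h1 : lineIdeal β i ≤ RingHom.ker (lineSubst β i) := by
      rw [lineIdeal, Ideal.span_le]
      rintro _ ⟨j, hj, rfl⟩
      rw [SetLike.mem_coe, RingHom.mem_ker, lineSubst_lineForm, if_pos hj]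
    exact h1 h
  · have h1 := sub_lineSubst_mem β i p
    rwa [h, sub_zero] at h1

theorem lineSubst_idem (i : ℕ) (p : MvPolynomial (Fin (n + 1)) k) :
    lineSubst β i (lineSubst β i p) = lineSubst β i p := by
  have h := (mem_lineIdeal_iff β).1 (sub_lineSubst_mem β i p)
  rw [map_sub, sub_eq_zero] at h
  exact h.symm

theorem eval_lineSubst {a : Fin (n + 1) → k} (ha : ∀ j, a (Fin.succ j) = β j * a 0) (i : ℕ)
    (p : MvPolynomial (Fin (n + 1)) k) : eval a (lineSubst β i p) = eval a p := by
  have h1 : lineIdeal β i ≤ RingHom.ker (eval a) := by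
    rw [lineIdeal, Ideal.span_le]
    rintro _ ⟨j, -, rfl⟩
    rw [SetLike.mem_coe, RingHom.mem_ker, lineForm, map_sub, map_mul, eval_X, eval_X, eval_C, ha,
      sub_self]
  have h2 := h1 (sub_lineSubst_mem β i p)
  rw [RingHom.mem_ker, map_sub, sub_eq_zero] at h2
  exact h2.symm

theorem X_zero_dvd_lineSubst {p : MvPolynomial (Fin (n + 1)) k} (hp : constantCoeff p = 0) :
    X 0 ∣ lineSubst β n p := by
  have h : ∀ p : MvPolynomial (Fin (n + 1)) k,
      (X 0 : MvPolynomial (Fin (n + 1)) k) ∣ lineSubst β n p - C (constantCoeff p) := by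
    intro p
    induction p using MvPolynomial.induction_on with
    | C a => rw [lineSubst_C, constantCoeff_C, sub_self]; exact dvd_zero _
    | add p q hp hq =>
      rw [map_add, map_add, map_add, add_sub_add_comm]
      exact dvd_add hp hq
    | mul_X p j hp =>
      rw [map_mul, map_mul, constantCoeff_X, mul_zero, map_zero, sub_zero]
      refine Dvd.dvd.mul_left ?_ _
      refine Fin.cases ?_ (fun j => ?_) j
      · rw [lineSubst_X_zero]
      · rw [lineSubst_X_succ, if_pos j.2]
        exact Dvd.intro_left _ rfl
  have h1 := h p
  rwa [hp, map_zero, sub_zero] at h1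

theorem exists_sub_mul_mem {i : Fin n} {b : MvPolynomial (Fin (n + 1)) k}
    (hb : b ∈ lineIdeal β (i + 1)) : ∃ c, b - c * lineForm β i ∈ lineIdeal β i := by
  have h : lineIdeal β (i + 1) ≤ Ideal.span {lineForm β i} ⊔ lineIdeal β i := by
    rw [lineIdeal, Ideal.span_le]
    rintro _ ⟨j, hj, rfl⟩
    rcases (Nat.lt_succ_iff_lt_or_eq.1 hj) with h | h
    · exact Ideal.mem_sup_right (Ideal.subset_span ⟨j, h, rfl⟩)
    · rw [Fin.ext h]
      exact Ideal.mem_sup_left (Ideal.mem_span_singleton_self _)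
  obtain ⟨u, hu, v, hv, rfl⟩ := Submodule.mem_sup.1 (h hb)
  obtain ⟨c, rfl⟩ := Ideal.mem_span_singleton'.1 hu
  exact ⟨c, by rwa [add_sub_cancel_left]⟩

end Specialize

section OneRelation

variable {A R J : Type*} [CommRing A] [CommRing R] [Fintype J] (φ : A →+* R) {g : J → R}

theorem exists_sum_of_mem_map (hg : ∀ r, ∃ b : J → A, r = ∑ t, φ (b t) * g t) {I : Ideal A} {r : R}
    (hr : r ∈ I.map φ) : ∃ b : J → A, (∀ t, b t ∈ I) ∧ r = ∑ t, φ (b t) * g t := by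
  have h : ∀ u, ∃ b : J → A, (∀ t, b t ∈ I) ∧ u * r = ∑ t, φ (b t) * g t := by
    refine Submodule.span_induction (p := fun r _ => ∀ u, ∃ b : J → A, (∀ t, b t ∈ I) ∧
      u * r = ∑ t, φ (b t) * g t) ?_ ?_ ?_ ?_ hr
    · rintro _ ⟨a, ha, rfl⟩ u
      obtain ⟨b, rfl⟩ := hg u
      refine ⟨fun t => a * b t, fun t => I.mul_mem_right _ ha, ?_⟩
      rw [Finset.sum_mul]
      exact Finset.sum_congr rfl fun t _ => by rw [map_mul]; ring
    · exact fun u => ⟨0, fun t => zero_mem _, by simp⟩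
    · intro x y _ _ hx hy u
      obtain ⟨b, hb, hb'⟩ := hx u
      obtain ⟨c, hc, hc'⟩ := hy u
      refine ⟨fun t => b t + c t, fun t => add_mem (hb t) (hc t), ?_⟩
      simp only [mul_add, hb', hc', map_add, add_mul, Finset.sum_add_distrib]
    · intro a x _ hx u
      obtain ⟨b, hb, hb'⟩ := hx (u * a)
      exact ⟨b, hb, by rw [smul_eq_mul, ← mul_assoc, hb']⟩
  obtain ⟨b, hb, hb'⟩ := h 1
  exact ⟨b, hb, by rw [← hb', one_mul]⟩

theorem sum_mem_map {I : Ideal A} {b : J → A} (hb : ∀ t, b t ∈ I) :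
    ∑ t, φ (b t) * g t ∈ I.map φ :=
  Submodule.sum_mem _ fun t _ => Ideal.mul_mem_right _ _ (Ideal.mem_map_of_mem φ (hb t))

end OneRelation

open RingTheory.Sequence in
/-- A ring with a presentation by one relation over a polynomial ring in `n + 1` variables has a
regular sequence of length `n`, whose quotient has a socle. -/
theorem exists_isWeaklyRegular_of_relation {k R J : Type*} [Field k] [Infinite k] [CommRing R]
    [Algebra k R] [Fintype J] {n : ℕ} {y : Fin (n + 1) → R} {g : J → R}
    (hg : ∀ r, ∃ b : J → MvPolynomial (Fin (n + 1)) k, r = ∑ t, aeval y (b t) * g t)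
    {κ : J → MvPolynomial (Fin (n + 1)) k} (hκ0 : ∃ t, κ t ≠ 0)
    (hκ : ∑ t, aeval y (κ t) * g t = 0)
    (hκu : ∀ v : J → MvPolynomial (Fin (n + 1)) k, ∑ t, aeval y (v t) * g t = 0 →
      ∃ b, ∀ t, v t = b * κ t)
    (hκc : ∀ t, constantCoeff (κ t) = 0) :
    ∃ ls : List R, ls.length = n ∧ (∀ l ∈ ls, l ∈ Submodule.span k (Set.range y)) ∧
      IsWeaklyRegular R ls ∧ ∃ s ∉ Ideal.ofList ls, ∀ i, y i * s ∈ Ideal.ofList ls := by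
  obtain ⟨t₀, ht₀⟩ := hκ0
  obtain ⟨a, ha⟩ : ∃ a, eval a (κ t₀ * X 0) ≠ 0 := by
    by_contra! h
    exact mul_ne_zero ht₀ (X_ne_zero 0) (MvPolynomial.funext fun a => by rw [h, map_zero])
  rw [map_mul, eval_X] at ha
  have ha0 : a 0 ≠ 0 := right_ne_zero_of_mul ha
  set β : Fin n → k := fun j => a j.succ / a 0 with hβ
  have haβ : ∀ j, a (Fin.succ j) = β j * a 0 := fun j => by rw [hβ]; field_simp
  have hκρ : ∀ i, lineSubst β i (κ t₀) ≠ 0 := by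
    intro i h
    have h1 := eval_lineSubst β haβ i (κ t₀)
    rw [h, map_zero] at h1
    exact ha (by rw [← h1, zero_mul])
  let φ : MvPolynomial (Fin (n + 1)) k →+* R := (aeval y : MvPolynomial (Fin (n + 1)) k →ₐ[k] R)
  have hφ : ∀ p, φ p = aeval y p := fun p => rfl
  let ls : List R := List.ofFn fun j => φ (lineForm β j)
  have hlen : ls.length = n := List.length_ofFn
  have htake : ∀ i, Ideal.ofList (ls.take i) = (lineIdeal β i).map φ := by
    intro i
    rw [lineIdeal, Ideal.map_span]
    refine congrArg _ (Set.ext fun r => ?_)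
    simp only [Set.mem_setOf_eq, List.mem_take_iff_getElem, Set.mem_image]
    constructor
    · rintro ⟨j, hj, rfl⟩
      refine ⟨_, ⟨⟨j, by omega⟩, by simp only; omega, rfl⟩, by simp [ls]⟩
    · rintro ⟨_, ⟨j, hj, rfl⟩, rfl⟩
      exact ⟨j, by have := j.2; omega, by simp [ls]⟩
  have hall : Ideal.ofList ls = (lineIdeal β n).map φ := by
    rw [← htake, List.take_of_length_le hlen.le]
  refine ⟨ls, hlen, ?_, ?_, ?_⟩
  · intro l hl
    obtain ⟨j, rfl⟩ := (List.mem_ofFn' _ _).1 hl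
    have h1 : φ (lineForm β j) = y j.succ - β j • y 0 := by
      rw [hφ, lineForm, map_sub, map_mul, aeval_X, aeval_X, aeval_C, Algebra.smul_def]
    change φ (lineForm β j) ∈ _
    rw [h1]
    exact sub_mem (Submodule.subset_span ⟨_, rfl⟩)
      (Submodule.smul_mem _ _ (Submodule.subset_span ⟨_, rfl⟩))
  · rw [isWeaklyRegular_iff_mem]
    intro i hi r hr
    rw [htake] at hr ⊢
    have hi' : i < n := hlen ▸ hi
    have hlsi : ls[i] = φ (lineForm β ⟨i, hi'⟩) := by simp [ls]
    rw [hlsi] at hr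
    obtain ⟨u, rfl⟩ := hg r
    obtain ⟨w, hw, hw'⟩ := exists_sum_of_mem_map φ hg hr
    obtain ⟨b, hb⟩ := hκu (fun t => lineForm β ⟨i, hi'⟩ * u t - w t) (by
      simp only [map_sub, sub_mul, Finset.sum_sub_distrib, map_mul]
      simp only [mul_assoc]
      rw [← Finset.mul_sum]
      exact sub_eq_zero.2 hw')
    have hb1 : b ∈ lineIdeal β (i + 1) := by
      rw [mem_lineIdeal_iff]
      have h1 := congrArg (lineSubst β (i + 1)) (hb t₀)
      rw [map_sub, map_mul, map_mul, lineSubst_lineForm, if_pos (Nat.lt_succ_self i), zero_mul,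
        (mem_lineIdeal_iff β).1 ((Ideal.span_mono (by
          rintro _ ⟨j, hj, rfl⟩
          exact ⟨j, by omega, rfl⟩) : lineIdeal β i ≤ lineIdeal β (i + 1)) (hw t₀)), sub_zero] at h1
      exact (mul_eq_zero.1 h1.symm).resolve_right (hκρ _)
    obtain ⟨c, hc⟩ := exists_sub_mul_mem β (i := ⟨i, hi'⟩) hb1
    have h2 : ∀ t, u t - c * κ t ∈ lineIdeal β i := by
      intro t
      rw [mem_lineIdeal_iff, map_sub, map_mul]
      have h1 := congrArg (lineSubst β i) (hb t)
      have h3 := (mem_lineIdeal_iff β).1 hc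
      rw [map_sub, map_mul, lineSubst_lineForm, if_neg (lt_irrefl i), sub_eq_zero] at h3
      rw [map_sub, map_mul, map_mul, lineSubst_lineForm, if_neg (lt_irrefl i),
        (mem_lineIdeal_iff β).1 (hw t), sub_zero, h3] at h1
      have h0 : lineForm β ⟨i, hi'⟩ ≠ 0 := by
        intro h
        have h4 := congrArg (eval (Function.update (0 : Fin (n + 1) → k) (Fin.succ ⟨i, hi'⟩) 1)) h
        simp [lineForm, Function.update_of_ne (Fin.succ_ne_zero _).symm] at h4
      refine sub_eq_zero.2 (mul_left_cancel₀ h0 ?_)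
      rw [h1]; ring
    have h3 := sum_mem_map φ (g := g) h2
    simp only [map_sub, map_mul, sub_mul, Finset.sum_sub_distrib, mul_assoc] at h3
    rw [← Finset.mul_sum] at h3
    simp only [hφ] at h3
    rwa [hκ, mul_zero, sub_zero] at h3
  · have hdvd : ∀ t, ∃ q, lineSubst β n (κ t) = X 0 * q := fun t => X_zero_dvd_lineSubst β (hκc t)
    choose q hq using hdvd
    have hqidem : ∀ t, lineSubst β n (q t) = q t := by
      intro t
      have h1 := lineSubst_idem β n (κ t)
      rw [hq, map_mul, lineSubst_X_zero] at h1
      exact mul_left_cancel₀ (X_ne_zero 0) h1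
    have hq0 : q t₀ ≠ 0 := by
      intro h
      exact hκρ n (by rw [hq, h, mul_zero])
    have hy0 : y 0 * ∑ t, φ (q t) * g t ∈ (lineIdeal β n).map φ := by
      have h1 := sum_mem_map φ (g := g) fun t => sub_lineSubst_mem β n (κ t)
      simp only [map_sub, sub_mul, Finset.sum_sub_distrib] at h1
      simp only [hφ, hq, map_mul, aeval_X] at h1
      rw [hκ, zero_sub, neg_mem_iff] at h1
      simp only [mul_assoc] at h1
      rwa [← Finset.mul_sum] at h1
    refine ⟨∑ t, φ (q t) * g t, ?_, ?_⟩
    · rw [hall]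
      intro h
      obtain ⟨w, hw, hw'⟩ := exists_sum_of_mem_map φ hg h
      obtain ⟨b, hb⟩ := hκu (fun t => q t - w t) (by
        simp only [map_sub, sub_mul, Finset.sum_sub_distrib]
        exact sub_eq_zero.2 hw')
      have h1 := congrArg (lineSubst β n) (hb t₀)
      rw [map_sub, hqidem, (mem_lineIdeal_iff β).1 (hw t₀), sub_zero, map_mul, hq,
        ← mul_assoc] at h1
      have h2 : lineSubst β n b * X 0 = 1 :=
        mul_right_cancel₀ hq0 (by rw [one_mul, ← h1])
      have h3 := congrArg constantCoeff h2
      rw [map_mul, constantCoeff_X, mul_zero, map_one] at h3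
      exact zero_ne_one h3
    · intro i
      rw [hall]
      refine Fin.cases hy0 (fun j => ?_) i
      have h1 : y j.succ = φ (lineForm β j) + algebraMap k R (β j) * y 0 := by
        rw [hφ, lineForm, map_sub, map_mul, aeval_X, aeval_X, aeval_C, sub_add_cancel]
      rw [h1, add_mul, mul_assoc]
      exact add_mem (Ideal.mul_mem_right _ _
        (Ideal.mem_map_of_mem φ (Ideal.subset_span ⟨j, j.2, rfl⟩))) (Ideal.mul_mem_left _ _ hy0)

end GenericProjection

namespace GenericProjection

section Graded

variable {k R S : Type*} [Field k] [CommRing R] [Algebra k R] [Fintype S] {X : S → R}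

theorem exists_components (htop : Algebra.adjoin k (Set.range X) = ⊤) (r : R) :
    ∃ (N : ℕ) (f : ℕ → R), (∀ m, f m ∈ Submodule.span k (Set.range X) ^ m) ∧
      (∀ m, N ≤ m → f m = 0) ∧ ∀ M, N ≤ M → ∑ m ∈ Finset.range M, f m = r := by
  have hr : r ∈ Algebra.adjoin k (Set.range X) := htop ▸ Algebra.mem_top
  rw [Algebra.adjoin_range_eq_range_aeval] at hr
  obtain ⟨p, rfl⟩ := hr
  refine ⟨p.totalDegree + 1, fun m => aeval X (homogeneousComponent m p), fun m => ?_, ?_, ?_⟩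
  · exact (mem_span_pow_iff X m _).2 ⟨_, homogeneousComponent_isHomogeneous m p, rfl⟩
  · intro m hm
    simp only
    rw [homogeneousComponent_eq_zero _ _ (by omega), map_zero]
  · intro M hM
    rw [← map_sum, sum_range_homogeneousComponent p (by omega)]
    rfl

theorem exists_graded_relation (htop : Algebra.adjoin k (Set.range X) = ⊤)
    (hgr : IndepPowers (Submodule.span k (Set.range X))) {I : Type*} [Fintype I] {u : I → R}
    (hu : ∀ i, u i ∈ Submodule.span k (Set.range X)) {e : ℕ → R}
    (he : ∀ m, e m ∈ Submodule.span k (Set.range X) ^ m) {M : ℕ} {ρ : I → R}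
    (heM : ∀ m, M ≤ m → e m = 0) (h : ∑ m ∈ Finset.range M, e m + ∑ i, u i * ρ i = 0) :
    ∃ f : ℕ → I → R, (∀ m i, f m i ∈ Submodule.span k (Set.range X) ^ m) ∧ e 0 = 0 ∧
      ∀ m, e (m + 1) + ∑ i, u i * f m i = 0 := by
  choose N f hf hfN hfs using fun i => exists_components htop (ρ i)
  set B := M + Finset.univ.sup N with hB
  have hNB : ∀ i, N i ≤ B := fun i => (Finset.le_sup (Finset.mem_univ i)).trans (by omega)
  let F : ℕ → R := fun m => Nat.casesOn m 0 fun m => ∑ i, u i * f i m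
  have hsum : ∀ L, B ≤ L → ∑ m ∈ Finset.range (L + 1), (e m + F m) = 0 := by
    intro L hL
    rw [Finset.sum_add_distrib]
    have h1 : ∑ m ∈ Finset.range (L + 1), e m = ∑ m ∈ Finset.range M, e m := by
      refine (Finset.sum_subset (Finset.range_mono (by omega)) fun m _ hm => heM m ?_).symm
      simpa using hm
    have h2 : ∑ m ∈ Finset.range (L + 1), F m = ∑ i, u i * ρ i := by
      rw [Finset.sum_range_succ', show F 0 = 0 from rfl, add_zero]
      change ∑ m ∈ Finset.range L, ∑ i, u i * f i m = _
      rw [Finset.sum_comm]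
      exact Finset.sum_congr rfl fun i _ => by
        rw [← Finset.mul_sum, hfs i L ((hNB i).trans hL)]
    rw [h1, h2, h]
  have hmem : ∀ m, e m + F m ∈ Submodule.span k (Set.range X) ^ m := by
    intro m
    refine add_mem (he m) ?_
    cases m with
    | zero => exact zero_mem _
    | succ m =>
      refine Submodule.sum_mem _ fun i _ => ?_
      rw [pow_succ']
      exact Submodule.mul_mem_mul (hu i) (hf i m)
  have hz : ∀ m, e m + F m = 0 := fun m =>
    hgr (Finset.range (B + m + 1)) _ (fun m _ => hmem m) (hsum _ (by omega)) m
      (Finset.mem_range.2 (by omega))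
  refine ⟨fun m i => f i m, fun m i => hf i m, ?_, fun m => hz (m + 1)⟩
  have := hz 0
  simpa [F] using this

theorem span_range_ne_top [Nontrivial R] (htop : Algebra.adjoin k (Set.range X) = ⊤)
    (hgr : IndepPowers (Submodule.span k (Set.range X))) : Ideal.span (Set.range X) ≠ ⊤ := by
  rw [Ne, Ideal.eq_top_iff_one, Ideal.mem_span_range_iff_exists_fun]
  rintro ⟨ρ, hρ⟩
  obtain ⟨f, -, h0, -⟩ := exists_graded_relation htop hgr (u := X)
    (fun i => Submodule.subset_span ⟨i, rfl⟩) (e := fun m => if m = 0 then -1 else 0) (M := 1)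
    (ρ := ρ) (fun m => by
      split_ifs with h
      · rw [h, pow_zero]; exact neg_mem (Submodule.one_le.1 le_rfl)
      · exact zero_mem _) (fun m hm => if_neg (by omega)) (by
      rw [Finset.sum_range_one, if_pos rfl, ← hρ, ← Finset.sum_neg_distrib,
        ← Finset.sum_add_distrib]
      exact Finset.sum_eq_zero fun i _ => by ring)
  rw [if_pos rfl, neg_eq_zero] at h0
  exact one_ne_zero h0

end Graded

section Module

variable {k R J I : Type*} [Field k] [CommRing R] [Algebra k R] [Fintype J] (y : I → R) (g : J → R)

/-- The submodule over the subalgebra generated by `y` that is generated by `g`. -/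
def genModule : Submodule k R :=
  LinearMap.range (∑ t, (LinearMap.mulRight k (g t)).comp
    ((aeval y : MvPolynomial I k →ₐ[k] R).toLinearMap.comp (LinearMap.proj t)) :
      (J → MvPolynomial I k) →ₗ[k] R)

theorem mem_genModule_iff {r : R} :
    r ∈ genModule (k := k) y g ↔ ∃ b : J → MvPolynomial I k, r = ∑ t, aeval y (b t) * g t := by
  rw [genModule, LinearMap.mem_range]
  refine exists_congr fun b => ?_
  rw [eq_comm]
  simp [LinearMap.sum_apply]

theorem mem_genModule [DecidableEq J] (t : J) : g t ∈ genModule (k := k) y g := by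
  rw [mem_genModule_iff]
  refine ⟨Pi.single t 1, ?_⟩
  rw [Finset.sum_eq_single t]
  · simp
  · intro s _ hs
    simp [Pi.single_eq_of_ne hs]
  · simp

theorem span_mul_genModule_le : Submodule.span k (Set.range y) * genModule y g ≤ genModule y g := by
  rw [Submodule.mul_le]
  intro a ha r hr
  obtain ⟨b, rfl⟩ := (mem_genModule_iff y g).1 hr
  rw [mem_genModule_iff]
  obtain ⟨p, -, rfl⟩ := (mem_span_pow_iff y 1 a).1 (by rwa [pow_one])
  refine ⟨fun t => p * b t, ?_⟩
  rw [Finset.mul_sum]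
  exact Finset.sum_congr rfl fun t _ => by rw [map_mul, mul_assoc]

end Module

theorem finrank_span_mul_le {k R I J : Type*} [Field k] [CommRing R] [Algebra k R] [Fintype I]
    [Fintype J] (y : I → R) (z : J → R) :
    Module.finrank k (Submodule.span k (Set.range y) * (Submodule.span k (Set.range y) ⊔
      Submodule.span k (Set.range z)) : Submodule k R) ≤
      (Fintype.card I + 1).choose 2 + Fintype.card I * Fintype.card J := by
  classical
  rw [Submodule.mul_sup]
  have f1 : Module.Finite k (Submodule.span k (Set.range y)) :=
    Module.Finite.span_of_finite k (Set.finite_range _)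
  have f2 : Module.Finite k (Submodule.span k (Set.range z)) :=
    Module.Finite.span_of_finite k (Set.finite_range _)
  have h1 : Submodule.span k (Set.range y) * Submodule.span k (Set.range y) =
      (homogeneousSubmodule I k 2).map (aeval y : MvPolynomial I k →ₐ[k] R).toLinearMap := by
    rw [map_homogeneousSubmodule, pow_two]
  have h2 : Submodule.span k (Set.range y) * Submodule.span k (Set.range z) =
      Submodule.span k (Set.range fun ij : I × J => y ij.1 * z ij.2) := by
    rw [Submodule.span_mul_span]
    congr 1
    ext r
    simp [Set.mem_mul]
  have f3 : Module.Finite k (homogeneousSubmodule I k 2) :=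
    Module.Finite.iff_fg.2 (homogeneousSubmodule_fg I k 2)
  have f4 : Module.Finite k (Submodule.span k (Set.range fun ij : I × J => y ij.1 * z ij.2)) :=
    Module.Finite.span_of_finite k (Set.finite_range _)
  have f5 : Module.Finite k ((homogeneousSubmodule I k 2).map
    (aeval y : MvPolynomial I k →ₐ[k] R).toLinearMap) := Module.Finite.map _ _
  rw [h1, h2]
  refine (Submodule.finrank_add_le_finrank_add_finrank _ _).trans (add_le_add ?_ ?_)
  · refine (Submodule.finrank_map_le _ _).trans (le_of_eq ?_)
    rw [finrank_homogeneousSubmodule]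
    rfl
  · refine (finrank_range_le_card _).trans (le_of_eq ?_)
    rw [Fintype.card_prod]

/-- If `W` has codimension `3` in a space generated by `W` and three elements, then these elements
are independent modulo `W`. -/
theorem eq_zero_of_sum_mem {k V : Type*} [Field k] [AddCommGroup V] [Module k V]
    {W U : Submodule k V} [Module.Finite k W] {N m : ℕ} {r : Fin (m + 1) → V}
    (hU : U ≤ W ⊔ Submodule.span k (Set.range r)) (hW : Module.finrank k W ≤ N)
    (hN : N + (m + 1) ≤ Module.finrank k U) {a : Fin (m + 1) → k} (ha : ∑ i, a i • r i ∈ W) (i) :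
    a i = 0 := by
  by_contra h
  have f1 : Module.Finite k (Submodule.span k (Set.range (r ∘ i.succAbove))) :=
    Module.Finite.span_of_finite k (Set.finite_range _)
  have hri : r i ∈ W ⊔ Submodule.span k (Set.range (r ∘ i.succAbove)) := by
    rw [Fin.sum_univ_succAbove _ i] at ha
    have h1 : r i = (a i)⁻¹ • ((a i • r i + ∑ j, a (i.succAbove j) • r (i.succAbove j)) -
        ∑ j, a (i.succAbove j) • r (i.succAbove j)) := by
      rw [add_sub_cancel_right, smul_smul, inv_mul_cancel₀ h, one_smul]
    rw [h1]
    exact Submodule.smul_mem _ _ (sub_mem (Submodule.mem_sup_left ha) (Submodule.mem_sup_right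
      (Submodule.sum_mem _ fun j _ => Submodule.smul_mem _ _ (Submodule.subset_span ⟨j, rfl⟩))))
  have hle : U ≤ W ⊔ Submodule.span k (Set.range (r ∘ i.succAbove)) := by
    refine hU.trans (sup_le le_sup_left (Submodule.span_le.2 ?_))
    rintro _ ⟨j, rfl⟩
    rcases Fin.eq_self_or_eq_succAbove i j with rfl | ⟨j, rfl⟩
    · exact hri
    · exact Submodule.mem_sup_right (Submodule.subset_span ⟨j, rfl⟩)
  have h2 := Submodule.finrank_mono hle
  have h3 := Submodule.finrank_add_le_finrank_add_finrank W
    (Submodule.span k (Set.range (r ∘ i.succAbove)))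
  have h4 := finrank_range_le_card (R := k) (r ∘ i.succAbove)
  rw [Set.finrank, Fintype.card_fin] at h4
  omega

end GenericProjection

namespace GenericProjection

section FractionField

variable {k R E : Type*} [Field k] [CommRing R] [Algebra k R] [Field E] [Algebra k E]
  [Algebra R E] [IsScalarTower k R E]

theorem map_toAlgHom_span_range_pow {S : Type*} (X : S → R) (m : ℕ) :
    (Submodule.span k (Set.range X) ^ m).map (IsScalarTower.toAlgHom k R E).toLinearMap =
      Submodule.span k (Set.range fun s => algebraMap R E (X s)) ^ m := by
  rw [Submodule.map_pow, Submodule.map_span, ← Set.range_comp]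
  rfl

theorem map_toAlgHom_span_range {S : Type*} (X : S → R) :
    (Submodule.span k (Set.range X)).map (IsScalarTower.toAlgHom k R E).toLinearMap =
      Submodule.span k (Set.range fun s => algebraMap R E (X s)) := by
  rw [Submodule.map_span, ← Set.range_comp]
  rfl

theorem IndepPowers.map_toAlgHom {S : Type*} {X : S → R}
    (h : IndepPowers (Submodule.span k (Set.range X)))
    (hinj : Function.Injective (algebraMap R E)) :
    IndepPowers (Submodule.span k (Set.range fun s => algebraMap R E (X s))) := by
  intro s g hg hsum m hm
  have hex : ∀ m, ∃ f : R, m ∈ s → f ∈ Submodule.span k (Set.range X) ^ m ∧ algebraMap R E f = g m := by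
    intro m
    by_cases hm : m ∈ s
    · have := hg m hm
      rw [← map_toAlgHom_span_range_pow] at this
      obtain ⟨f, hf, hfg⟩ := this
      exact ⟨f, fun _ => ⟨hf, hfg⟩⟩
    · exact ⟨0, fun h => absurd h hm⟩
  choose f hf using hex
  rw [← (hf m hm).2, h s f (fun m hm => (hf m hm).1) (hinj ?_) m hm, map_zero]
  rw [map_sum, map_zero, ← hsum]
  exact Finset.sum_congr rfl fun m hm => (hf m hm).2

theorem adjoin_algebraMap_eq_top [IsFractionRing R E] {S : Type*} {X : S → R}
    (h : Algebra.adjoin k (Set.range X) = ⊤) :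
    IntermediateField.adjoin k (Set.range fun s => algebraMap R E (X s)) = ⊤ := by
  refine top_unique fun e _ => ?_
  have hR : ∀ r : R, algebraMap R E r ∈
      IntermediateField.adjoin k (Set.range fun s => algebraMap R E (X s)) := by
    intro r
    have hr : r ∈ Algebra.adjoin k (Set.range X) := h ▸ Algebra.mem_top
    refine Algebra.adjoin_induction ?_ ?_ ?_ ?_ hr
    · rintro _ ⟨s, rfl⟩
      exact IntermediateField.subset_adjoin _ _ ⟨s, rfl⟩
    · intro a
      rw [← IsScalarTower.algebraMap_apply k R E]
      exact IntermediateField.algebraMap_mem _ a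
    · intro a b _ _ ha hb; rw [map_add]; exact add_mem ha hb
    · intro a b _ _ ha hb; rw [map_mul]; exact mul_mem ha hb
  obtain ⟨p, q, -, rfl⟩ := IsFractionRing.div_surjective (A := R) e
  exact div_mem (hR p) (hR q)

end FractionField

section ScalarProj

variable {k R : Type*} [Field k] [CommRing R] [Algebra k R] {n c : ℕ} (X : Fin (n + 1) ⊕ Fin c → R)
  (w₀ : Fin (n + 1) × Fin c → k)

theorem scalarProj_mem (i) : scalarProj X w₀ i ∈ Submodule.span k (Set.range X) :=
  add_mem (Submodule.subset_span ⟨_, rfl⟩) (Submodule.sum_mem _ fun _ _ =>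
    Submodule.smul_mem _ _ (Submodule.subset_span ⟨_, rfl⟩))

theorem span_range_eq_sup : Submodule.span k (Set.range X) =
    Submodule.span k (Set.range (scalarProj X w₀)) ⊔
      Submodule.span k (Set.range fun j => X (.inr j)) := by
  have hz : ∀ j, X (.inr j) ∈ Submodule.span k (Set.range fun j => X (.inr j)) :=
    fun j => Submodule.subset_span ⟨j, rfl⟩
  refine le_antisymm (Submodule.span_le.2 ?_) (sup_le (Submodule.span_le.2 ?_)
    (Submodule.span_le.2 ?_))
  · rintro _ ⟨i | j, rfl⟩
    · have h : X (.inl i) = scalarProj X w₀ i - ∑ j, w₀ (i, j) • X (.inr j) := by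
        rw [scalarProj, add_sub_cancel_right]
      rw [h]
      exact sub_mem (Submodule.mem_sup_left (Submodule.subset_span ⟨i, rfl⟩))
        (Submodule.mem_sup_right (Submodule.sum_mem _ fun j _ => Submodule.smul_mem _ _ (hz j)))
    · exact Submodule.mem_sup_right (hz j)
  · rintro _ ⟨i, rfl⟩
    exact scalarProj_mem X w₀ i
  · rintro _ ⟨j, rfl⟩
    exact Submodule.subset_span ⟨_, rfl⟩

variable {X}

theorem eq_zero_of_scalarProj_relation (hX : LinearIndependent k X) {a : Fin (n + 1) → k}
    {b : Fin c → k} (h : ∑ i, a i • scalarProj X w₀ i + ∑ j, b j • X (.inr j) = 0) :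
    (∀ i, a i = 0) ∧ ∀ j, b j = 0 := by
  have h1 : ∑ s, (Sum.elim a fun j => b j + ∑ i, a i * w₀ (i, j)) s • X s = 0 := by
    rw [Fintype.sum_sum_type, ← h]
    simp only [Sum.elim_inl, Sum.elim_inr, scalarProj, smul_add, Finset.sum_add_distrib, add_smul,
      Finset.smul_sum, Finset.sum_smul, mul_smul]
    rw [Finset.sum_comm]
    ring
  have h2 := Fintype.linearIndependent_iff.1 hX _ h1
  have ha : ∀ i, a i = 0 := fun i => h2 (.inl i)
  refine ⟨ha, fun j => ?_⟩
  have := h2 (.inr j)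
  simpa [ha] using this

theorem scalarProj_ne_zero (hX : LinearIndependent k X) (i) : scalarProj X w₀ i ≠ 0 := by
  classical
  intro h
  have := (eq_zero_of_scalarProj_relation w₀ hX (a := Pi.single i 1) (b := 0) (by
    simp [Pi.single_apply, ite_smul, h])).1 i
  simp at this

end ScalarProj

theorem aeval_sub_mem_span {k R I : Type*} [Field k] [CommRing R] [Algebra k R] (y : I → R)
    (p : MvPolynomial I k) :
    aeval y p - algebraMap k R (constantCoeff p) ∈ Ideal.span (Set.range y) := by
  induction p using MvPolynomial.induction_on with
  | C a => simp
  | add p q hp hq =>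
    rw [map_add, map_add, map_add, add_sub_add_comm]
    exact add_mem hp hq
  | mul_X p i hp =>
    rw [map_mul, map_mul, aeval_X, constantCoeff_X, mul_zero, map_zero, sub_zero]
    exact Ideal.mul_mem_left _ _ (Ideal.subset_span ⟨i, rfl⟩)

section Generators

variable {k R : Type*} [Field k] [CommRing R] [Algebra k R] {n c : ℕ}
  {X : Fin (n + 1) ⊕ Fin c → R} {w₀ : Fin (n + 1) × Fin c → k} {r : Fin 3 → R}

variable (X r) in
/-- The generators `1`, the last coordinates, and three elements `r` of degree two. -/
def gens : Unit ⊕ Fin c ⊕ Fin 3 → R :=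
  Sum.elim (fun _ => 1) (Sum.elim (fun j => X (.inr j)) r)

theorem pow_le_genModule
    (h2 : Submodule.span k (Set.range X) ^ 2 ≤ Submodule.span k (Set.range (scalarProj X w₀)) *
        Submodule.span k (Set.range X) ⊔ Submodule.span k (Set.range r))
    (h3 : Submodule.span k (Set.range X) ^ 3 ≤ Submodule.span k (Set.range (scalarProj X w₀)) *
        Submodule.span k (Set.range X) ^ 2) (m : ℕ) :
    Submodule.span k (Set.range X) ^ m ≤ genModule (scalarProj X w₀) (gens X r) := by
  have hY := span_mul_genModule_le (k := k) (scalarProj X w₀) (gens X r)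
  have hG := mem_genModule (k := k) (scalarProj X w₀) (gens X r)
  have e0 : (1 : Submodule k R) ≤ genModule (scalarProj X w₀) (gens X r) :=
    Submodule.one_le.2 (hG (.inl ()))
  have e1 : Submodule.span k (Set.range X) ≤ genModule (scalarProj X w₀) (gens X r) := by
    rw [span_range_eq_sup X w₀]
    refine sup_le ?_ (Submodule.span_le.2 ?_)
    · refine le_trans ?_ hY
      calc Submodule.span k (Set.range (scalarProj X w₀))
          = Submodule.span k (Set.range (scalarProj X w₀)) * 1 := (mul_one _).symm
        _ ≤ _ := mul_le_mul' le_rfl e0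
    · rintro _ ⟨j, rfl⟩
      exact hG (.inr (.inl j))
  have e2 : Submodule.span k (Set.range X) ^ 2 ≤ genModule (scalarProj X w₀) (gens X r) := by
    refine h2.trans (sup_le ((mul_le_mul' le_rfl e1).trans hY) (Submodule.span_le.2 ?_))
    rintro _ ⟨a, rfl⟩
    exact hG (.inr (.inr a))
  have e3 : ∀ m, Submodule.span k (Set.range X) ^ (m + 2) ≤
      genModule (scalarProj X w₀) (gens X r) := by
    intro m
    induction m with
    | zero => exact e2
    | succ m ih =>
      calc Submodule.span k (Set.range X) ^ (m + 1 + 2)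
          = Submodule.span k (Set.range X) ^ 3 * Submodule.span k (Set.range X) ^ m := by
            rw [← pow_add]; congr 1; omega
        _ ≤ Submodule.span k (Set.range (scalarProj X w₀)) *
            Submodule.span k (Set.range X) ^ 2 * Submodule.span k (Set.range X) ^ m :=
            mul_le_mul' h3 le_rfl
        _ = Submodule.span k (Set.range (scalarProj X w₀)) *
            Submodule.span k (Set.range X) ^ (m + 2) := by
            rw [mul_assoc, ← pow_add, add_comm 2 m]
        _ ≤ _ := (mul_le_mul' le_rfl ih).trans hY
  match m with
  | 0 => exact (pow_zero _).trans_le e0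
  | 1 => exact (pow_one _).trans_le e1
  | m + 2 => exact e3 m

theorem constantCoeff_eq_zero_of_relation (hX : IsConeRing k X)
    (hr : ∀ a, r a ∈ Submodule.span k (Set.range X) ^ 2)
    (h2 : Submodule.span k (Set.range X) ^ 2 ≤ Submodule.span k (Set.range (scalarProj X w₀)) *
        Submodule.span k (Set.range X) ⊔ Submodule.span k (Set.range r)) [Nontrivial R]
    {κ : Unit ⊕ Fin c ⊕ Fin 3 → MvPolynomial (Fin (n + 1)) k}
    (hκ : ∑ t, aeval (scalarProj X w₀) (κ t) * gens X r t = 0) (t) :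
    constantCoeff (κ t) = 0 := by
  set y := scalarProj X w₀ with hy
  set V := Submodule.span k (Set.range X) with hV
  have hmem : ∑ t, constantCoeff (κ t) • gens X r t ∈ Ideal.span (Set.range y) := by
    have h1 : ∑ t, (aeval y (κ t) - algebraMap k R (constantCoeff (κ t))) * gens X r t ∈
        Ideal.span (Set.range y) :=
      Ideal.sum_mem _ fun t _ => Ideal.mul_mem_right _ _ (aeval_sub_mem_span y (κ t))
    simp only [sub_mul, Finset.sum_sub_distrib, hκ, zero_sub, neg_mem_iff] at h1
    simpa only [Algebra.smul_def] using h1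
  obtain ⟨ρ, hρ⟩ := Ideal.mem_span_range_iff_exists_fun.1 (neg_mem hmem)
  rw [Fintype.sum_sum_type, Fintype.sum_sum_type] at hρ
  simp only [gens, Sum.elim_inl, Sum.elim_inr, Finset.univ_unique, Finset.sum_singleton] at hρ
  let e : ℕ → R := fun m => match m with
    | 0 => constantCoeff (κ (.inl ())) • 1
    | 1 => ∑ j, constantCoeff (κ (.inr (.inl j))) • X (.inr j)
    | 2 => ∑ a, constantCoeff (κ (.inr (.inr a))) • r a
    | _ + 3 => 0
  obtain ⟨f, hf, h0, hsucc⟩ := exists_graded_relation hX.adjoin_eq_top hX.graded (u := y)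
    (scalarProj_mem X w₀) (e := e) (M := 3) (ρ := ρ) (fun m => by
      match m with
      | 0 => exact Submodule.smul_mem _ _ (by rw [pow_zero]; exact Submodule.one_le.1 le_rfl)
      | 1 =>
        rw [pow_one]
        exact Submodule.sum_mem _ fun j _ => Submodule.smul_mem _ _
          (Submodule.subset_span ⟨_, rfl⟩)
      | 2 => exact Submodule.sum_mem _ fun a _ => Submodule.smul_mem _ _ (hr a)
      | _ + 3 => exact zero_mem _)
    (fun m hm => by
      match m with
      | m + 3 => rfl
      | 0 | 1 | 2 => omega) (by
      simp only [Finset.sum_range_succ, Finset.sum_range_zero, e, zero_add]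
      rw [Finset.sum_congr rfl fun i _ => mul_comm (y i) (ρ i), hρ]
      simp only [PUnit.default_eq_unit]
      ring)
  rcases t with ⟨⟩ | j | a
  · have : constantCoeff (κ (.inl ())) • (1 : R) = 0 := h0
    exact (smul_eq_zero.1 this).resolve_right one_ne_zero
  · have h1 := hsucc 0
    have hex : ∀ i, ∃ a : k, algebraMap k R a = f 0 i := fun i => by
      have := hf 0 i
      rw [pow_zero] at this
      exact Submodule.mem_one.1 this
    choose a ha using hex
    refine (eq_zero_of_scalarProj_relation w₀ hX.linearIndependent (a := a)
      (b := fun j => constantCoeff (κ (.inr (.inl j)))) ?_).2 j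
    rw [← h1, add_comm]
    simp only [← ha, Algebra.smul_def, zero_add, e]
    congr 1
    exact Finset.sum_congr rfl fun i _ => mul_comm _ _
  · have h1 := hsucc 1
    have f1 : Module.Finite k V := Module.Finite.span_of_finite k (Set.finite_range _)
    have f2 : Module.Finite k (Submodule.span k (Set.range y)) :=
      Module.Finite.span_of_finite k (Set.finite_range _)
    have f3 : Module.Finite k (Submodule.span k (Set.range y) * V : Submodule k R) :=
      Module.Finite.iff_fg.2 ((Module.Finite.iff_fg.1 f2).mul (Module.Finite.iff_fg.1 f1))
    refine eq_zero_of_sum_mem (m := 2) h2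
      (N := (n + 1 + 1).choose 2 + (n + 1) * c) ?_ ?_
      (a := fun a => constantCoeff (κ (.inr (.inr a)))) ?_ a
    · have := finrank_span_mul_le (k := k) y fun j => X (.inr j)
      rw [← span_range_eq_sup X w₀] at this
      simpa using this
    · exact hX.finrank_sq.ge
    · have h2 : ∑ a, constantCoeff (κ (.inr (.inr a))) • r a = -∑ i, y i * f 1 i :=
        eq_neg_of_add_eq_zero_left h1
      rw [h2]
      refine neg_mem (Submodule.sum_mem _ fun i _ => Submodule.mul_mem_mul
        (Submodule.subset_span ⟨i, rfl⟩) ?_)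
      have := hf 1 i
      rwa [pow_one] at this

end Generators

end GenericProjection

namespace GenericProjection

theorem finite_adjoin_scalarProj {k R E : Type*} [Field k] [CommRing R] [Algebra k R] [Field E]
    [Algebra k E] [Algebra R E] [IsScalarTower k R E] [IsFractionRing R E] {n c : ℕ}
    {X : Fin (n + 1) ⊕ Fin c → R} {y : Fin (n + 1) → R} {g : Unit ⊕ Fin c ⊕ Fin 3 → R}
    (hX : IsConeRing k X) (hinj : Function.Injective (algebraMap R E))
    (hy : ∀ i, y i ∈ Submodule.span k (Set.range X)) (hy0 : y 0 ≠ 0)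
    (h3 : Submodule.span k (Set.range X) ^ 3 ≤ Submodule.span k (Set.range y) *
        Submodule.span k (Set.range X) ^ 2)
    (hg : Submodule.span k (Set.range X) ^ 2 ≤ genModule y g) :
    AlgebraicIndependent k (fun i => algebraMap R E (y i)) ∧
    Submodule.span (IntermediateField.adjoin k (Set.range fun i => algebraMap R E (y i)))
      (Set.range fun t => algebraMap R E (g t)) = ⊤ ∧
    Module.finrank (IntermediateField.adjoin k (Set.range fun i => algebraMap R E (y i))) E =
      c + 3 := by
  have hyE : ∀ i, algebraMap R E (y i) ∈
      Submodule.span k (Set.range fun s => algebraMap R E (X s)) := by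
    intro i
    rw [← map_toAlgHom_span_range]
    exact ⟨y i, hy i, rfl⟩
  have hy0E : algebraMap R E (y 0) ≠ 0 := (map_ne_zero_iff _ hinj).2 hy0
  have hstep : ∀ m, 2 ≤ m → Submodule.span k (Set.range fun s => algebraMap R E (X s)) ^ (m + 1) ≤
      Submodule.span k (Set.range fun i => algebraMap R E (y i)) *
        Submodule.span k (Set.range fun s => algebraMap R E (X s)) ^ m := by
    intro m hm
    obtain ⟨m, rfl⟩ := Nat.exists_eq_add_of_le hm
    rw [← map_toAlgHom_span_range_pow, ← map_toAlgHom_span_range_pow, ← map_toAlgHom_span_range,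
      ← Submodule.map_mul]
    refine Submodule.map_mono ?_
    calc Submodule.span k (Set.range X) ^ (2 + m + 1)
        = Submodule.span k (Set.range X) ^ 3 * Submodule.span k (Set.range X) ^ m := by
          rw [← pow_add]; congr 1; omega
      _ ≤ Submodule.span k (Set.range y) * Submodule.span k (Set.range X) ^ 2 *
          Submodule.span k (Set.range X) ^ m := mul_le_mul' h3 le_rfl
      _ = _ := by rw [mul_assoc, ← pow_add]
  have hgen := adjoin_algebraMap_eq_top (E := E) hX.adjoin_eq_top
  obtain ⟨hfin, htop⟩ := span_pow_eq_top hyE hy0E hstep hgen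
  have hind : AlgebraicIndependent k (fun i => algebraMap R E (y i)) := by
    obtain ⟨t, ht⟩ := hX.exists_basis
    have ht2 : AlgebraicIndependent k (fun i => algebraMap R E (t i)) :=
      ht.1.map' (f := IsScalarTower.toAlgHom k R E) hinj
    exact algebraicIndependent_of_card_eq ht2 rfl (Algebra.IsAlgebraic.of_finite _ E)
  refine ⟨hind, ?_, ?_⟩
  · rw [eq_top_iff, ← htop, Submodule.span_le]
    intro u hu
    rw [← map_toAlgHom_span_range_pow] at hu
    obtain ⟨v, hv, rfl⟩ := hu
    obtain ⟨b, rfl⟩ := (mem_genModule_iff y g).1 (hg hv)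
    change algebraMap R E _ ∈ _
    rw [map_sum]
    refine Submodule.sum_mem _ fun t _ => ?_
    rw [map_mul, ← MvPolynomial.aeval_algebraMap_apply]
    have hb : aeval (fun i => algebraMap R E (y i)) (b t) ∈
        IntermediateField.adjoin k (Set.range fun i => algebraMap R E (y i)) :=
      IntermediateField.algebra_adjoin_le_adjoin _ _ (by
        rw [Algebra.adjoin_range_eq_range_aeval]
        exact ⟨b t, rfl⟩)
    exact Submodule.smul_mem _ (⟨_, hb⟩ :
      IntermediateField.adjoin k (Set.range fun i => algebraMap R E (y i)))
      (Submodule.subset_span ⟨t, rfl⟩)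
  · refine finrank_adjoin_eq (n := n) (hX.graded.map_toAlgHom hinj) hyE hind hstep hgen ?_
    refine hX.growth.congr fun m => ?_
    rw [← map_toAlgHom_span_range_pow]
    congr 3
    exact (LinearEquiv.finrank_eq (Submodule.equivMapOfInjective
      (IsScalarTower.toAlgHom k R E).toLinearMap hinj _))

theorem exists_isWeaklyRegular {k R : Type} [Field k] [CharZero k] [CommRing R] [IsDomain R]
    [Algebra k R] {n c : ℕ} {X : Fin (n + 1) ⊕ Fin c → R} (hc : 4 ≤ c) (hX : IsConeRing k X) :
    ∃ ls : List R, ls.length = n ∧ (∀ l ∈ ls, l ∈ Submodule.span k (Set.range X)) ∧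
      RingTheory.Sequence.IsRegular R ls ∧
      ∀ fs : List R, RingTheory.Sequence.IsRegular R fs →
        (∀ f ∈ fs, f ∈ Ideal.span (Set.range X)) → fs.length ≤ n := by
  obtain ⟨w₀, r, hr, h2, h3⟩ := exists_generators hc hX
  have hgm := pow_le_genModule h2 h3
  have hy := scalarProj_mem X w₀
  have hinj : Function.Injective (algebraMap R (FractionRing R)) :=
    IsFractionRing.injective R (FractionRing R)
  obtain ⟨hind, hspan, hrank⟩ := finite_adjoin_scalarProj (E := FractionRing R) hX hinj hy
    (scalarProj_ne_zero w₀ hX.linearIndependent 0) h3 (hgm 2)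
  obtain ⟨κ, hκ0, hκ, hκu⟩ := exists_primitive_relation hind hspan (by
    rw [hrank]
    simp only [Fintype.card_sum, Fintype.card_unit, Fintype.card_fin]
    omega)
  have hrel : ∀ v : Unit ⊕ Fin c ⊕ Fin 3 → MvPolynomial (Fin (n + 1)) k,
      ∑ t, aeval (fun i => algebraMap R (FractionRing R) (scalarProj X w₀ i)) (v t) *
        algebraMap R (FractionRing R) (gens X r t) =
      algebraMap R (FractionRing R) (∑ t, aeval (scalarProj X w₀) (v t) * gens X r t) := by
    intro v
    rw [map_sum]
    exact Finset.sum_congr rfl fun t _ => by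
      rw [map_mul, ← MvPolynomial.aeval_algebraMap_apply]
      rfl
  rw [hrel, map_eq_zero_iff _ hinj] at hκ
  have hne := span_range_ne_top hX.adjoin_eq_top hX.graded
  have hinf : Infinite k := inferInstance
  obtain ⟨ls, hlen, hls, hreg, s, hs, hys⟩ := exists_isWeaklyRegular_of_relation (g := gens X r)
    (y := scalarProj X w₀) (fun a => by
      rw [← mem_genModule_iff]
      obtain ⟨N, f, hf, -, hsum⟩ := exists_components hX.adjoin_eq_top a
      rw [← hsum N le_rfl]
      exact Submodule.sum_mem _ fun m _ => hgm m (hf m)) hκ0 hκ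
    (fun v hv => hκu v (by rw [hrel, hv, map_zero]))
    (constantCoeff_eq_zero_of_relation hX hr h2 hκ)
  have hlsX : ∀ l ∈ ls, l ∈ Submodule.span k (Set.range X) := fun l hl =>
    Submodule.span_le.2 (by rintro _ ⟨i, rfl⟩; exact hy i) (hls l hl)
  have hspanI : ∀ l ∈ Submodule.span k (Set.range X), l ∈ Ideal.span (Set.range X) :=
    fun l hl => Submodule.span_le_restrictScalars k R _ hl
  have hft : Algebra.FiniteType k R := ⟨Subalgebra.fg_def.2
    ⟨_, Set.finite_range X, hX.adjoin_eq_top⟩⟩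
  have hnoeth : IsNoetherianRing R := Algebra.FiniteType.isNoetherianRing k R
  refine ⟨ls, hlen, hlsX, ⟨hreg, ?_⟩, fun fs hfs hfm => ?_⟩
  · intro h
    refine hne (top_unique ?_)
    rw [h, smul_eq_mul, Ideal.mul_top]
    exact Ideal.span_le.2 fun l hl => hspanI l (hlsX l hl)
  · rw [← hlen]
    refine length_le_of_isRegular (J := Ideal.span (Set.range (scalarProj X w₀)))
      hne ?_ hreg hs ?_ hfs hfm
    · rw [Ideal.span_le]
      rintro _ ⟨t, rfl⟩
      change X t ∈ Ideal.radical _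
      rw [Ideal.mem_radical_iff]
      refine ⟨3, ?_⟩
      have hXt : X t ∈ Submodule.span k (Set.range X) := Submodule.subset_span ⟨t, rfl⟩
      have hX3 : X t ^ 3 ∈ Submodule.span k (Set.range X) ^ 3 :=
        Submodule.pow_mem_pow _ hXt 3
      have hle : Submodule.span k (Set.range (scalarProj X w₀)) *
          Submodule.span k (Set.range X) ^ 2 ≤
          (Ideal.span (Set.range (scalarProj X w₀))).restrictScalars k :=
        Submodule.mul_le.2 fun a ha b _ =>
          Ideal.mul_mem_right _ _ (Submodule.span_le_restrictScalars k R _ ha)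
      exact hle (h3 hX3)
    · intro a ha
      induction ha using Submodule.span_induction with
      | mem a ha => obtain ⟨i, rfl⟩ := ha; exact hys i
      | zero => rw [zero_mul]; exact zero_mem _
      | add a b _ _ ha hb => rw [add_mul]; exact add_mem ha hb
      | smul q a _ ha => rw [smul_eq_mul, mul_assoc]; exact Ideal.mul_mem_left _ _ ha

end GenericProjection

namespace GenericProjection

theorem ringKrullDim_eq_of_isIntegral (A B : Type*) [CommRing A] [CommRing B] [IsDomain B] [Algebra A B]
    [Algebra.IsIntegral A B] (hinj : Function.Injective (algebraMap A B)) :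
    ringKrullDim B = ringKrullDim A := by
  refine le_antisymm ?_ (iSup_le fun l => ?_)
  · refine Order.krullDim_le_of_strictMono (PrimeSpectrum.comap (algebraMap A B)) ?_
    intro P Q hPQ
    exact Ideal.IsIntegral.comap_lt_comap (I := P.asIdeal) (J := Q.asIdeal) hPQ
  · obtain ⟨P, hP, hPl⟩ := Ideal.exists_ideal_over_prime_of_isIntegral_of_isDomain
      (S := B) l.head.asIdeal (by
        rw [(RingHom.injective_iff_ker_eq_bot _).1 hinj]
        exact bot_le)
    have hlo : P.LiesOver l.head.asIdeal := ⟨hPl.symm⟩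
    obtain ⟨L, hL, -, -⟩ := Ideal.exists_ltSeries_of_hasGoingUp l P
    rw [← hL]
    exact Order.LTSeries.length_le_krullDim L

theorem exists_isTranscendenceBasis_of_ringKrullDim (k : Type*) {A : Type*} [Field k] [CommRing A]
    [IsDomain A] [Algebra k A] [Algebra.FiniteType k A] {d : ℕ} (hd : ringKrullDim A = d) :
    ∃ t : Fin d → A, IsTranscendenceBasis k t := by
  obtain ⟨s, g, hinj, hintegral⟩ := exists_integral_inj_algHom_of_fg k A
  obtain rfl : s = d := by
    letI := g.toRingHom.toAlgebra
    have h1 : Algebra.IsIntegral (MvPolynomial (Fin s) k) A := ⟨hintegral⟩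
    rw [ringKrullDim_eq_of_isIntegral (MvPolynomial (Fin s) k) A hinj,
      MvPolynomial.ringKrullDim_of_isNoetherianRing, ringKrullDim_eq_zero_of_field, zero_add,
      Nat.card_eq_fintype_card, Fintype.card_fin] at hd
    exact_mod_cast hd
  have hga : aeval (fun i => g (X i)) = g := by
    ext i
    simp
  refine ⟨fun i => g (X i), isTranscendenceBasis_iff_algebraicIndependent_isAlgebraic.2 ⟨?_, ?_⟩⟩
  · rw [AlgebraicIndependent, hga]
    exact hinj
  · refine ⟨fun a => IsIntegral.isAlgebraic ?_⟩
    obtain ⟨p, hp, hpa⟩ := hintegral a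
    have hmem : ∀ q, g q ∈ Algebra.adjoin k (Set.range fun i => g (X i)) := fun q => by
      rw [Algebra.adjoin_range_eq_range_aeval, hga]
      exact ⟨q, rfl⟩
    refine ⟨p.map (g.codRestrict _ hmem : _ →ₐ[k] _).toRingHom, hp.map _, ?_⟩
    rw [Polynomial.eval₂_map]
    exact hpa

theorem eval_smul_of_isHomogeneous {k ι : Type*} [CommRing k] {p : MvPolynomial ι k} {m : ℕ}
    (hp : p.IsHomogeneous m) (t : k) (x : ι → k) : eval (t • x) p = t ^ m * eval x p := by
  rw [eval_eq, eval_eq, Finset.mul_sum]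
  refine Finset.sum_congr rfl fun d hd => ?_
  have hdm : ∑ i ∈ d.support, d i = m := by
    rw [← hp.degree_eq_sum_deg_support hd]
  simp only [Pi.smul_apply, smul_eq_mul, mul_pow, Finset.prod_mul_distrib]
  rw [Finset.prod_pow_eq_pow_sum, hdm]
  ring

section Quotient

variable {k ι : Type*} [Field k] [Fintype ι] (I : Ideal (MvPolynomial ι k))

theorem aeval_mk_X (p : MvPolynomial ι k) :
    aeval (fun i => Ideal.Quotient.mk I (X i)) p = Ideal.Quotient.mk I p := by
  have : aeval (fun i => Ideal.Quotient.mk I (X i)) = Ideal.Quotient.mkₐ k I := by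
    ext i
    simp
  rw [this]
  rfl

theorem adjoin_range_mk_X :
    Algebra.adjoin k (Set.range fun i => Ideal.Quotient.mk I (X i)) = ⊤ := by
  rw [Algebra.adjoin_range_eq_range_aeval, eq_top_iff]
  intro a _
  obtain ⟨p, rfl⟩ := Ideal.Quotient.mk_surjective a
  exact ⟨p, aeval_mk_X I p⟩

theorem finrank_span_range_mk_X_pow (m : ℕ) :
    Module.finrank k (Submodule.span k (Set.range fun i => Ideal.Quotient.mk I (X i)) ^ m :
      Submodule k (MvPolynomial ι k ⧸ I)) = Module.finrank k (homogeneousSubmodule ι k m) -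
      Module.finrank k (Submodule.restrictScalars k I ⊓ homogeneousSubmodule ι k m :
        Submodule k (MvPolynomial ι k)) := by
  have hfin : Module.Finite k (homogeneousSubmodule ι k m) :=
    Module.Finite.iff_fg.2 (homogeneousSubmodule_fg ι k m)
  set φ := (aeval (fun i => Ideal.Quotient.mk I (X i)) :
    MvPolynomial ι k →ₐ[k] MvPolynomial ι k ⧸ I).toLinearMap with hφ
  have hker : LinearMap.ker φ = Submodule.restrictScalars k I := by
    ext p
    rw [LinearMap.mem_ker, Submodule.restrictScalars_mem, ← Ideal.Quotient.eq_zero_iff_mem,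
      ← aeval_mk_X]
    rfl
  have h := (φ.domRestrict (homogeneousSubmodule ι k m)).finrank_range_add_finrank_ker
  rw [LinearMap.range_domRestrict, LinearMap.ker_domRestrict, hφ, map_homogeneousSubmodule, ← hφ,
    hker, ← Submodule.finrank_map_subtype_eq, Submodule.map_comap_subtype,
    inf_comm] at h
  omega

variable {I}

theorem mem_span_range_mk_X_iff {f : MvPolynomial ι k} (hI : ∀ f ∈ I, coeff 0 f = 0) :
    Ideal.Quotient.mk I f ∈ Ideal.span (Set.range fun i => Ideal.Quotient.mk I (X i)) ↔
      coeff 0 f = 0 := by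
  have hX : Ideal.span (Set.range fun i => Ideal.Quotient.mk I (X i)) =
      (Ideal.span (Set.range X)).map (Ideal.Quotient.mk I) := by
    rw [Ideal.map_span, ← Set.range_comp]
    rfl
  have h0 : ∀ f : MvPolynomial ι k, f ∈ Ideal.span (Set.range X) ↔ coeff 0 f = 0 := by
    intro f
    constructor
    · intro hf
      have hle : Ideal.span (Set.range X) ≤ RingHom.ker (constantCoeff (R := k) (σ := ι)) :=
        Ideal.span_le.2 (by rintro _ ⟨i, rfl⟩; exact constantCoeff_X k i)
      exact hle hf
    · intro hf
      have h := aeval_sub_mem_span (k := k) (X : ι → MvPolynomial ι k) f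
      rw [constantCoeff_eq, hf, map_zero, sub_zero, aeval_X_left_apply] at h
      exact h
  rw [hX, Ideal.mem_map_iff_of_surjective _ Ideal.Quotient.mk_surjective]
  constructor
  · rintro ⟨g, hg, hgf⟩
    have h1 := hI _ (Ideal.Quotient.eq.1 hgf)
    rw [coeff_sub, (h0 g).1 hg, zero_sub, neg_eq_zero] at h1
    exact h1
  · intro hf
    exact ⟨f, (h0 f).2 hf, rfl⟩

theorem indepPowers_of_cone [Infinite k] {C : Set (ι → k)} (hC : ∀ x ∈ C, ∀ t : k, t • x ∈ C)
    (hI : ∀ f, f ∈ I ↔ ∀ x ∈ C, eval x f = 0) :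
    IndepPowers (Submodule.span k (Set.range fun i => Ideal.Quotient.mk I (X i))) := by
  intro s g hg hsum
  have hex : ∀ m, ∃ p : MvPolynomial ι k, m ∈ s →
      p.IsHomogeneous m ∧ Ideal.Quotient.mk I p = g m := by
    intro m
    by_cases hm : m ∈ s
    · obtain ⟨p, hp, hpg⟩ := (mem_span_pow_iff _ m _).1 (hg m hm)
      exact ⟨p, fun _ => ⟨hp, by rw [← aeval_mk_X, hpg]⟩⟩
    · exact ⟨0, fun h => absurd h hm⟩
  choose p hp using hex
  have hmem : ∑ m ∈ s, p m ∈ I := by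
    rw [← Ideal.Quotient.eq_zero_iff_mem, map_sum, ← hsum]
    exact Finset.sum_congr rfl fun m hm => (hp m hm).2
  intro m hm
  rw [← (hp m hm).2, Ideal.Quotient.eq_zero_iff_mem, hI]
  intro x hx
  have hpoly : ∑ m ∈ s, Polynomial.monomial m (eval x (p m)) = 0 := by
    refine Polynomial.funext fun t => ?_
    rw [Polynomial.eval_zero, ← (hI _).1 hmem _ (hC x hx t), map_sum, Polynomial.eval_finset_sum]
    refine Finset.sum_congr rfl fun m hm => ?_
    rw [Polynomial.eval_monomial, mul_comm, eval_smul_of_isHomogeneous (hp m hm).1]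
  have := congrArg (fun q => Polynomial.coeff q m) hpoly
  simpa [Polynomial.finset_sum_coeff, Polynomial.coeff_monomial, hm] using this

end Quotient

end GenericProjection

namespace GenericProjection

theorem mem_vanIdeal_iff {k ι : Type} [Field k] [Fintype ι] [DecidableEq ι] {C : Set (ι → k)}
    {f : MvPolynomial ι k} : f ∈ vanIdeal k ι C ↔ ∀ x ∈ C, eval x f = 0 := by
  simp [vanIdeal, Ideal.mem_iInf, RingHom.mem_ker]

theorem choose_two_sub (n c : ℕ) (hc : 4 ≤ c) :
    (n + c + 1 + 2 - 1).choose 2 - ((c + 1).choose 2 - 3) =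
      (n + 2).choose 2 + (n + 1) * c + 3 := by
  have key : ∀ a : ℕ, (a + 1).choose 2 * 2 = (a + 1) * a := fun a => by
    have h := Finset.sum_range_id_mul_two (a + 1)
    rwa [Finset.sum_range_id, ← Nat.choose_two_right, Nat.add_sub_cancel] at h
  have h1 := key (n + c + 1)
  have h2 := key c
  have h3 := key (n + 1)
  rw [show n + c + 1 + 2 - 1 = n + c + 1 + 1 from rfl]
  have h4 : 3 ≤ (c + 1).choose 2 := by nlinarith
  have h5 : (n + c + 1 + 1).choose 2 =
      (n + 1 + 1).choose 2 + (n + 1) * c + (c + 1).choose 2 := by nlinarith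
  rw [show n + 2 = n + 1 + 1 from rfl]
  omega

/-- The homogeneous coordinates, split into two blocks. -/
def splitEquiv (n c : ℕ) : Fin (n + 1) ⊕ Fin c ≃ Fin (n + c + 1) :=
  finSumFinEquiv.trans (finCongr (by omega))

theorem isConeRing {k : Type} [Field k] [CharZero k] {n c : ℕ} (hc : 4 ≤ c)
    {C : Set (Fin (n + c + 1) → k)} (hV : IsProjVariety k (Fin (n + c + 1)) C)
    (hnd : Nondeg k (Fin (n + c + 1)) C) (hdim : HasDim k (Fin (n + c + 1)) C n)
    (hdeg : HasDegree k (Fin (n + c + 1)) C n (c + 3))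
    (ha : a2 k (Fin (n + c + 1)) C = Nat.choose (c + 1) 2 - 3) :
    IsConeRing k (fun s : Fin (n + 1) ⊕ Fin c =>
      Ideal.Quotient.mk (vanIdeal k (Fin (n + c + 1)) C) (X (splitEquiv n c s))) := by
  have hprime := hV.prime
  have hrange : (Set.range fun s : Fin (n + 1) ⊕ Fin c =>
      Ideal.Quotient.mk (vanIdeal k (Fin (n + c + 1)) C) (X (splitEquiv n c s))) =
      Set.range fun i => Ideal.Quotient.mk (vanIdeal k (Fin (n + c + 1)) C) (X i) :=
    (splitEquiv n c).surjective.range_comp fun i =>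
      Ideal.Quotient.mk (vanIdeal k (Fin (n + c + 1)) C) (X i)
  have hinf : Infinite k := inferInstance
  have hhilb : ∀ m, Module.finrank k (Submodule.span k (Set.range fun i =>
      Ideal.Quotient.mk (vanIdeal k (Fin (n + c + 1)) C) (X i)) ^ m :
      Submodule k (MvPolynomial (Fin (n + c + 1)) k ⧸ vanIdeal k (Fin (n + c + 1)) C)) =
      hilb k (Fin (n + c + 1)) C m := finrank_span_range_mk_X_pow _
  constructor
  · rw [hrange]
    exact adjoin_range_mk_X _
  · intro r hr
    obtain ⟨f, rfl⟩ := Ideal.Quotient.mk_surjective r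
    rw [Ne, Ideal.Quotient.eq_zero_iff_mem, mem_vanIdeal_iff] at hr
    push Not at hr
    obtain ⟨x, hx, hfx⟩ := hr
    refine ⟨Ideal.Quotient.liftₐ _ (aeval x) fun g hg => ?_, ?_⟩
    · rw [aeval_eq_eval]
      exact mem_vanIdeal_iff.1 hg x hx
    · exact hfx
  · rw [hrange]
    exact indepPowers_of_cone hV.smul_mem fun f => mem_vanIdeal_iff
  · rw [hrange]
    simp only [hhilb]
    exact hdeg
  · have hlin : LinearIndependent k fun i =>
        Ideal.Quotient.mk (vanIdeal k (Fin (n + c + 1)) C) (X i) := by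
      rw [Fintype.linearIndependent_iff]
      intro a hsum i
      have h1 : ∑ i, a i • (X i : MvPolynomial (Fin (n + c + 1)) k) = 0 := by
        refine hnd _ (Submodule.sum_mem _ fun i _ => Submodule.smul_mem _ _
          (isHomogeneous_X k i)) (mem_vanIdeal_iff.1 ?_)
        rw [← Ideal.Quotient.eq_zero_iff_mem, ← hsum, map_sum]
        rfl
      exact Fintype.linearIndependent_iff.1 (linearIndependent_X _ k) a h1 i
    exact hlin.comp _ (splitEquiv n c).injective
  · exact exists_isTranscendenceBasis_of_ringKrullDim k hdim
  · rw [hrange, hhilb]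
    change Module.finrank k (homogeneousSubmodule (Fin (n + c + 1)) k 2) -
      a2 k (Fin (n + c + 1)) C = _
    rw [ha, finrank_homogeneousSubmodule, Fintype.card_fin, choose_two_sub n c hc]

end GenericProjection

open GenericProjection

/-- Proposition 3.5. Let `X ⊆ ℙ^{n+c}` be nondegenerate irreducible of
dimension `n`, codimension `c ≥ 4` and degree `d = c + 3` with `a₂(X) = C(c+1,2) - 3`.
Then the arithmetic depth of `X` equals `n`. -/
theorem stmt_10 {k : Type} [Field k] [IsAlgClosed k] [CharZero k]
    (n c : ℕ) (hc : 4 ≤ c)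
    (C : Set (Fin (n + c + 1) → k))
    (hV : IsProjVariety k (Fin (n + c + 1)) C)
    (hnd : Nondeg k (Fin (n + c + 1)) C)
    (hdim : HasDim k (Fin (n + c + 1)) C n)
    (hdeg : HasDegree k (Fin (n + c + 1)) C n (c + 3))
    (ha : a2 k (Fin (n + c + 1)) C = Nat.choose (c + 1) 2 - 3) :
    arithDepth k (Fin (n + c + 1)) C = n := by
  have hX := isConeRing hc hV hnd hdim hdeg ha
  have hprime := hV.prime
  obtain ⟨ls, hlen, hls, hreg, hmax⟩ := exists_isWeaklyRegular hc hX
  have hrange : (Set.range fun s : Fin (n + 1) ⊕ Fin c =>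
      Ideal.Quotient.mk (vanIdeal k (Fin (n + c + 1)) C) (X (splitEquiv n c s))) =
      Set.range fun i => Ideal.Quotient.mk (vanIdeal k (Fin (n + c + 1)) C) (X i) :=
    (splitEquiv n c).surjective.range_comp fun i =>
      Ideal.Quotient.mk (vanIdeal k (Fin (n + c + 1)) C) (X i)
  rw [hrange] at hls hmax
  have hI : ∀ f ∈ vanIdeal k (Fin (n + c + 1)) C, coeff 0 f = 0 := fun f hf => by
    rw [← constantCoeff_eq, ← eval_zero]
    exact mem_vanIdeal_iff.1 hf 0 hV.zero_mem
  have hiff : ∀ fs : List (MvPolynomial (Fin (n + c + 1)) k),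
      IsRegSeqOn k (Fin (n + c + 1)) (vanIdeal k (Fin (n + c + 1)) C) fs ↔
      RingTheory.Sequence.IsRegular (MvPolynomial (Fin (n + c + 1)) k ⧸
        vanIdeal k (Fin (n + c + 1)) C)
        (fs.map (Ideal.Quotient.mk (vanIdeal k (Fin (n + c + 1)) C))) := fun fs => by
    rw [isRegular_map_iff _ Ideal.Quotient.mk_surjective, Ideal.mk_ker]
    rfl
  have hmem : n ∈ {l : ℕ | ∃ fs : List (MvPolynomial (Fin (n + c + 1)) k), fs.length = l ∧
      (∀ f ∈ fs, coeff 0 f = 0) ∧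
      IsRegSeqOn k (Fin (n + c + 1)) (vanIdeal k (Fin (n + c + 1)) C) fs} := by
    obtain ⟨fs, hfs⟩ : ∃ fs : List (MvPolynomial (Fin (n + c + 1)) k),
        fs.map (Ideal.Quotient.mk (vanIdeal k (Fin (n + c + 1)) C)) = ls :=
      List.map_surjective_iff.2 Ideal.Quotient.mk_surjective ls
    refine ⟨fs, (by rw [← hfs, List.length_map] : fs.length = ls.length).trans hlen, fun f hf => ?_, (hiff fs).2 (hfs ▸ hreg)⟩
    rw [← mem_span_range_mk_X_iff hI]
    exact Submodule.span_le_restrictScalars k _ _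
      (hls _ (hfs ▸ List.mem_map_of_mem hf))
  have hle : ∀ l ∈ {l : ℕ | ∃ fs : List (MvPolynomial (Fin (n + c + 1)) k), fs.length = l ∧
      (∀ f ∈ fs, coeff 0 f = 0) ∧
      IsRegSeqOn k (Fin (n + c + 1)) (vanIdeal k (Fin (n + c + 1)) C) fs}, l ≤ n := by
    rintro _ ⟨fs, rfl, hfs, hfr⟩
    rw [← List.length_map (Ideal.Quotient.mk (vanIdeal k (Fin (n + c + 1)) C))]
    refine hmax _ ((hiff fs).1 hfr) fun g hg => ?_
    obtain ⟨f, hf, rfl⟩ := List.mem_map.1 hg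
    exact (mem_span_range_mk_X_iff hI).2 (hfs f hf)
  exact le_antisymm (csSup_le ⟨n, hmem⟩ hle) (le_csSup ⟨n, hle⟩ hmem)
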